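/- (Siegel–Walfisz theorem.) Let C > 0 be given. Then there exists a constant D = D(C) > 0 such that for all x ≥ 2, all positive integers q ≤ (log x)^C, and all integers a with gcd(a,q) = 1, one has π(x;q,a) = (1/φ(q))·∫_2^x dt/log t + O(x·e^{−D·√(log x)}), with an implied constant depending only on C. -/

import Mathlib

open scoped Classical

/-- `π(y; q, a)`: number of primes `l ≤ y` with `l ≡ a (mod q)`. -/
noncomputable def primePiMod (y : ℝ) (q : ℕ) (a : ℤ) : ℕ :=
  ((Finset.Icc 1 ⌊y⌋₊).filter (fun n : ℕ => n.Prime ∧ (n : ℤ) ≡ a [ZMOD (q : ℤ)])).card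

namespace SiegelWalfisz

open Complex Filter Topology MeasureTheory Set Asymptotics
open ArithmeticFunction (vonMangoldt)
open ArithmeticFunction.vonMangoldt (residueClass residueClass_apply residueClass_nonneg residueClass_le)

/-- The integral `∫_1^∞ E(t) t^{-s-1} dt`. -/
noncomputable def tailMellin (E : ℝ → ℂ) (s : ℂ) : ℂ :=
  ∫ t in Ioi (1 : ℝ), E t * (t : ℂ) ^ (-(s + 1))

lemma norm_tailMellin_le {E : ℝ → ℂ} {K r : ℝ} (hE : ∀ t, 1 ≤ t → ‖E t‖ ≤ K * t ^ r)
    {s : ℂ} (hs : r < s.re) : ‖tailMellin E s‖ ≤ K / (s.re - r) := by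
  have hlt : r - s.re - 1 < -1 := by linarith
  have hint : IntegrableOn (fun t : ℝ => K * t ^ (r - s.re - 1)) (Ioi 1) :=
    (integrableOn_Ioi_rpow_of_lt hlt one_pos).const_mul K
  have h1 : ‖tailMellin E s‖ ≤ ∫ t in Ioi (1 : ℝ), K * t ^ (r - s.re - 1) := by
    refine norm_integral_le_of_norm_le hint ?_
    filter_upwards [ae_restrict_mem measurableSet_Ioi] with t ht
    have ht0 : 0 < t := one_pos.trans ht
    rw [norm_mul, norm_cpow_eq_rpow_re_of_pos ht0]
    have : (-(s + 1)).re = -s.re - 1 := by simp; ring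
    rw [this]
    calc ‖E t‖ * t ^ (-s.re - 1) ≤ K * t ^ r * t ^ (-s.re - 1) := by
          gcongr; exact hE t (le_of_lt ht)
      _ = K * t ^ (r - s.re - 1) := by
          rw [mul_assoc, ← Real.rpow_add ht0]; ring_nf
  refine h1.trans (le_of_eq ?_)
  rw [integral_const_mul, integral_Ioi_rpow_of_lt hlt one_pos, Real.one_rpow,
    show r - s.re - 1 + 1 = -(s.re - r) by ring, neg_div_neg_eq, mul_one_div]

lemma differentiableAt_tailMellin {E : ℝ → ℂ} (hEm : Measurable E) {K r : ℝ}
    (hE : ∀ t, 1 ≤ t → ‖E t‖ ≤ K * t ^ r) {s : ℂ} (hs : r < s.re) :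
    DifferentiableAt ℂ (tailMellin E) s := by
  set f : ℝ → ℂ := (Ioi (1 : ℝ)).indicator E with hf
  have hfE : tailMellin E = fun z => mellin f (-z) := by
    ext z
    rw [mellin, tailMellin]
    have : (fun t : ℝ => (t : ℂ) ^ (-z - 1) • f t) =
        (Ioi (1 : ℝ)).indicator (fun t : ℝ => E t * (t : ℂ) ^ (-(z + 1))) := by
      ext t
      by_cases ht : t ∈ Ioi (1 : ℝ)
      · simp only [hf, indicator_of_mem ht, smul_eq_mul, mul_comm]
        congr 2; ring
      · simp [hf, indicator_of_notMem ht]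
    rw [this, setIntegral_indicator measurableSet_Ioi,
      inter_eq_self_of_subset_right (Ioi_subset_Ioi zero_le_one)]
  have hK : 0 ≤ K := by
    have := (norm_nonneg _).trans (hE 1 le_rfl); simpa using this
  have hfm : Measurable f := hEm.indicator measurableSet_Ioi
  have hfb : ∀ t, 0 < t → ‖f t‖ ≤ K * t ^ r := by
    intro t ht
    by_cases h : t ∈ Ioi (1 : ℝ)
    · rw [hf, indicator_of_mem h]; exact hE t (le_of_lt h)
    · rw [hf, indicator_of_notMem h]; simp; positivity
  have hloc : LocallyIntegrableOn f (Ioi 0) := by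
    have hc : ContinuousOn (fun t : ℝ => K * t ^ r) (Ioi 0) := by
      refine continuousOn_const.mul (continuousOn_id.rpow_const fun t ht => Or.inl (ne_of_gt ht))
    refine (hc.locallyIntegrableOn measurableSet_Ioi).mono hfm.aestronglyMeasurable ?_
    refine Eventually.of_forall fun t => ?_
    rcases lt_or_ge 0 t with ht | ht
    · exact (hfb t ht).trans (Real.le_norm_self _)
    · rw [hf, indicator_of_notMem (by simp; linarith)]; simp; positivity
  rw [hfE]
  refine DifferentiableAt.fun_comp' (g := mellin f) (f := fun z : ℂ => -z) s ?_ differentiableAt_id.neg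
  refine mellin_differentiableAt_of_isBigO_rpow (a := -r) (b := (-s).re - 1) hloc ?_ (by simpa) ?_ (by simp)
  · refine IsBigO.of_bound K ?_
    filter_upwards [eventually_gt_atTop 0] with t ht
    rw [neg_neg, Real.norm_of_nonneg (by positivity)]
    exact hfb t ht
  · refine IsBigO.of_bound 0 ?_
    filter_upwards [Ioo_mem_nhdsGT (zero_lt_one (α := ℝ))] with t ht
    rw [hf, indicator_of_notMem (by simp; exact ht.2.le)]; simp

/-- Partial sums of a Dirichlet character. -/
noncomputable def charSum {q : ℕ} (χ : DirichletCharacter ℂ q) (t : ℝ) : ℂ :=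
  ∑ k ∈ Finset.Icc 1 ⌊t⌋₊, χ k

lemma measurable_charSum {q : ℕ} (χ : DirichletCharacter ℂ q) : Measurable (charSum χ) :=
  (measurable_from_nat (f := fun n : ℕ => ∑ k ∈ Finset.Icc 1 n, χ k)).comp Nat.measurable_floor

lemma norm_charSum_le_self {q : ℕ} (χ : DirichletCharacter ℂ q) {t : ℝ} (ht : 0 ≤ t) :
    ‖charSum χ t‖ ≤ t := by
  calc ‖charSum χ t‖ ≤ ∑ k ∈ Finset.Icc 1 ⌊t⌋₊, (1 : ℝ) :=
        norm_sum_le_of_le _ fun k _ => χ.norm_le_one _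
    _ = ⌊t⌋₊ := by simp
    _ ≤ t := Nat.floor_le ht

lemma sum_range_zmod {q : ℕ} [NeZero q] (f : ZMod q → ℂ) :
    ∑ k ∈ Finset.range q, f k = ∑ a, f a := by
  refine Finset.sum_bij (fun k _ => (k : ZMod q)) (by simp) ?_ ?_ (by simp)
  · intro a ha b hb h
    rw [ZMod.natCast_eq_natCast_iff'] at h
    rwa [Nat.mod_eq_of_lt (Finset.mem_range.1 ha), Nat.mod_eq_of_lt (Finset.mem_range.1 hb)] at h
  · intro b _
    exact ⟨b.val, Finset.mem_range.2 b.val_lt, by simp⟩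

lemma norm_sum_range_char_le {q : ℕ} [NeZero q] {χ : DirichletCharacter ℂ q} (hχ : χ ≠ 1) (n : ℕ) :
    ‖∑ k ∈ Finset.range n, χ k‖ ≤ q := by
  induction n using Nat.strong_induction_on with
  | _ n ih =>
    rcases le_or_gt n q with h | h
    · calc ‖∑ k ∈ Finset.range n, χ k‖ ≤ ∑ k ∈ Finset.range n, (1 : ℝ) :=
            norm_sum_le_of_le _ fun k _ => χ.norm_le_one _
        _ = n := by simp
        _ ≤ q := by exact_mod_cast h
    · obtain ⟨m, rfl⟩ := Nat.exists_eq_add_of_le h.le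
      rw [Finset.sum_range_add, sum_range_zmod, MulChar.sum_eq_zero_of_ne_one hχ, zero_add]
      simpa using ih m (by have := NeZero.pos q; omega)

lemma norm_charSum_le {q : ℕ} [NeZero q] {χ : DirichletCharacter ℂ q} (hχ : χ ≠ 1) (t : ℝ) :
    ‖charSum χ t‖ ≤ q := by
  have hq : q ≠ 1 := by rintro rfl; exact hχ (DirichletCharacter.level_one χ)
  have : charSum χ t = ∑ k ∈ Finset.range (⌊t⌋₊ + 1), χ k := by
    have := Fact.mk (lt_of_le_of_ne (NeZero.pos q) hq.symm)
    rw [Finset.sum_range_succ', charSum, Finset.range_eq_Ico, Finset.sum_Ico_add' (fun k : ℕ => χ (k : ZMod q))]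
    rw [Nat.cast_zero, MulChar.map_zero]
    simp [← Finset.Ico_add_one_right_eq_Icc]
  rw [this]; exact norm_sum_range_char_le hχ _

lemma norm_charSum_le_rpow {q : ℕ} [NeZero q] {χ : DirichletCharacter ℂ q} (hχ : χ ≠ 1)
    {θ : ℝ} (h0 : 0 ≤ θ) (h1 : θ ≤ 1) (t : ℝ) (ht : 1 ≤ t) :
    ‖charSum χ t‖ ≤ (q : ℝ) ^ θ * t ^ (1 - θ) := by
  have hn := norm_nonneg (charSum χ t)
  calc ‖charSum χ t‖ = ‖charSum χ t‖ ^ θ * ‖charSum χ t‖ ^ (1 - θ) := by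
        rw [← Real.rpow_add_of_nonneg hn h0 (by linarith)]; simp
    _ ≤ _ := mul_le_mul (Real.rpow_le_rpow hn (norm_charSum_le hχ t) h0)
        (Real.rpow_le_rpow hn (norm_charSum_le_self χ (by linarith)) (by linarith))
        (by positivity) (by positivity)

lemma LFunction_eq_mul_tailMellin {q : ℕ} [NeZero q] {χ : DirichletCharacter ℂ q} (hχ : χ ≠ 1)
    {s : ℂ} (hs : 0 < s.re) : χ.LFunction s = s * tailMellin (charSum χ) s := by
  have hU : IsOpen {z : ℂ | 0 < z.re} := isOpen_lt continuous_const continuous_re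
  have hb : ∀ t : ℝ, 1 ≤ t → ‖charSum χ t‖ ≤ q * t ^ (0 : ℝ) := by
    intro t _; simpa using norm_charSum_le hχ t
  refine AnalyticOnNhd.eqOn_of_preconnected_of_eventuallyEq (𝕜 := ℂ) (U := {z : ℂ | 0 < z.re}) (z₀ := 2)
    (f := χ.LFunction) (g := fun s => s * tailMellin (charSum χ) s) ?_ ?_ ?_ (by simp) ?_ hs
  · exact (DifferentiableOn.analyticOnNhd
      (DirichletCharacter.differentiable_LFunction hχ).differentiableOn hU)
  · refine DifferentiableOn.analyticOnNhd (fun z hz => ?_) hU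
    exact (differentiableAt_id.mul
      (differentiableAt_tailMellin (measurable_charSum χ) hb hz)).differentiableWithinAt
  · exact (convex_halfSpace_re_gt 0).isPreconnected
  · have : {z : ℂ | 1 < z.re} ∈ 𝓝 (2 : ℂ) :=
      (isOpen_lt continuous_const continuous_re).mem_nhds (by simp)
    filter_upwards [this] with z hz
    rw [DirichletCharacter.LFunction_eq_LSeries χ hz]
    refine LSeries_eq_mul_integral _ le_rfl (one_pos.trans hz)
      (DirichletCharacter.LSeriesSummable_of_one_lt_re χ hz) ?_
    refine Asymptotics.IsBigO.of_bound q (Eventually.of_forall fun n => ?_)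
    simpa [charSum] using norm_charSum_le hχ n

lemma norm_LFunction_le_rpow {q : ℕ} [NeZero q] {χ : DirichletCharacter ℂ q} (hχ : χ ≠ 1)
    {θ : ℝ} (h0 : 0 ≤ θ) (h1 : θ ≤ 1) {s : ℂ} (hs : 1 - θ < s.re) :
    ‖χ.LFunction s‖ ≤ ‖s‖ * ((q : ℝ) ^ θ / (s.re - (1 - θ))) := by
  rw [LFunction_eq_mul_tailMellin hχ (by linarith), norm_mul]
  gcongr
  exact norm_tailMellin_le (norm_charSum_le_rpow hχ h0 h1) hs

lemma measurable_floor_sub : Measurable (fun t : ℝ => ((⌊t⌋₊ : ℂ) - t)) :=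
  (measurable_from_nat (f := fun n : ℕ => (n : ℂ)).comp Nat.measurable_floor).sub
    Complex.measurable_ofReal

lemma norm_floor_sub_le (t : ℝ) (ht : 1 ≤ t) : ‖((⌊t⌋₊ : ℂ) - t)‖ ≤ 1 * t ^ (0 : ℝ) := by
  have h : ((⌊t⌋₊ : ℂ) - t) = ((⌊t⌋₊ - t : ℝ) : ℂ) := by push_cast; ring
  rw [h, Complex.norm_real, Real.norm_eq_abs, abs_le]
  have := Nat.floor_le (show 0 ≤ t by linarith)
  have := Nat.lt_floor_add_one t
  constructor <;> simp <;> linarith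

lemma integral_cpow_Ioi_one {s : ℂ} (hs : 1 < s.re) :
    ∫ t in Ioi (1 : ℝ), (t : ℂ) * (t : ℂ) ^ (-(s + 1)) = 1 / (s - 1) := by
  have h : ∀ t ∈ Ioi (1 : ℝ), (t : ℂ) * (t : ℂ) ^ (-(s + 1)) = (t : ℂ) ^ (-s) := by
    intro t ht
    have : (t : ℂ) ≠ 0 := by exact_mod_cast (one_pos.trans ht).ne'
    rw [show -s = 1 + -(s + 1) by ring, cpow_add _ _ this, cpow_one]
  rw [setIntegral_congr_fun measurableSet_Ioi h, integral_Ioi_cpow_of_lt (by simpa) one_pos]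
  have : s - 1 ≠ 0 := by intro h; rw [sub_eq_zero.1 h] at hs; simp at hs
  have h' : -s + 1 ≠ 0 := by intro h; apply this; linear_combination -h
  simp; field_simp; ring

lemma integrableOn_tailMellin {E : ℝ → ℂ} (hEm : Measurable E) {K r : ℝ}
    (hE : ∀ t, 1 ≤ t → ‖E t‖ ≤ K * t ^ r) {s : ℂ} (hs : r < s.re) :
    IntegrableOn (fun t : ℝ => E t * (t : ℂ) ^ (-(s + 1))) (Ioi 1) := by
  have hlt : r - s.re - 1 < -1 := by linarith
  have hint : IntegrableOn (fun t : ℝ => K * t ^ (r - s.re - 1)) (Ioi 1) :=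
    (integrableOn_Ioi_rpow_of_lt hlt one_pos).const_mul K
  refine hint.mono' ?_ ?_
  · exact (hEm.mul (Complex.measurable_ofReal.pow_const _)).aestronglyMeasurable
  · filter_upwards [ae_restrict_mem measurableSet_Ioi] with t ht
    have ht0 : 0 < t := one_pos.trans ht
    rw [norm_mul, norm_cpow_eq_rpow_re_of_pos ht0]
    have : (-(s + 1)).re = -s.re - 1 := by simp; ring
    rw [this]
    calc ‖E t‖ * t ^ (-s.re - 1) ≤ K * t ^ r * t ^ (-s.re - 1) := by
          gcongr; exact hE t (le_of_lt ht)
      _ = K * t ^ (r - s.re - 1) := by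
          rw [mul_assoc, ← Real.rpow_add ht0]; ring_nf

/-- The continuation of `ζ(s) - 1 / (s - 1)` to `Re s > 0`. -/
noncomputable def zetaReg (s : ℂ) : ℂ := 1 + s * tailMellin (fun t => (⌊t⌋₊ : ℂ) - t) s

lemma differentiableAt_zetaReg {s : ℂ} (hs : 0 < s.re) : DifferentiableAt ℂ zetaReg s :=
  (differentiableAt_const _).add (differentiableAt_id.mul
    (differentiableAt_tailMellin measurable_floor_sub norm_floor_sub_le hs))

lemma norm_zetaReg_le {s : ℂ} (hs : 0 < s.re) : ‖zetaReg s‖ ≤ 1 + ‖s‖ / s.re := by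
  refine (norm_add_le _ _).trans ?_
  rw [norm_one, norm_mul, div_eq_mul_inv]
  gcongr
  simpa using norm_tailMellin_le norm_floor_sub_le hs

lemma riemannZeta_eq_of_one_lt {s : ℂ} (hs : 1 < s.re) :
    riemannZeta s = 1 / (s - 1) + zetaReg s := by
  have hs1 : s - 1 ≠ 0 := by intro h; rw [sub_eq_zero.1 h] at hs; simp at hs
  have h0 : LSeries 1 s = s * ∫ t in Ioi (1 : ℝ), (∑ k ∈ Finset.Icc 1 ⌊t⌋₊, (1 : ℕ → ℂ) k) * (t : ℂ) ^ (-(s + 1)) := by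
    refine LSeries_eq_mul_integral (1 : ℕ → ℂ) (r := 1) zero_le_one hs
      (LSeriesSummable_one_iff.2 hs) ?_
    refine IsBigO.of_bound 1 (Eventually.of_forall fun n => ?_)
    simp
  rw [← LSeries_one_eq_riemannZeta hs, h0, zetaReg, tailMellin]
  have hadd : ∫ t in Ioi (1 : ℝ), (∑ k ∈ Finset.Icc 1 ⌊t⌋₊, (1 : ℕ → ℂ) k) * (t : ℂ) ^ (-(s + 1))
      = (∫ t in Ioi (1 : ℝ), ((⌊t⌋₊ : ℂ) - t) * (t : ℂ) ^ (-(s + 1))) + 1 / (s - 1) := by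
    rw [← integral_cpow_Ioi_one hs, ← integral_add]
    · congr 1; ext t; simp; ring
    · exact integrableOn_tailMellin measurable_floor_sub norm_floor_sub_le (by linarith)
    · refine integrableOn_tailMellin (K := 1) (r := 1) Complex.measurable_ofReal ?_ hs
      intro t ht; simp [abs_of_pos (show 0 < t by linarith)]
  rw [hadd]; field_simp; ring

lemma LFunctionTrivChar₁_of_ne {q : ℕ} [NeZero q] {s : ℂ} (hs : s ≠ 1) :
    DirichletCharacter.LFunctionTrivChar₁ q s =
      (s - 1) * DirichletCharacter.LFunctionTrivChar q s := by
  unfold DirichletCharacter.LFunctionTrivChar₁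
  exact Function.update_of_ne hs _ _

lemma LFunctionTrivChar₁_one_eq {s : ℂ} (hs : 0 < s.re) :
    DirichletCharacter.LFunctionTrivChar₁ 1 s = 1 + (s - 1) * zetaReg s := by
  have hU : IsOpen {z : ℂ | 0 < z.re} := isOpen_lt continuous_const continuous_re
  refine AnalyticOnNhd.eqOn_of_preconnected_of_eventuallyEq (𝕜 := ℂ) (U := {z : ℂ | 0 < z.re})
    (z₀ := 2) (f := DirichletCharacter.LFunctionTrivChar₁ 1)
    (g := fun s => 1 + (s - 1) * zetaReg s) ?_ ?_ ?_ (by simp) ?_ hs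
  · exact (DifferentiableOn.analyticOnNhd
      (DirichletCharacter.differentiable_LFunctionTrivChar₁ 1).differentiableOn hU)
  · refine DifferentiableOn.analyticOnNhd (fun z hz => ?_) hU
    exact ((differentiableAt_const _).add ((differentiableAt_id.sub_const 1).mul
      (differentiableAt_zetaReg hz))).differentiableWithinAt
  · exact (convex_halfSpace_re_gt 0).isPreconnected
  · have : {z : ℂ | 1 < z.re} ∈ 𝓝 (2 : ℂ) :=
      (isOpen_lt continuous_const continuous_re).mem_nhds (by simp)
    filter_upwards [this] with z hz
    have hz1 : z ≠ 1 := by rintro rfl; simp at hz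
    have hz2 := sub_ne_zero.2 hz1
    rw [LFunctionTrivChar₁_of_ne hz1, DirichletCharacter.LFunctionTrivChar_eq_mul_riemannZeta hz1,
      riemannZeta_eq_of_one_lt hz]
    simp; field_simp

lemma riemannZeta_eq {s : ℂ} (hs : 0 < s.re) (hs1 : s ≠ 1) :
    riemannZeta s = 1 / (s - 1) + zetaReg s := by
  have h := LFunctionTrivChar₁_one_eq hs
  have hz2 := sub_ne_zero.2 hs1
  rw [LFunctionTrivChar₁_of_ne hs1, DirichletCharacter.LFunctionTrivChar_eq_mul_riemannZeta hs1] at h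
  simp at h
  field_simp; linear_combination h

/-- The Dirichlet `L`-function with its possible pole at `1` removed. -/
noncomputable def regL {q : ℕ} [NeZero q] (χ : DirichletCharacter ℂ q) : ℂ → ℂ :=
  if χ = 1 then DirichletCharacter.LFunctionTrivChar₁ q else χ.LFunction

lemma differentiable_regL {q : ℕ} [NeZero q] (χ : DirichletCharacter ℂ q) :
    Differentiable ℂ (regL χ) := by
  rw [regL]; split_ifs with h
  · exact DirichletCharacter.differentiable_LFunctionTrivChar₁ q
  · exact DirichletCharacter.differentiable_LFunction h

lemma regL_of_ne {q : ℕ} [NeZero q] {χ : DirichletCharacter ℂ q} (h : χ ≠ 1) :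
    regL χ = χ.LFunction := if_neg h

lemma regL_one_apply {q : ℕ} [NeZero q] {s : ℂ} (hs : s ≠ 1) :
    regL (1 : DirichletCharacter ℂ q) s = (s - 1) * DirichletCharacter.LFunctionTrivChar q s := by
  rw [regL, if_pos rfl, LFunctionTrivChar₁_of_ne hs]

lemma regL_one_eq {q : ℕ} [NeZero q] {s : ℂ} (hs : 0 < s.re) :
    regL (1 : DirichletCharacter ℂ q) s =
      (∏ p ∈ q.primeFactors, (1 - (p : ℂ) ^ (-s))) * (1 + (s - 1) * zetaReg s) := by
  rcases eq_or_ne s 1 with rfl | h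
  · simp [regL, cpow_neg_one]
  · rw [regL_one_apply h, DirichletCharacter.LFunctionTrivChar_eq_mul_riemannZeta h,
      riemannZeta_eq hs h]
    have := sub_ne_zero.2 h
    field_simp

lemma regL_ne_zero_of_one_le_re {q : ℕ} [NeZero q] (χ : DirichletCharacter ℂ q) {s : ℂ}
    (hs : 1 ≤ s.re) : regL χ s ≠ 0 := by
  by_cases h : χ = 1
  · subst h
    rcases eq_or_ne s 1 with rfl | h1
    · rw [regL, if_pos rfl]; exact DirichletCharacter.LFunctionTrivChar₁_apply_one_ne_zero q
    · rw [regL_one_apply h1]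
      exact mul_ne_zero (sub_ne_zero.2 h1)
        (DirichletCharacter.LFunction_ne_zero_of_one_le_re _ (.inr h1) hs)
  · rw [regL_of_ne h]; exact DirichletCharacter.LFunction_ne_zero_of_one_le_re _ (.inl h) hs

lemma norm_prod_one_sub_le (q : ℕ) (hq : q ≠ 0) {s : ℂ} (hs : 0 < s.re) :
    ‖∏ p ∈ q.primeFactors, (1 - (p : ℂ) ^ (-s))‖ ≤ q := by
  calc ‖∏ p ∈ q.primeFactors, (1 - (p : ℂ) ^ (-s))‖ ≤ ∏ p ∈ q.primeFactors, (p : ℝ) := by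
        rw [norm_prod]
        refine Finset.prod_le_prod (fun _ _ => norm_nonneg _) fun p hp => ?_
        have hp' := Nat.prime_of_mem_primeFactors hp
        have h2 : (2 : ℝ) ≤ p := by exact_mod_cast hp'.two_le
        refine (norm_sub_le _ _).trans ?_
        have : ‖(p : ℂ) ^ (-s)‖ ≤ 1 := by
          rw [norm_natCast_cpow_of_pos hp'.pos]
          exact Real.rpow_le_one_of_one_le_of_nonpos (by linarith) (by simp; linarith)
        simp; linarith
    _ = ((∏ p ∈ q.primeFactors, p : ℕ) : ℝ) := by push_cast; rfl
    _ ≤ q := by exact_mod_cast Nat.le_of_dvd (Nat.pos_of_ne_zero hq) (Nat.prod_primeFactors_dvd q)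

/-- Polynomial bound for `L`-functions in `Re s ≥ 1/2`. -/
lemma norm_regL_le {q : ℕ} [NeZero q] (χ : DirichletCharacter ℂ q) {s : ℂ} (hs : 1 / 2 ≤ s.re) :
    ‖regL χ s‖ ≤ q * (4 * (1 + ‖s‖) ^ 2) := by
  have h0 := norm_nonneg s
  by_cases h : χ = 1
  · subst h
    rw [regL_one_eq (by linarith), norm_mul]
    gcongr
    · exact norm_prod_one_sub_le q (NeZero.ne q) (by linarith)
    have h1 : ‖zetaReg s‖ ≤ 1 + 2 * ‖s‖ := by
      refine (norm_zetaReg_le (by linarith)).trans ?_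
      rw [add_le_add_iff_left, div_le_iff₀ (by linarith)]
      nlinarith
    have h2 : ‖s - 1‖ ≤ ‖s‖ + 1 := by simpa using norm_sub_le s 1
    calc ‖1 + (s - 1) * zetaReg s‖ ≤ 1 + (‖s‖ + 1) * (1 + 2 * ‖s‖) := by
          refine (norm_add_le _ _).trans ?_
          rw [norm_one, norm_mul]; gcongr
      _ ≤ _ := by nlinarith
  · rw [regL_of_ne h]
    refine (norm_LFunction_le_rpow (θ := 1) h zero_le_one le_rfl (by linarith)).trans ?_
    rw [Real.rpow_one, sub_self, sub_zero]
    have : (q : ℝ) / s.re ≤ 2 * q := by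
      rw [div_le_iff₀ (by linarith)]
      nlinarith [Nat.cast_nonneg (α := ℝ) q]
    calc ‖s‖ * (q / s.re) ≤ ‖s‖ * (2 * q) := by gcongr
      _ ≤ _ := by nlinarith [Nat.cast_nonneg (α := ℝ) q, mul_nonneg (Nat.cast_nonneg (α := ℝ) q) h0, mul_nonneg (Nat.cast_nonneg (α := ℝ) q) (sq_nonneg ‖s‖)]

lemma tsum_rpow_le {σ : ℝ} (hσ : 1 < σ) : ∑' n : ℕ, ‖LSeries.term 1 (σ : ℂ) n‖ ≤ 1 / (σ - 1) + 2 := by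
  have hs : 1 < (σ : ℂ).re := by simpa
  have h1 : ((∑' n : ℕ, ‖LSeries.term 1 (σ : ℂ) n‖ : ℝ) : ℂ) = riemannZeta σ := by
    rw [← LSeries_one_eq_riemannZeta hs, LSeries, Complex.ofReal_tsum]
    refine tsum_congr fun n => ?_
    rcases eq_or_ne n 0 with rfl | hn
    · simp
    · rw [LSeries.term_of_ne_zero hn, norm_div, norm_natCast_cpow_of_pos (Nat.pos_of_ne_zero hn)]
      simp [Complex.ofReal_cpow]
  have h2 := congrArg norm h1
  rw [Complex.norm_real, Real.norm_of_nonneg (tsum_nonneg fun _ => norm_nonneg _),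
    riemannZeta_eq_of_one_lt hs] at h2
  rw [h2]
  refine (norm_add_le _ _).trans (add_le_add (le_of_eq ?_) ?_)
  · rw [norm_div, norm_one, show (σ : ℂ) - 1 = ((σ - 1 : ℝ) : ℂ) by push_cast; rfl, Complex.norm_real,
      Real.norm_of_nonneg (by linarith)]
  · refine (norm_zetaReg_le (by simp; linarith)).trans (le_of_eq ?_)
    rw [Complex.norm_real, Real.norm_of_nonneg (by linarith), Complex.ofReal_re,
      div_self (by linarith)]
    norm_num

lemma norm_term_le_mul {f : ℕ → ℂ} {K η : ℝ} (hf : ∀ n, n ≠ 0 → ‖f n‖ ≤ K * (n : ℝ) ^ η) (s : ℂ) (n : ℕ) :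
    ‖LSeries.term f s n‖ ≤ K * ‖LSeries.term 1 ((s.re - η : ℝ) : ℂ) n‖ := by
  rcases eq_or_ne n 0 with rfl | hn
  · simp
  · have hn0 : 0 < (n : ℝ) := by exact_mod_cast Nat.pos_of_ne_zero hn
    rw [LSeries.term_of_ne_zero hn, LSeries.term_of_ne_zero hn, norm_div, norm_div,
      norm_natCast_cpow_of_pos (Nat.pos_of_ne_zero hn),
      norm_natCast_cpow_of_pos (Nat.pos_of_ne_zero hn), Complex.ofReal_re, Pi.one_apply, norm_one,
      Real.rpow_sub hn0]
    rw [one_div_div, ← mul_div_assoc]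
    gcongr
    exact hf n hn

lemma summable_term_of_le {f : ℕ → ℂ} {K η : ℝ} (hf : ∀ n, n ≠ 0 → ‖f n‖ ≤ K * (n : ℝ) ^ η) {s : ℂ}
    (hs : 1 + η < s.re) : Summable fun n => ‖LSeries.term f s n‖ := by
  refine Summable.of_nonneg_of_le (fun _ => norm_nonneg _) (norm_term_le_mul hf s) ?_
  refine Summable.mul_left K (Summable.norm ?_)
  exact LSeriesSummable_one_iff.2 (by simp; linarith)

lemma tsum_norm_term_le {f : ℕ → ℂ} {K η : ℝ} (hf : ∀ n, n ≠ 0 → ‖f n‖ ≤ K * (n : ℝ) ^ η) {s : ℂ}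
    (hs : 1 + η < s.re) : ∑' n, ‖LSeries.term f s n‖ ≤ K * (1 / (s.re - η - 1) + 2) := by
  have hK : 0 ≤ K := by simpa using (norm_nonneg _).trans (hf 1 one_ne_zero)
  calc ∑' n, ‖LSeries.term f s n‖ ≤ ∑' n, K * ‖LSeries.term 1 ((s.re - η : ℝ) : ℂ) n‖ := by
        refine Summable.tsum_le_tsum (norm_term_le_mul hf s) (summable_term_of_le hf hs) ?_
        refine Summable.mul_left K (Summable.norm ?_)
        exact LSeriesSummable_one_iff.2 (by simp; linarith)
    _ ≤ _ := by
        rw [tsum_mul_left]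
        gcongr
        exact tsum_rpow_le (by linarith)

lemma norm_LSeries_le_of_norm_le_one {f : ℕ → ℂ} (hf : ∀ n, ‖f n‖ ≤ 1) {s : ℂ} (hs : 1 < s.re) :
    ‖LSeries f s‖ ≤ 1 / (s.re - 1) + 2 := by
  have hf' : ∀ n, n ≠ 0 → ‖f n‖ ≤ 1 * (n : ℝ) ^ (0 : ℝ) := fun n _ => by simpa using hf n
  refine (norm_tsum_le_tsum_norm (summable_term_of_le hf' (by simpa))).trans ?_
  simpa using tsum_norm_term_le hf' (s := s) (by simpa)

lemma norm_LFunction_ge {q : ℕ} [NeZero q] (χ : DirichletCharacter ℂ q) {s : ℂ} {δ : ℝ} (h0 : 0 < δ)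
    (h1 : δ ≤ 1) (hs : s.re = 1 + δ) : δ / 3 ≤ ‖χ.LFunction s‖ := by
  have hs1 : 1 < s.re := by linarith
  have hmul := DirichletCharacter.LSeries.mul_mu_eq_one χ hs1
  rw [← DirichletCharacter.LFunction_eq_LSeries χ hs1] at hmul
  have hn := congrArg norm hmul
  rw [norm_mul, norm_one] at hn
  have hb : ‖LSeries ((fun n : ℕ => χ n) * fun n => ((ArithmeticFunction.moebius n : ℤ) : ℂ)) s‖ ≤ 3 / δ := by
    refine (norm_LSeries_le_of_norm_le_one (fun n => ?_) hs1).trans ?_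
    · rw [Pi.mul_apply, norm_mul]
      refine mul_le_one₀ (χ.norm_le_one _) (norm_nonneg _) ?_
      have := @ArithmeticFunction.abs_moebius_le_one n
      rw [Complex.norm_intCast]; exact_mod_cast this
    · rw [hs, add_sub_cancel_left]
      have : 1 ≤ 1 / δ := by rw [le_div_iff₀ h0]; linarith
      calc 1 / δ + 2 ≤ 1 / δ + 2 * (1 / δ) := by linarith
        _ = 3 / δ := by ring
  have hL := norm_nonneg (χ.LFunction s)
  have : 1 ≤ ‖χ.LFunction s‖ * (3 / δ) := by
    rw [← hn]; gcongr
  rw [div_le_iff₀ (by norm_num)]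
  rw [mul_div_assoc', le_div_iff₀ h0] at this
  linarith

lemma norm_regL_ge {q : ℕ} [NeZero q] (χ : DirichletCharacter ℂ q) {s : ℂ} {δ : ℝ} (h0 : 0 < δ)
    (h1 : δ ≤ 1) (hs : s.re = 1 + δ) : δ ^ 2 / 3 ≤ ‖regL χ s‖ := by
  have hL := norm_LFunction_ge χ h0 h1 hs
  by_cases h : χ = 1
  · subst h
    have hs1 : s ≠ 1 := by rintro rfl; simp at hs; linarith
    rw [regL_one_apply hs1, norm_mul]
    have : δ ≤ ‖s - 1‖ := by
      refine le_trans (le_of_eq ?_) (re_le_norm _)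
      simp [hs]
    calc δ ^ 2 / 3 = δ * (δ / 3) := by ring
      _ ≤ _ := by gcongr
  · rw [regL_of_ne h]; nlinarith

/-- `logDeriv` of the regularised `L`-function in the half plane of absolute convergence. -/
lemma logDeriv_regL {q : ℕ} [NeZero q] (χ : DirichletCharacter ℂ q) {s : ℂ} (hs : 1 < s.re) :
    LSeries (fun n => χ n * (ArithmeticFunction.vonMangoldt n : ℂ)) s =
      -(deriv (regL χ) s / regL χ s) + if χ = 1 then 1 / (s - 1) else 0 := by
  have h0 := DirichletCharacter.LSeries_twist_vonMangoldt_eq χ hs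
  have h1 : deriv (LSeries (fun n : ℕ => χ n)) s = deriv χ.LFunction s :=
    (DirichletCharacter.deriv_LFunction_eq_deriv_LSeries χ hs).symm
  rw [h1, ← DirichletCharacter.LFunction_eq_LSeries χ hs] at h0
  have h0' : LSeries (fun n => χ n * (ArithmeticFunction.vonMangoldt n : ℂ)) s =
      -deriv χ.LFunction s / χ.LFunction s := h0
  rw [h0']
  by_cases h : χ = 1
  · subst h
    have hs1 : s ≠ 1 := by rintro rfl; simp at hs
    rw [if_pos rfl, regL_one_apply hs1, regL, if_pos rfl,
      DirichletCharacter.deriv_LFunctionTrivChar₁_apply_of_ne_one q hs1]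
    have := sub_ne_zero.2 hs1
    have h3 : DirichletCharacter.LFunctionTrivChar q s ≠ 0 :=
      DirichletCharacter.LFunction_ne_zero_of_one_le_re _ (.inr hs1) hs.le
    field_simp; ring
  · rw [if_neg h, regL_of_ne h]; ring

lemma summable_char_vonMangoldt {q : ℕ} [NeZero q] (χ : DirichletCharacter ℂ q) {s : ℂ} (hs : 1 < s.re) :
    LSeriesSummable (fun n => χ n * (ArithmeticFunction.vonMangoldt n : ℂ)) s :=
  DirichletCharacter.LSeriesSummable_twist_vonMangoldt χ hs

lemma three_four_one_aux (z : ℂ) (hz : ‖z‖ = 1) : 0 ≤ 3 + 4 * z.re + (z ^ 2).re := by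
  have h : z.re ^ 2 + z.im ^ 2 = 1 := by
    have := Complex.sq_norm z; rw [hz, normSq_apply] at this; nlinarith
  have : (z ^ 2).re = z.re ^ 2 - z.im ^ 2 := by simp [sq]
  rw [this]; nlinarith [sq_nonneg (z.re + 1)]

/-- The `3-4-1` inequality for logarithmic derivatives. -/
lemma three_four_one {q : ℕ} [NeZero q] (χ : DirichletCharacter ℂ q) {σ : ℝ} (hσ : 1 < σ) (t : ℝ) :
    0 ≤ 3 * (LSeries (fun n => (1 : DirichletCharacter ℂ q) n * (ArithmeticFunction.vonMangoldt n : ℂ)) σ).re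
      + 4 * (LSeries (fun n => χ n * (ArithmeticFunction.vonMangoldt n : ℂ)) (σ + t * I)).re
      + (LSeries (fun n => (χ ^ 2) n * (ArithmeticFunction.vonMangoldt n : ℂ)) (σ + 2 * t * I)).re := by
  have hs0 := summable_char_vonMangoldt (1 : DirichletCharacter ℂ q) (s := σ) (by simpa)
  have hs1 := summable_char_vonMangoldt χ (s := σ + t * I) (by simpa)
  have hs2 := summable_char_vonMangoldt (χ ^ 2) (s := σ + 2 * t * I) (by simpa)
  have e0 := (Complex.hasSum_re hs0.hasSum).mul_left 3
  have e1 := (Complex.hasSum_re hs1.hasSum).mul_left 4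
  have e2 := Complex.hasSum_re hs2.hasSum
  refine ((e0.add e1).add e2).nonneg fun n => ?_
  rcases eq_or_ne n 0 with rfl | hn
  · simp
  have hn0 : (n : ℂ) ≠ 0 := by exact_mod_cast hn
  have hnp : 0 < n := Nat.pos_of_ne_zero hn
  by_cases hu : IsUnit (n : ZMod q)
  · set z : ℂ := χ n * (n : ℂ) ^ (-(t * I)) with hz
    have hz1 : ‖z‖ = 1 := by
      have := χ.unit_norm_eq_one hu.unit
      rw [IsUnit.unit_spec] at this
      rw [hz, norm_mul, norm_natCast_cpow_of_pos hnp, this]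
      simp
    set w : ℝ := ArithmeticFunction.vonMangoldt n * (n : ℝ) ^ (-σ) with hw'
    have hw : 0 ≤ w := mul_nonneg ArithmeticFunction.vonMangoldt_nonneg (by positivity)
    have hwc : (w : ℂ) = (ArithmeticFunction.vonMangoldt n : ℂ) * (n : ℂ) ^ (-(σ : ℂ)) := by
      rw [hw', ofReal_mul, Complex.ofReal_cpow (by positivity)]; simp
    have t0 : LSeries.term (fun n => (1 : DirichletCharacter ℂ q) n * (ArithmeticFunction.vonMangoldt n : ℂ)) σ n = w := by
      rw [LSeries.term_of_ne_zero hn, hwc, MulChar.one_apply hu, cpow_neg, one_mul, div_eq_mul_inv]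
    have t1 : LSeries.term (fun n => χ n * (ArithmeticFunction.vonMangoldt n : ℂ)) (σ + t * I) n = w * z := by
      rw [LSeries.term_of_ne_zero hn, hwc, hz, div_eq_mul_inv, ← cpow_neg, neg_add, cpow_add _ _ hn0]
      ring
    have t2 : LSeries.term (fun n => (χ ^ 2) n * (ArithmeticFunction.vonMangoldt n : ℂ)) (σ + 2 * t * I) n = w * z ^ 2 := by
      rw [LSeries.term_of_ne_zero hn, hwc, hz, div_eq_mul_inv, ← cpow_neg,
        show -((σ : ℂ) + 2 * t * I) = -σ + (-(t * I) + -(t * I)) by ring, cpow_add _ _ hn0,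
        cpow_add _ _ hn0, MulChar.pow_apply' _ two_ne_zero]
      ring
    rw [t0, t1, t2, ofReal_re, re_ofReal_mul, re_ofReal_mul]
    have := mul_nonneg hw (three_four_one_aux z hz1)
    linarith
  · simp [LSeries.term_of_ne_zero hn, MulChar.map_nonunit _ hu]

/-- A holomorphic function without zeros on a disc, and not much larger than its value at the centre,
has small logarithmic derivative. -/
lemma norm_logDeriv_le_of_ne_zero_aux {f : ℂ → ℂ} {R M : ℝ} (hR : 0 < R) (hM : 0 < M)
    (hf : Differentiable ℂ f) (hne : ∀ z ∈ Metric.ball (0 : ℂ) R, f z ≠ 0)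
    (hb : ∀ z ∈ Metric.ball (0 : ℂ) R, ‖f z‖ ≤ Real.exp M * ‖f 0‖) {z : ℂ} (hz : ‖z‖ ≤ 3 / 4 * R) :
    ‖logDeriv f z‖ ≤ 112 * M / R := by
  have hd : DifferentiableOn ℂ (logDeriv f) (Metric.ball 0 R) := by
    refine DifferentiableOn.div (hf.deriv.differentiableOn) hf.differentiableOn hne
  have h0 : (0 : ℂ) ∈ Metric.ball (0 : ℂ) R := Metric.mem_ball_self hR
  obtain ⟨h, hh0, hh⟩ := hd.isExactOn_ball.with_val_at 0 0
  have hconst : ∀ w ∈ Metric.ball (0 : ℂ) R, f w = f 0 * exp (h w) := by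
    intro w hw
    have hder : ∀ u ∈ Metric.ball (0 : ℂ) R, HasDerivAt (fun u => f u * exp (-h u)) 0 u := by
      intro u hu
      have := (hf u).hasDerivAt.mul (hh u hu).neg.cexp
      refine this.congr_deriv ?_
      simp only [Pi.neg_apply]
      rw [logDeriv_apply]
      have := hne u hu
      field_simp; ring
    have := Metric.isOpen_ball.is_const_of_deriv_eq_zero (convex_ball _ _).isPreconnected
      (fun u hu => (hder u hu).differentiableAt.differentiableWithinAt)
      (fun u hu => (hder u hu).deriv) hw h0
    simp only [hh0, neg_zero, exp_zero, mul_one] at this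
    rw [← this, mul_assoc, ← exp_add]; simp
  have hre : MapsTo h (Metric.ball 0 R) {z | z.re ≤ M} := by
    intro w hw
    have h1 := hb w hw
    rw [hconst w hw, norm_mul, norm_exp, mul_comm] at h1
    exact Real.exp_le_exp.1 (le_of_mul_le_mul_right h1 (norm_pos_iff.2 (hne 0 h0)))
  have hhd : DifferentiableOn ℂ h (Metric.ball 0 R) :=
    fun w hw => (hh w hw).differentiableAt.differentiableWithinAt
  have hsub : Metric.closedBall z (R / 8) ⊆ Metric.ball 0 R := by
    intro w hw
    rw [mem_ball_zero_iff]
    rw [mem_closedBall_iff_norm] at hw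
    have := norm_le_norm_add_norm_sub' w z
    linarith
  have hC : ∀ w ∈ Metric.sphere z (R / 8), ‖h w‖ ≤ 14 * M := by
    intro w hw
    have hwR := hsub (Metric.sphere_subset_closedBall hw)
    have h1 := borelCaratheodory_zero hM hhd hre hR hwR hh0
    refine h1.trans ?_
    rw [mem_sphere_iff_norm] at hw
    have := norm_le_norm_add_norm_sub' w z
    rw [div_le_iff₀ (by linarith)]
    nlinarith
  have h2 := norm_deriv_le_of_forall_mem_sphere_norm_le (by positivity)
    (DifferentiableOn.diffContOnCl ((hhd.mono hsub).mono
      (closure_minimal Metric.ball_subset_closedBall Metric.isClosed_closedBall))) hC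
  rw [(hh z (hsub (Metric.mem_closedBall_self (by positivity)))).deriv] at h2
  refine h2.trans (le_of_eq ?_)
  field_simp; ring

lemma norm_logDeriv_le_of_ne_zero {f : ℂ → ℂ} {c : ℂ} {R M : ℝ} (hR : 0 < R) (hM : 0 < M)
    (hf : Differentiable ℂ f) (hne : ∀ z ∈ Metric.ball c R, f z ≠ 0)
    (hb : ∀ z ∈ Metric.ball c R, ‖f z‖ ≤ Real.exp M * ‖f c‖) {z : ℂ} (hz : ‖z - c‖ ≤ 3 / 4 * R) :
    ‖logDeriv f z‖ ≤ 112 * M / R := by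
  have hg : Differentiable ℂ fun w => f (c + w) := hf.comp (differentiable_id.const_add c)
  have hmem : ∀ w ∈ Metric.ball (0 : ℂ) R, c + w ∈ Metric.ball c R := fun w hw => by
    rw [mem_ball_iff_norm, add_sub_cancel_left]; simpa using hw
  have h := norm_logDeriv_le_of_ne_zero_aux hR hM hg (fun w hw => hne _ (hmem w hw))
    (fun w hw => by simpa using hb _ (hmem w hw)) hz
  have e : logDeriv (fun w => f (c + w)) (z - c) = logDeriv f z := by
    rw [logDeriv_apply, logDeriv_apply, deriv_comp_const_add]; simp
  rwa [e] at h

/-- Dividing out `n` zeros of `f` in the disc of radius `R / 2` and multiplying by the Blaschke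
numerators. -/
lemma exists_blaschke {f g : ℂ → ℂ} {R M : ℝ} {n : ℕ} {ρ : Fin n → ℂ} (hR : 0 < R)
    (hg : Differentiable ℂ g) (hfg : ∀ z, f z = g z * ∏ i, (z - ρ i))
    (hb : ∀ z ∈ Metric.closedBall (0 : ℂ) R, ‖f z‖ ≤ M) {z : ℂ} (hz : z ∈ Metric.closedBall (0 : ℂ) R) :
    ‖g z * ∏ i, (R - (starRingEnd ℂ (ρ i)) * z / R)‖ ≤ M := by
  have hd : Differentiable ℂ fun z => g z * ∏ i, (R - (starRingEnd ℂ (ρ i)) * z / R) := by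
    refine hg.mul ?_
    fun_prop
  refine norm_le_of_forall_mem_frontier_norm_le Metric.isBounded_ball hd.diffContOnCl ?_
    (U := Metric.ball (0 : ℂ) R) (by rwa [closure_ball _ hR.ne'])
  intro w hw
  rw [frontier_ball _ hR.ne'] at hw
  refine le_trans (le_of_eq ?_) (hb w (Metric.sphere_subset_closedBall hw))
  rw [hfg, norm_mul, norm_mul, norm_prod, norm_prod]
  congr 1
  refine Finset.prod_congr rfl fun i _ => ?_
  have hwR : ‖w‖ = R := by simpa using hw
  have hRc : (R : ℂ) ≠ 0 := by exact_mod_cast hR.ne'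
  have h1 : (R : ℂ) - (starRingEnd ℂ (ρ i)) * w / R = w * starRingEnd ℂ (w - ρ i) / R := by
    have : w * starRingEnd ℂ w = R ^ 2 := by rw [mul_conj, normSq_eq_norm_sq, hwR]; push_cast; rfl
    rw [map_sub, mul_sub, this]; field_simp
  rw [h1, norm_div, norm_mul, Complex.norm_conj, hwR, Complex.norm_real, Real.norm_of_nonneg hR.le]
  field_simp

lemma exists_zero_extraction {f : ℂ → ℂ} {R M : ℝ} (hR : 0 < R)
    (hf : Differentiable ℂ f) (hf0 : f 0 ≠ 0)
    (hb : ∀ z ∈ Metric.closedBall (0 : ℂ) R, ‖f z‖ ≤ M) :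
    ∃ (n : ℕ) (ρ : Fin n → ℂ) (g : ℂ → ℂ), Differentiable ℂ g ∧ (∀ z, f z = g z * ∏ i, (z - ρ i)) ∧
      (∀ i, ‖ρ i‖ ≤ R / 2) ∧ ∀ z, ‖z‖ ≤ R / 2 → g z ≠ 0 := by
  set P : ℕ → Prop := fun n => ∃ (ρ : Fin n → ℂ) (g : ℂ → ℂ), Differentiable ℂ g ∧
    (∀ z, f z = g z * ∏ i, (z - ρ i)) ∧ (∀ i, ‖ρ i‖ ≤ R / 2) with hP
  have hbound : ∀ n, P n → (n : ℝ) ≤ M / ‖f 0‖ := by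
    rintro n ⟨ρ, g, hg, hfg, hρ⟩
    have h1 := exists_blaschke hR hg hfg hb (Metric.mem_closedBall_self hR.le)
    have h2 : ‖f 0‖ * 2 ^ n ≤ M := by
      refine le_trans ?_ h1
      rw [hfg, norm_mul, norm_mul, mul_assoc]
      gcongr
      rw [norm_prod, norm_prod, show (2 : ℝ) ^ n = ∏ _i : Fin n, 2 by simp, ← Finset.prod_mul_distrib]
      refine Finset.prod_le_prod (fun i _ => by positivity) fun i _ => ?_
      simp only [zero_sub, norm_neg, mul_zero, zero_div, sub_zero, Complex.norm_real,
        Real.norm_of_nonneg hR.le]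
      linarith [hρ i]
    rw [le_div_iff₀ (norm_pos_iff.2 hf0)]
    have : (n : ℝ) ≤ 2 ^ n := by exact_mod_cast Nat.lt_two_pow_self.le
    nlinarith [norm_nonneg (f 0)]
  have h0 : P 0 := ⟨Fin.elim0, f, hf, by simp, fun i => i.elim0⟩
  obtain ⟨n, hn, hmax⟩ : ∃ n, P n ∧ ¬ P (n + 1) := by
    by_contra! h
    have hall : ∀ n, P n := fun n => by
      induction n with
      | zero => exact h0
      | succ n ih => exact h n ih
    obtain ⟨N, hN⟩ := exists_nat_gt (M / ‖f 0‖)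
    exact absurd (hbound N (hall N)) (not_le.2 hN)
  obtain ⟨ρ, g, hg, hfg, hρ⟩ := hn
  refine ⟨n, ρ, g, hg, hfg, hρ, fun z hz hgz => hmax ?_⟩
  refine ⟨Fin.cons z ρ, dslope g z, ?_, fun w => ?_, fun i => ?_⟩
  · rw [← differentiableOn_univ]
    exact (differentiableOn_dslope univ_mem).2 hg.differentiableOn
  · rw [Fin.prod_univ_succ, hfg, ← mul_assoc]
    simp only [Fin.cons_zero, Fin.cons_succ]
    congr 1
    have := sub_smul_dslope g z w
    rw [hgz, sub_zero, smul_eq_mul] at this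
    rw [← this, mul_comm]
  · refine Fin.cases ?_ (fun j => ?_) i
    · simpa using hz
    · simpa using hρ j

lemma re_inv_sub_le {w : ℂ} {R : ℝ} (hw : ‖w‖ ≤ R / 2) (hw0 : w ≠ 0) (hre : w.re ≤ 0) :
    (1 / w - starRingEnd ℂ w / R ^ 2).re ≤ 0 := by
  have e : (1 / w - starRingEnd ℂ w / R ^ 2).re = w.re * (1 / normSq w - 1 / R ^ 2) := by
    rw [one_div, sub_re, inv_re, ← ofReal_pow, div_ofReal_re, conj_re]; ring
  rw [e]
  refine mul_nonpos_of_nonpos_of_nonneg hre (sub_nonneg.2 ?_)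
  have := norm_pos_iff.2 hw0
  rw [normSq_eq_norm_sq]
  gcongr
  linarith

lemma landau_aux {f : ℂ → ℂ} {R M : ℝ} (hR : 0 < R) (hM : 0 < M)
    (hf : Differentiable ℂ f) (hf0 : f 0 ≠ 0)
    (hb : ∀ z ∈ Metric.closedBall (0 : ℂ) R, ‖f z‖ ≤ Real.exp M * ‖f 0‖)
    (hz : ∀ z ∈ Metric.closedBall (0 : ℂ) R, f z = 0 → z.re ≤ 0) :
    -(logDeriv f 0).re ≤ 224 * M / R ∧
    ∀ z, ‖z‖ ≤ R / 2 → f z = 0 → -(logDeriv f 0).re ≤ 224 * M / R + 1 / R + (1 / z).re := by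
  obtain ⟨n, ρ, g, hg, hfg, hρ, hgne⟩ := exists_zero_extraction hR hf hf0 hb
  set h : ℂ → ℂ := fun z => g z * ∏ i, (R - (starRingEnd ℂ (ρ i)) * z / R) with hh
  have hRc : (R : ℂ) ≠ 0 := by exact_mod_cast hR.ne'
  have hhd : Differentiable ℂ h := hg.mul (by fun_prop)
  have hfac : ∀ z, ‖z‖ ≤ R / 2 → ∀ i, (R : ℂ) - (starRingEnd ℂ (ρ i)) * z / R ≠ 0 := by
    intro z hz i h0
    have h1 : ‖(starRingEnd ℂ (ρ i)) * z / R‖ = R := by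
      rw [← sub_eq_zero.1 h0, Complex.norm_real, Real.norm_of_nonneg hR.le]
    rw [norm_div, norm_mul, Complex.norm_conj, Complex.norm_real, Real.norm_of_nonneg hR.le,
      div_eq_iff hR.ne'] at h1
    have := mul_le_mul (hρ i) hz (norm_nonneg _) (by positivity)
    nlinarith
  have hρ0 : ∀ i, ρ i ≠ 0 := by
    intro i hi
    apply hf0
    rw [hfg, Finset.prod_eq_zero (Finset.mem_univ i) (by rw [hi, sub_zero]), mul_zero]
  have hfρ : ∀ i, f (ρ i) = 0 := fun i => by
    rw [hfg, Finset.prod_eq_zero (Finset.mem_univ i) (sub_self _), mul_zero]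
  have hh0 : ‖f 0‖ ≤ ‖h 0‖ := by
    rw [hh, hfg]
    simp only [norm_mul, norm_prod]
    gcongr with i
    simp only [zero_sub, norm_neg, mul_zero, zero_div, sub_zero, Complex.norm_real,
        Real.norm_of_nonneg hR.le]
    linarith [hρ i]
  have hlh := norm_logDeriv_le_of_ne_zero_aux (f := h) (R := R / 2) (z := 0) (by positivity) hM hhd
    (fun z hz => by
      have hz' : ‖z‖ ≤ R / 2 := by simpa using (mem_ball_zero_iff.1 hz).le
      exact mul_ne_zero (hgne z hz') (Finset.prod_ne_zero_iff.2 fun i _ => hfac z hz' i))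
    (fun z hz => by
      have hz' : z ∈ Metric.closedBall (0 : ℂ) R := by
        rw [mem_closedBall_zero_iff]; linarith [mem_ball_zero_iff.1 hz]
      refine (exists_blaschke hR hg hfg hb hz').trans ?_
      gcongr) (by simp; positivity)
  have e1 : logDeriv f 0 = logDeriv g 0 + ∑ i, -(1 / ρ i) := by
    have : f = fun z => g z * ∏ i, (z - ρ i) := funext hfg
    rw [this, logDeriv_mul _ (hgne 0 (by simp; positivity))
      (Finset.prod_ne_zero_iff.2 fun i _ => by simpa using hρ0 i) hg.differentiableAt (by fun_prop),
      logDeriv_prod (fun i _ => by simpa using hρ0 i) (fun i _ => by fun_prop)]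
    congr 1
    refine Finset.sum_congr rfl fun i _ => ?_
    rw [logDeriv_apply, deriv_sub_const, deriv_id'']
    simp
  have e2 : logDeriv h 0 = logDeriv g 0 + ∑ i, -(starRingEnd ℂ (ρ i) / R ^ 2) := by
    rw [hh, logDeriv_mul _ (hgne 0 (by simp; positivity))
      (Finset.prod_ne_zero_iff.2 fun i _ => by simpa using hRc) hg.differentiableAt (by fun_prop),
      logDeriv_prod (fun i _ => by simpa using hRc) (fun i _ => by fun_prop)]
    congr 1
    refine Finset.sum_congr rfl fun i _ => ?_
    rw [logDeriv_apply, deriv_const_sub, deriv_div_const, deriv_const_mul_id]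
    simp only [mul_zero, zero_div, sub_zero]
    field_simp
  have e3 : -(logDeriv f 0).re = -(logDeriv h 0).re + ∑ i, (1 / ρ i - starRingEnd ℂ (ρ i) / R ^ 2).re := by
    rw [e1, e2, ← re_sum, Finset.sum_sub_distrib]
    simp only [Finset.sum_neg_distrib, add_re, neg_re, sub_re]
    ring
  have hneg : ∀ i, (1 / ρ i - starRingEnd ℂ (ρ i) / R ^ 2).re ≤ 0 := fun i =>
    re_inv_sub_le (hρ i) (hρ0 i) (hz _ (by rw [mem_closedBall_zero_iff]; linarith [hρ i]) (hfρ i))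
  have hl : -(logDeriv h 0).re ≤ 224 * M / R := by
    refine (neg_le_abs _).trans ((abs_re_le_norm _).trans (hlh.trans (le_of_eq ?_)))
    field_simp; ring
  refine ⟨?_, fun z hzR hfz => ?_⟩
  · rw [e3]
    linarith [Finset.sum_nonpos fun i (_ : i ∈ Finset.univ) => hneg i]
  · rw [hfg, mul_eq_zero, or_iff_right (hgne z hzR), Finset.prod_eq_zero_iff] at hfz
    obtain ⟨i, -, hi⟩ := hfz
    rw [sub_eq_zero.1 hi, e3]
    have h1 : ∑ i, (1 / ρ i - starRingEnd ℂ (ρ i) / R ^ 2).re ≤ (1 / ρ i - starRingEnd ℂ (ρ i) / R ^ 2).re :=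
      by
        rw [← Finset.add_sum_erase _ _ (Finset.mem_univ i)]
        linarith [Finset.sum_nonpos fun j (_ : j ∈ Finset.univ.erase i) => hneg j]
    have h2 : -(starRingEnd ℂ (ρ i) / R ^ 2).re ≤ 1 / R := by
      refine (neg_le_abs _).trans ((abs_re_le_norm _).trans ?_)
      rw [norm_div, Complex.norm_conj, norm_pow, Complex.norm_real, Real.norm_of_nonneg hR.le,
        div_le_div_iff₀ (by positivity) hR]
      nlinarith [hρ i]
    rw [sub_re] at h1
    linarith

/-- The lemma of Landau on the real part of a logarithmic derivative, to the right of the zeros. -/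
lemma landau {f : ℂ → ℂ} {c : ℂ} {R M : ℝ} (hR : 0 < R) (hM : 0 < M)
    (hf : Differentiable ℂ f) (hf0 : f c ≠ 0)
    (hb : ∀ z ∈ Metric.closedBall c R, ‖f z‖ ≤ Real.exp M * ‖f c‖)
    (hz : ∀ z, f z = 0 → z.re ≤ c.re) :
    -(logDeriv f c).re ≤ 224 * M / R ∧
    ∀ z, ‖z - c‖ ≤ R / 2 → f z = 0 → -(logDeriv f c).re ≤ 224 * M / R + 1 / R + (1 / (z - c)).re := by
  have hg : Differentiable ℂ fun w => f (c + w) := hf.comp (differentiable_id.const_add c)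
  have h := landau_aux hR hM hg (by simpa) (fun w hw => by
      simpa using hb (c + w) (by rw [mem_closedBall_iff_norm, add_sub_cancel_left]; simpa using hw))
    (fun w _ hw => by simpa using hz _ hw)
  have e : logDeriv (fun w => f (c + w)) 0 = logDeriv f c := by
    rw [logDeriv_apply, logDeriv_apply, deriv_comp_const_add]; simp
  rw [e] at h
  exact ⟨h.1, fun z hzR hfz => h.2 _ hzR (by simpa using hfz)⟩

lemma iteratedDeriv_div_sub_one {H : ℂ → ℂ} (hH : Differentiable ℂ H) (m : ℕ) :
    iteratedDeriv m (fun s => H s / (s - 1)) 2 =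
      iteratedDeriv m (dslope H 1) 2 + H 1 * ((-1) ^ m * m.factorial) := by
  have hG : Differentiable ℂ (dslope H 1) := by
    rw [← differentiableOn_univ]
    exact (differentiableOn_dslope univ_mem).2 hH.differentiableOn
  have h1 : (fun s => H s / (s - 1)) =ᶠ[𝓝 2] fun s => dslope H 1 s + H 1 * (1 * s - 1)⁻¹ := by
    filter_upwards [isOpen_ne.mem_nhds (show (2 : ℂ) ≠ 1 by norm_num)] with s hs
    have hs' : s - 1 ≠ 0 := sub_ne_zero.2 hs
    rw [dslope_of_ne _ hs, slope_def_field]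
    field_simp; ring
  have hinv : ContDiffAt ℂ m (fun s : ℂ => (1 * s - 1)⁻¹) 2 :=
    ContDiffAt.inv (by fun_prop) (by norm_num)
  rw [h1.iteratedDeriv_eq, iteratedDeriv_fun_add hG.contDiff.contDiffAt (contDiffAt_const.mul hinv),
    iteratedDeriv_const_mul _ hinv, iteratedDeriv_eq_iterate (f := fun s : ℂ => (1 * s - 1)⁻¹),
    iter_deriv_inv_linear_sub]
  norm_num

lemma le_of_hasSum_sub {a c : ℕ → ℝ} {l B b y S : ℝ} (hac : ∀ m, c m = a m - l) (ha : ∀ m, 0 ≤ a m)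
    (hl : 0 ≤ l) (hcb : ∀ m, |c m| ≤ B * (3 / 4) ^ m) (hb : b ≤ a 0) (hy1 : 1 < y) (hy2 : y ≤ 9 / 8)
    (hS : HasSum (fun m => c m * y ^ m) S) (N : ℕ) :
    b ≤ l * ((2 * y ^ N - 1) / (y - 1)) + S + 32 / 5 * B * (27 / 32) ^ N := by
  have hB0 : 0 ≤ B := by simpa using (abs_nonneg _).trans (hcb 0)
  have hterm : ∀ m : ℕ, -(B * (27 / 32 : ℝ) ^ N * (27 / 32 : ℝ) ^ m) ≤ c (m + (N + 1)) * y ^ (m + (N + 1)) := by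
    intro m
    have h2 : |c (m + (N + 1)) * y ^ (m + (N + 1))| ≤ B * (27 / 32) ^ (m + (N + 1)) := by
      rw [abs_mul, abs_of_nonneg (pow_nonneg (by linarith : 0 ≤ y) _)]
      calc |c (m + (N + 1))| * y ^ (m + (N + 1)) ≤ B * (3 / 4) ^ (m + (N + 1)) * (9 / 8) ^ (m + (N + 1)) := by
            gcongr
            exact hcb _
        _ = _ := by rw [mul_assoc, ← mul_pow]; norm_num
    have h3 : B * (27 / 32 : ℝ) ^ (m + (N + 1)) ≤ B * (27 / 32 : ℝ) ^ N * (27 / 32 : ℝ) ^ m := by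
      rw [mul_assoc, ← pow_add]
      gcongr B * ?_
      exact pow_le_pow_of_le_one (by norm_num) (by norm_num) (by omega)
    exact (neg_le_neg (h2.trans h3)).trans (neg_abs_le _)
  have htail : -(32 / 5 * B * (27 / 32) ^ N) ≤ ∑' m, c (m + (N + 1)) * y ^ (m + (N + 1)) := by
    have hg : HasSum (fun m : ℕ => -(B * (27 / 32 : ℝ) ^ N * (27 / 32 : ℝ) ^ m))
        (-(B * (27 / 32 : ℝ) ^ N * (1 - 27 / 32)⁻¹)) :=
      ((hasSum_geometric_of_lt_one (by norm_num) (by norm_num)).mul_left _).neg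
    have := hasSum_le hterm hg ((summable_nat_add_iff (N + 1)).2 hS.summable).hasSum
    refine le_trans (le_of_eq ?_) this
    ring
  have hhead : b - l * ((2 * y ^ N - 1) / (y - 1)) ≤ ∑ m ∈ Finset.range (N + 1), c m * y ^ m := by
    have e : ∀ m, c m * y ^ m = a m * y ^ m - l * y ^ m := fun m => by rw [hac]; ring
    simp only [e, Finset.sum_sub_distrib, ← Finset.mul_sum]
    refine sub_le_sub ?_ ?_
    · calc b ≤ a 0 * y ^ 0 := by simpa using hb
        _ ≤ _ := Finset.single_le_sum (f := fun m => a m * y ^ m)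
            (fun m _ => mul_nonneg (ha m) (pow_nonneg (by linarith) _)) (by simp)
    · rw [geom_sum_eq (by linarith), pow_succ, mul_comm (y ^ N)]
      gcongr
      linarith
  have hsplit := hS.summable.sum_add_tsum_nat_add (N + 1)
  rw [hS.tsum_eq] at hsplit
  linarith

open scoped ComplexOrder in
/-- The lemma of Estermann: nonnegativity of the Taylor coefficients at `2` of `H s / (s - 1)` forces a lower
bound for the residue `H 1`. -/
lemma estermann {H : ℂ → ℂ} (hH : Differentiable ℂ H) {B b : ℝ}
    (hB : ∀ s ∈ Metric.sphere (2 : ℂ) (4 / 3), ‖dslope H 1 s‖ ≤ B)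
    (hpos : ∀ m, 0 ≤ (-1) ^ m * iteratedDeriv m (fun s => H s / (s - 1)) 2)
    (hb : b ≤ (H 2).re) :
    (H 1).im = 0 ∧ 0 ≤ (H 1).re ∧ ∀ β : ℝ, 7 / 8 < β → β < 1 → (H β).im = 0 ∧
      (0 ≤ (H β).re → ∀ N : ℕ,
        b ≤ 2 * (H 1).re * (2 - β) ^ N / (1 - β) + 32 / 5 * B * (27 / 32) ^ N) := by
  have hG : Differentiable ℂ (dslope H 1) := by
    rw [← differentiableOn_univ]
    exact (differentiableOn_dslope univ_mem).2 hH.differentiableOn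
  obtain ⟨a, ha⟩ : ∃ a : ℕ → ℂ, ∀ m, a m = (m.factorial : ℂ)⁻¹ * ((-1) ^ m * iteratedDeriv m (fun s => H s / (s - 1)) 2) :=
    ⟨_, fun _ => rfl⟩
  obtain ⟨c, hc⟩ : ∃ c : ℕ → ℂ, ∀ m, c m = (m.factorial : ℂ)⁻¹ * ((-1) ^ m * iteratedDeriv m (dslope H 1) 2) :=
    ⟨_, fun _ => rfl⟩
  have hsgn : ∀ m : ℕ, ((-1 : ℂ) ^ m) * (-1) ^ m = 1 := fun m => by
    rw [← mul_pow]; simp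
  have hac : ∀ m, c m = a m - H 1 := by
    intro m
    have hm : (m.factorial : ℂ) ≠ 0 := by exact_mod_cast m.factorial_ne_zero
    rw [hc, ha, iteratedDeriv_div_sub_one hH, mul_add, mul_add, show (-1 : ℂ) ^ m * (H 1 * ((-1) ^ m * m.factorial)) =
      ((-1) ^ m * (-1) ^ m) * (H 1 * m.factorial) by ring, hsgn]
    field_simp; ring
  have ha0 : ∀ m, 0 ≤ a m := fun m => by
    rw [ha]
    exact mul_nonneg (by rw [inv_nonneg]; exact_mod_cast Nat.zero_le _) (hpos m)
  have hare : ∀ m, 0 ≤ (a m).re := fun m => (Complex.nonneg_iff.1 (ha0 m)).1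
  have haim : ∀ m, (a m).im = 0 := fun m => ((Complex.nonneg_iff.1 (ha0 m)).2).symm
  have hcb : ∀ m, ‖c m‖ ≤ B * (3 / 4) ^ m := by
    intro m
    have h1 := norm_iteratedDeriv_le_of_forall_mem_sphere_norm_le m (by norm_num) hG.diffContOnCl hB
    have hm : (0 : ℝ) < m.factorial := by exact_mod_cast m.factorial_pos
    rw [hc]
    simp only [norm_mul, norm_inv, norm_pow, norm_neg, norm_one, one_pow, one_mul, norm_natCast]
    rw [inv_mul_le_iff₀ hm]
    refine h1.trans (le_of_eq ?_)
    rw [mul_div_assoc, div_eq_mul_inv, ← inv_pow]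
    norm_num
  have hB0 : 0 ≤ B := by simpa using (norm_nonneg _).trans (hcb 0)
  have hc0 : Tendsto c atTop (𝓝 0) := by
    refine squeeze_zero_norm hcb ?_
    simpa using (tendsto_pow_atTop_nhds_zero_of_lt_one (r := (3 / 4 : ℝ)) (by norm_num) (by norm_num)).const_mul B
  have hat : Tendsto a atTop (𝓝 (H 1)) := by
    have := hc0.add_const (H 1)
    simpa [hac] using this
  have hatre : Tendsto (fun m => (a m).re) atTop (𝓝 (H 1).re) := (continuous_re.tendsto _).comp hat
  have hatim : Tendsto (fun m => (a m).im) atTop (𝓝 (H 1).im) := (continuous_im.tendsto _).comp hat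
  have him : (H 1).im = 0 := by
    simp only [haim] at hatim
    exact (tendsto_nhds_unique hatim tendsto_const_nhds)
  have hre : 0 ≤ (H 1).re := ge_of_tendsto' hatre hare
  refine ⟨him, hre, fun β h7 h1 => ?_⟩
  have hsum : HasSum (fun m => c m * ((2 - β : ℝ) : ℂ) ^ m) (dslope H 1 β) := by
    have := hasSum_taylorSeries_of_entire hG 2 (β : ℂ)
    convert this using 2 with m
    · rfl
    rw [hc, smul_eq_mul, smul_eq_mul, show (β : ℂ) - 2 = (-1) * ((2 - β : ℝ) : ℂ) by push_cast; ring, mul_pow]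
    ring
  have hHβ : H β = H 1 + (β - 1) * dslope H 1 β := by
    have := sub_smul_dslope H 1 (β : ℂ)
    rw [smul_eq_mul] at this; rw [this]; ring
  have hcim : ∀ m, (c m).im = 0 := fun m => by rw [hac, sub_im, haim, him, sub_zero]
  have hsre : HasSum (fun m => (c m).re * (2 - β) ^ m) (dslope H 1 β).re := by
    convert hasSum_re hsum using 2 with m
    rw [← ofReal_pow, re_mul_ofReal]
  have hsim : (dslope H 1 β).im = 0 := by
    have := hasSum_im hsum
    have e : (fun m => (c m * ((2 - β : ℝ) : ℂ) ^ m).im) = fun _ => 0 := by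
      funext m
      rw [← ofReal_pow, im_mul_ofReal, hcim, zero_mul]
    rw [e] at this
    exact this.unique hasSum_zero
  have hreβ : (H β).re = (H 1).re - (1 - β) * (dslope H 1 β).re := by
    rw [hHβ]; simp [hsim]; ring
  refine ⟨by rw [hHβ]; simp [hsim, him], fun h0 N => ?_⟩
  have h2 := le_of_hasSum_sub (fun m => by rw [hac, sub_re]) hare hre
    (fun m => (abs_re_le_norm _).trans (hcb m)) (b := b) (by rw [ha]; norm_num; exact hb) (by linarith)
    (by linarith) hsre N
  have h5 : (dslope H 1 β).re ≤ (H 1).re / (1 - β) := by rw [le_div_iff₀ (by linarith)]; linarith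
  refine h2.trans ?_
  rw [show 2 - β - 1 = 1 - β by ring]
  have : (H 1).re * ((2 * (2 - β) ^ N - 1) / (1 - β)) + (H 1).re / (1 - β) =
    2 * (H 1).re * (2 - β) ^ N / (1 - β) := by ring
  linarith

lemma re_LFunction_two {q : ℕ} [NeZero q] {χ : DirichletCharacter ℂ q} (hχ : χ ^ 2 = 1) :
    (χ.LFunction 2).im = 0 ∧ 1 / 3 ≤ (χ.LFunction 2).re := by
  have hq := MulChar.isQuadratic_iff_sq_eq_one.2 hχ
  have h2 : (1 : ℝ) < (2 : ℂ).re := by norm_num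
  rw [DirichletCharacter.LFunction_eq_LSeries χ h2]
  have hs : LSeriesSummable (fun n : ℕ => χ n) 2 := DirichletCharacter.LSeriesSummable_of_one_lt_re χ h2
  have h1 : LSeriesSummable 1 2 := LSeriesSummable_one_iff.2 h2
  have hterm : ∀ n, (LSeries.term (fun n : ℕ => χ n) 2 n).im = 0 ∧
      0 ≤ (LSeries.term (fun n : ℕ => χ n) 2 n).re + (LSeries.term 1 2 n).re := by
    intro n
    rcases eq_or_ne n 0 with rfl | hn
    · simp
    have e : (n : ℂ) ^ (2 : ℂ) = ((n ^ 2 : ℝ) : ℂ) := by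
      rw [show (2 : ℂ) = ((2 : ℕ) : ℂ) by norm_num, cpow_natCast]; push_cast; rfl
    rw [LSeries.term_of_ne_zero hn, LSeries.term_of_ne_zero hn, e, div_ofReal_im, div_ofReal_re,
      div_ofReal_re, ← add_div]
    rcases hq (n : ZMod q) with h | h | h <;> rw [h] <;> (simp; try positivity)
  constructor
  · refine (hasSum_im hs.hasSum).unique ?_
    simp only [(hterm _).1]
    exact hasSum_zero
  · have hsum := (hasSum_re hs.hasSum).add (hasSum_re h1.hasSum)
    have hle := le_hasSum hsum 1 fun n _ => (hterm n).2
    have hz : (∑' n, LSeries.term 1 2 n) = ((Real.pi ^ 2 / 6 : ℝ) : ℂ) := by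
      have : LSeries 1 2 = riemannZeta 2 := LSeries_one_eq_riemannZeta h2
      rw [LSeries] at this
      rw [this, riemannZeta_two]; push_cast; rfl
    rw [hz, ofReal_re] at hle
    have hpi := Real.pi_lt_d2
    have hpi0 := Real.pi_pos
    rw [LSeries]
    simp [LSeries.term_of_ne_zero] at hle
    nlinarith

lemma regL_two {q : ℕ} [NeZero q] {χ : DirichletCharacter ℂ q} (hχ : χ ^ 2 = 1) :
    (regL χ 2).im = 0 ∧ 1 / 3 ≤ (regL χ 2).re := by
  have h := re_LFunction_two hχ
  by_cases h1 : χ = 1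
  · subst h1
    rw [regL_one_apply (by norm_num)]
    norm_num
    simpa [DirichletCharacter.LFunctionTrivChar] using h
  · rwa [regL_of_ne h1]

section family

variable {q : ℕ} [NeZero q] {k : ℕ} {ψ : Fin k → DirichletCharacter ℂ q} {i₀ : Fin k}

lemma family_deriv (hi : ∀ i, ψ i = 1 ↔ i = i₀) {s : ℂ} (hs : 1 < s.re) :
    deriv (fun s => (∏ i, regL (ψ i) s) / (s - 1)) s =
      -(LSeries (∑ i, fun n => ψ i n * (ArithmeticFunction.vonMangoldt n : ℂ)) s *
        ((∏ i, regL (ψ i) s) / (s - 1))) := by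
  have hs1 : s - 1 ≠ 0 := by
    rw [sub_ne_zero]; rintro rfl; simp at hs
  have hne : ∀ i, regL (ψ i) s ≠ 0 := fun i => regL_ne_zero_of_one_le_re _ hs.le
  have hP : ∏ i, regL (ψ i) s ≠ 0 := Finset.prod_ne_zero_iff.2 fun i _ => hne i
  have hd : ∀ i, Differentiable ℂ (regL (ψ i)) := fun i => differentiable_regL _
  have h1 : logDeriv (fun s => (∏ i, regL (ψ i) s) / (s - 1)) s =
      -(LSeries (∑ i, fun n => ψ i n * (ArithmeticFunction.vonMangoldt n : ℂ)) s) := by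
    rw [logDeriv_div (f := fun s => ∏ i, regL (ψ i) s) (g := fun s => s - 1) _ hP hs1 (by fun_prop) (by fun_prop), logDeriv_prod (fun i _ => hne i)
      (fun i _ => (hd i) s), LSeries_sum fun i _ => summable_char_vonMangoldt _ hs]
    simp only [logDeriv_regL _ hs, hi, Finset.sum_add_distrib, Finset.sum_neg_distrib,
      Finset.sum_ite_eq', Finset.mem_univ, if_true]
    simp only [logDeriv_apply, deriv_sub_const, deriv_id'']
    ring
  rw [logDeriv_apply, div_eq_iff (div_ne_zero hP hs1)] at h1
  rw [h1]; ring

open scoped ComplexOrder in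
lemma family_nonneg (hi : ∀ i, ψ i = 1 ↔ i = i₀) (hpos : ∀ n : ℕ, 0 ≤ ∑ i, ψ i n)
    (h2 : 0 ≤ ∏ i, regL (ψ i) 2) (m : ℕ) :
    0 ≤ (-1) ^ m * iteratedDeriv m (fun s => (∏ i, regL (ψ i) s) / (s - 1)) 2 := by
  set P : ℂ → ℂ := LSeries (∑ i, fun n => ψ i n * (ArithmeticFunction.vonMangoldt n : ℂ)) with hP
  set F : ℂ → ℂ := fun s => (∏ i, regL (ψ i) s) / (s - 1) with hF
  have hd : ∀ i, Differentiable ℂ (regL (ψ i)) := fun i => differentiable_regL _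
  have habs : LSeries.abscissaOfAbsConv (∑ i, fun n => ψ i n * (ArithmeticFunction.vonMangoldt n : ℂ)) < (2 : ℝ) := by
    refine lt_of_le_of_lt (b := ((1 : ℝ) : EReal)) ?_ (by exact_mod_cast one_lt_two)
    refine LSeries.abscissaOfAbsConv_le_of_forall_lt_LSeriesSummable fun y hy => ?_
    exact LSeriesSummable.sum fun i _ => summable_char_vonMangoldt _ (by simpa using hy)
  have hPpos : ∀ m, 0 ≤ (-1) ^ m * iteratedDeriv m P 2 := by
    intro m
    have := LSeries.iteratedDeriv_alternating (a := ∑ i, fun n : ℕ => ψ i n * (ArithmeticFunction.vonMangoldt n : ℂ))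
      (fun n => ?_) habs m
    · simpa using this
    · rw [Finset.sum_apply, ← Finset.sum_mul]
      refine mul_nonneg (hpos n) ?_
      exact Complex.zero_le_real.2 ArithmeticFunction.vonMangoldt_nonneg
  have hPan : AnalyticAt ℂ P 2 := LSeries_analyticOnNhd _ 2 (by simpa using habs)
  have hFan : AnalyticAt ℂ F 2 := by
    refine AnalyticAt.div ?_ (by fun_prop) (by norm_num)
    exact Differentiable.analyticAt (by fun_prop) 2
  have hev : deriv F =ᶠ[𝓝 2] fun s => -(P s * F s) := by
    filter_upwards [(isOpen_lt continuous_const continuous_re).mem_nhds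
      (show (1 : ℝ) < (2 : ℂ).re by norm_num)] with s hs
    exact family_deriv hi hs
  induction m using Nat.strong_induction_on with
  | _ m ih =>
  rcases m with _ | m
  · simp only [pow_zero, one_mul, iteratedDeriv_zero, hF]
    norm_num
    exact h2
  · rw [iteratedDeriv_succ', hev.iteratedDeriv_eq, iteratedDeriv_fun_neg,
      iteratedDeriv_fun_mul hPan.contDiffAt hFan.contDiffAt, pow_succ, mul_assoc, neg_one_mul, neg_neg,
      Finset.mul_sum]
    refine Finset.sum_nonneg fun j hj => ?_
    have hjm : j ≤ m := by simpa [Nat.lt_succ_iff] using hj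
    have e : (-1 : ℂ) ^ m = (-1) ^ j * (-1) ^ (m - j) := by rw [← pow_add]; congr 1; omega
    have := mul_nonneg (hPpos j) (ih (m - j) (by omega))
    have hc : (0 : ℂ) ≤ (m.choose j : ℂ) := by exact_mod_cast Nat.zero_le _
    calc (0 : ℂ) ≤ (m.choose j : ℂ) * ((-1) ^ j * iteratedDeriv j P 2 * ((-1) ^ (m - j) * iteratedDeriv (m - j) F 2)) :=
          mul_nonneg hc this
      _ = _ := by rw [e]; ring

lemma family_norm_dslope_le (hk : k ≤ 4) {s : ℂ} (hs : s ∈ Metric.sphere (2 : ℂ) (4 / 3)) :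
    ‖dslope (fun s => ∏ i, regL (ψ i) s) 1 s‖ ≤ 6 * (100 * q) ^ 4 := by
  have hq : (1 : ℝ) ≤ q := by exact_mod_cast NeZero.one_le
  rw [mem_sphere_iff_norm] at hs
  have h1 : 1 / 3 ≤ ‖s - 1‖ := by
    have := norm_sub_norm_le (s - 1) (1 : ℂ)
    have h2 : ‖s - 2‖ ≤ ‖s - 1‖ + ‖(1 : ℂ)‖ := by
      rw [show s - 2 = s - 1 - 1 by ring]; exact norm_sub_le _ _
    have h3 : (1 : ℝ) ≤ ‖s - 1‖ + ‖s - 2‖ := by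
      calc (1 : ℝ) = ‖(s - 1) - (s - 2)‖ := by norm_num
        _ ≤ _ := norm_sub_le _ _
    rw [hs, norm_one] at h2
    linarith
  have hs1 : s ≠ 1 := by rintro rfl; norm_num at h1
  have hns : ‖s‖ ≤ 10 / 3 := by
    calc ‖s‖ = ‖(s - 2) + 2‖ := by ring_nf
      _ ≤ ‖s - 2‖ + ‖(2 : ℂ)‖ := norm_add_le _ _
      _ = 10 / 3 := by rw [hs]; norm_num
  have hre : 2 / 3 ≤ s.re := by
    have := (abs_re_le_norm (s - 2)).trans hs.le
    rw [abs_le] at this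
    simp at this; linarith
  have key : ∀ z : ℂ, ‖z‖ ≤ 10 / 3 → 2 / 3 ≤ z.re → ‖∏ i, regL (ψ i) z‖ ≤ (100 * q) ^ 4 := by
    intro z hz hzr
    rw [norm_prod]
    calc ∏ i, ‖regL (ψ i) z‖ ≤ ∏ _i : Fin k, (100 * q : ℝ) := by
          refine Finset.prod_le_prod (fun _ _ => norm_nonneg _) fun i _ => ?_
          refine (norm_regL_le _ (by linarith)).trans ?_
          have : (4 : ℝ) * (1 + ‖z‖) ^ 2 ≤ 100 := by nlinarith [norm_nonneg z]
          nlinarith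
      _ = (100 * q : ℝ) ^ k := by simp
      _ ≤ _ := pow_le_pow_right₀ (by linarith) hk
  rw [dslope_of_ne _ hs1, slope_def_field, norm_div, div_le_iff₀ (by linarith)]
  have k1 := key s hns hre
  have k2 := key 1 (by norm_num) (by norm_num)
  have := norm_sub_le (∏ i, regL (ψ i) s) (∏ i, regL (ψ i) 1)
  have hp : (0 : ℝ) ≤ (100 * q) ^ 4 := by positivity
  nlinarith

lemma exists_nat_pow_bounds {X : ℝ} (hX : 1 ≤ X) : ∃ N : ℕ, (27 / 32 : ℝ) ^ N ≤ 1 / X ∧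
    ∀ δ : ℝ, 0 ≤ δ → δ ≤ 1 → (1 + δ) ^ N ≤ 3 * X ^ (32 / 5 * δ) := by
  have hX0 : 0 < X := by linarith
  have hlog := Real.log_nonneg hX
  refine ⟨⌈32 / 5 * Real.log X⌉₊, ?_, fun δ h0 h1 => ?_⟩
  · have h1 : (27 / 32 : ℝ) ≤ Real.exp (-(5 / 32)) := by
      have := Real.add_one_le_exp (-(5 / 32))
      linarith
    calc (27 / 32 : ℝ) ^ ⌈32 / 5 * Real.log X⌉₊ ≤ Real.exp (-(5 / 32)) ^ ⌈32 / 5 * Real.log X⌉₊ := by gcongr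
      _ = Real.exp (⌈32 / 5 * Real.log X⌉₊ * -(5 / 32)) := by rw [← Real.exp_nat_mul]
      _ ≤ Real.exp (-Real.log X) := by
          gcongr
          have := Nat.le_ceil (32 / 5 * Real.log X)
          linarith
      _ = 1 / X := by rw [Real.exp_neg, Real.exp_log hX0, one_div]
  · have hce := (Nat.ceil_lt_add_one (a := 32 / 5 * Real.log X) (by positivity)).le
    calc (1 + δ) ^ ⌈32 / 5 * Real.log X⌉₊ ≤ Real.exp δ ^ ⌈32 / 5 * Real.log X⌉₊ := by
          gcongr
          linarith [Real.add_one_le_exp δ]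
      _ = Real.exp (⌈32 / 5 * Real.log X⌉₊ * δ) := by rw [← Real.exp_nat_mul]
      _ ≤ Real.exp (1 + Real.log X * (32 / 5 * δ)) := by
          gcongr
          nlinarith
      _ ≤ 3 * X ^ (32 / 5 * δ) := by
          rw [Real.exp_add, Real.rpow_def_of_pos hX0]
          gcongr
          linarith [Real.exp_one_lt_d9]

open scoped ComplexOrder in
/-- Lower bound for the residue at `1` of a product of `L`-functions of real characters. -/
lemma family_lower : ∃ c₀ : ℝ, 0 < c₀ ∧ ∀ (q : ℕ) [NeZero q] (k : ℕ) (ψ : Fin k → DirichletCharacter ℂ q)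
    (i₀ : Fin k), k ≤ 4 → (∀ i, ψ i = 1 ↔ i = i₀) → (∀ i, ψ i ^ 2 = 1) →
    (∀ n : ℕ, 0 ≤ ∑ i, ψ i n) →
    (∏ i, regL (ψ i) 1).im = 0 ∧ 0 ≤ (∏ i, regL (ψ i) 1).re ∧
    ∀ β : ℝ, 7 / 8 < β → β < 1 → (∏ i, regL (ψ i) β).im = 0 ∧
      (0 ≤ (∏ i, regL (ψ i) β).re →
        c₀ * (1 - β) * (q : ℝ) ^ (-(26 * (1 - β))) ≤ (∏ i, regL (ψ i) 1).re) := by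
  refine ⟨(1 / 3) ^ 4 / (12 * 900 ^ 4), by positivity, ?_⟩
  intro q _ k ψ i₀ hk hi hreal hpos
  have hq : (1 : ℝ) ≤ q := by exact_mod_cast NeZero.one_le
  have h2 : ∏ i, regL (ψ i) 2 = ((∏ i, (regL (ψ i) 2).re : ℝ) : ℂ) := by
    rw [ofReal_prod]
    refine Finset.prod_congr rfl fun i _ => ?_
    exact Complex.ext (by simp) (by simp [(regL_two (hreal i)).1])
  have hb : (1 / 3 : ℝ) ^ 4 ≤ ∏ i, (regL (ψ i) 2).re := by
    calc (1 / 3 : ℝ) ^ 4 ≤ (1 / 3) ^ k := pow_le_pow_of_le_one (by norm_num) (by norm_num) hk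
      _ = ∏ _i : Fin k, (1 / 3 : ℝ) := by simp
      _ ≤ _ := Finset.prod_le_prod (fun _ _ => by norm_num) fun i _ => (regL_two (hreal i)).2
  have hd : ∀ i, Differentiable ℂ (regL (ψ i)) := fun i => differentiable_regL _
  have h2pos : 0 ≤ ∏ i, regL (ψ i) 2 := by
    rw [h2, Complex.zero_le_real]
    exact le_trans (by positivity) hb
  obtain ⟨e1, e2, e3⟩ := estermann (H := fun s => ∏ i, regL (ψ i) s) (b := (1 / 3) ^ 4)
    (B := 6 * (100 * q) ^ 4) (by fun_prop) (fun s hs => family_norm_dslope_le hk hs)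
    (family_nonneg hi hpos h2pos) (by simp only [h2, ofReal_re]; exact hb)
  refine ⟨e1, e2, fun β h7 h1 => ⟨(e3 β h7 h1).1, fun h0 => ?_⟩⟩
  obtain ⟨N, hN1, hN2⟩ := exists_nat_pow_bounds (X := (900 * q : ℝ) ^ 4) (one_le_pow₀ (by linarith))
  have h4 := (e3 β h7 h1).2 h0 N
  have h5 := hN2 (1 - β) (by linarith) (by linarith)
  rw [show 1 + (1 - β) = 2 - β by ring] at h5
  have h6 : 32 / 5 * (6 * (100 * q : ℝ) ^ 4) * (27 / 32) ^ N ≤ (1 / 3) ^ 4 / 2 := by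
    calc 32 / 5 * (6 * (100 * q : ℝ) ^ 4) * (27 / 32) ^ N ≤ 32 / 5 * (6 * (100 * q : ℝ) ^ 4) * (1 / (900 * q : ℝ) ^ 4) := by
          gcongr
      _ ≤ _ := by
          field_simp
          norm_num
  have h7' : ((900 * q : ℝ) ^ 4) ^ (32 / 5 * (1 - β)) ≤ 900 ^ 4 * (q : ℝ) ^ (26 * (1 - β)) := by
    rw [← Real.rpow_natCast, ← Real.rpow_mul (by positivity), Real.mul_rpow (by norm_num) (by positivity)]
    refine mul_le_mul ?_ ?_ (by positivity) (by positivity)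
    · rw [← Real.rpow_natCast 900 4]
      exact Real.rpow_le_rpow_of_exponent_le (by norm_num) (by push_cast; linarith)
    · exact Real.rpow_le_rpow_of_exponent_le hq (by push_cast; linarith)
  set l := (∏ i, regL (ψ i) 1).re
  have h8 : (1 / 3 : ℝ) ^ 4 / 2 ≤ 2 * l * (3 * (900 ^ 4 * (q : ℝ) ^ (26 * (1 - β)))) / (1 - β) := by
    calc (1 / 3 : ℝ) ^ 4 / 2 ≤ 2 * l * (2 - β) ^ N / (1 - β) := by linarith
      _ ≤ _ := by
        have : 0 < 1 - β := by linarith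
        gcongr
        exact h5.trans (by gcongr)
  have hqp : 0 < (q : ℝ) ^ (26 * (1 - β)) := by positivity
  rw [le_div_iff₀ (by linarith)] at h8
  rw [Real.rpow_neg (by positivity), ← div_eq_mul_inv, div_le_iff₀ hqp, div_mul_eq_mul_div, div_le_iff₀ (by positivity)]
  linarith

end family

lemma quadratic_apply {q : ℕ} {χ : DirichletCharacter ℂ q} (h2 : χ ^ 2 = 1) {a : ZMod q} (ha : IsUnit a) :
    χ a = 1 ∨ χ a = -1 := by
  have h : χ a ^ 2 = 1 := by
    rw [← MulChar.pow_apply' χ two_ne_zero, h2, MulChar.one_apply ha]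
  exact mul_self_eq_one_iff.1 (by rw [← sq, h])

lemma norm_regL_one_one_le (q : ℕ) [NeZero q] : ‖regL (1 : DirichletCharacter ℂ q) 1‖ ≤ 1 := by
  rw [regL_one_eq (by simp)]
  simp only [sub_self, zero_mul, add_zero, mul_one, norm_prod]
  refine Finset.prod_le_one (fun _ _ => norm_nonneg _) fun p hp => ?_
  have hp1 : (1 : ℝ) ≤ p := by exact_mod_cast (Nat.prime_of_mem_primeFactors hp).one_le
  have : (1 : ℂ) - (p : ℂ) ^ (-1 : ℂ) = ((1 - (p : ℝ)⁻¹ : ℝ) : ℂ) := by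
    rw [Complex.cpow_neg_one]; push_cast; rfl
  rw [this, Complex.norm_real, Real.norm_eq_abs, abs_le]
  have := inv_le_one_of_one_le₀ hp1
  have : 0 ≤ (p : ℝ)⁻¹ := by positivity
  constructor <;> linarith

lemma two_family_lower : ∃ c : ℝ, 0 < c ∧ ∀ (q : ℕ) [NeZero q] (χ : DirichletCharacter ℂ q), χ ≠ 1 → χ ^ 2 = 1 →
    (regL (1 : DirichletCharacter ℂ q) 1 * regL χ 1).im = 0 ∧ 0 ≤ (regL (1 : DirichletCharacter ℂ q) 1 * regL χ 1).re ∧ ∀ β : ℝ, 7 / 8 < β → β < 1 →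
      (regL (1 : DirichletCharacter ℂ q) β * regL χ β).im = 0 ∧ (0 ≤ (regL (1 : DirichletCharacter ℂ q) β * regL χ β).re →
        c * (1 - β) * (q : ℝ) ^ (-(26 * (1 - β))) ≤ ‖regL χ 1‖) := by
  obtain ⟨c, hc, h⟩ := family_lower
  refine ⟨c, hc, fun q _ χ h1 h2 => ?_⟩
  have := h q 2 ![1, χ] 0 (by norm_num) (by intro i; fin_cases i <;> simp [h1])
    (by intro i; fin_cases i <;> simp [h2]) (by
      intro n
      simp only [Fin.sum_univ_two, Matrix.cons_val_zero, Matrix.cons_val_one]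
      by_cases hn : IsUnit (n : ZMod q)
      · rw [MulChar.one_apply hn]
        rcases quadratic_apply h2 hn with h | h <;> rw [h] <;> norm_num [Complex.le_def]
      · rw [MulChar.map_nonunit _ hn, MulChar.map_nonunit _ hn]; simp)
  simp only [Fin.prod_univ_two, Matrix.cons_val_zero, Matrix.cons_val_one] at this
  refine ⟨this.1, this.2.1, fun β hb hb1 => ⟨(this.2.2 β hb hb1).1, fun h0 => ((this.2.2 β hb hb1).2 h0).trans ?_⟩⟩
  refine (Complex.re_le_norm _).trans ?_
  rw [norm_mul]
  exact mul_le_of_le_one_left (norm_nonneg _) (norm_regL_one_one_le q)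

lemma four_family_lower : ∃ c : ℝ, 0 < c ∧ ∀ (q : ℕ) [NeZero q] (χ χ' : DirichletCharacter ℂ q), χ ≠ 1 → χ ^ 2 = 1 →
    χ' ≠ 1 → χ' ^ 2 = 1 → χ * χ' ≠ 1 → ∀ β : ℝ, 7 / 8 < β → β < 1 → regL χ β = 0 →
        c * (1 - β) * (q : ℝ) ^ (-(26 * (1 - β))) ≤ ‖regL χ 1‖ * ‖regL χ' 1‖ * ‖regL (χ * χ') 1‖ := by
  obtain ⟨c, hc, h⟩ := family_lower
  refine ⟨c, hc, fun q _ χ χ' h1 h2 h1' h2' h12 β hb hb1 h0 => ?_⟩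
  have := h q 4 ![1, χ, χ', χ * χ'] 0 (by norm_num) (by intro i; fin_cases i <;> simp [h1, h1', h12])
    (by intro i; fin_cases i <;> simp [h2, h2', mul_pow]) (by
      intro n
      simp only [Fin.sum_univ_four, Matrix.cons_val_zero, Matrix.cons_val_one, Matrix.cons_val]
      by_cases hn : IsUnit (n : ZMod q)
      · rw [MulChar.one_apply hn, MulChar.mul_apply]
        rcases quadratic_apply h2 hn with h | h <;> rcases quadratic_apply h2' hn with h' | h' <;>
          rw [h, h'] <;> norm_num [Complex.le_def]
      · simp [MulChar.map_nonunit _ hn])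
  simp only [Fin.prod_univ_four, Matrix.cons_val_zero, Matrix.cons_val_one, Matrix.cons_val] at this
  refine ((this.2.2 β hb hb1).2 (by simp [h0])).trans ?_
  refine (Complex.re_le_norm _).trans ?_
  rw [norm_mul, norm_mul, norm_mul]
  gcongr
  exact mul_le_of_le_one_left (norm_nonneg _) (norm_regL_one_one_le q)

lemma regL_one_ofReal_ne_zero (q : ℕ) [NeZero q] {σ : ℝ} (h : 1 / 2 < σ) (h1 : σ ≤ 1) :
    regL (1 : DirichletCharacter ℂ q) σ ≠ 0 := by
  rw [regL_one_eq (by simp; linarith)]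
  refine mul_ne_zero (Finset.prod_ne_zero_iff.2 fun p hp h0 => ?_) fun h0 => ?_
  · have hp1 : (1 : ℝ) < p := by exact_mod_cast (Nat.prime_of_mem_primeFactors hp).one_lt
    have := congrArg norm (sub_eq_zero.1 h0)
    rw [norm_one, Complex.norm_natCast_cpow_of_pos (Nat.prime_of_mem_primeFactors hp).pos] at this
    have h3 := Real.rpow_lt_one_of_one_lt_of_neg hp1 (z := -σ) (by linarith)
    simp at this
    linarith
  · have h2 := norm_zetaReg_le (s := σ) (by simp; linarith)
    have h3 : ((σ : ℂ) - 1) * zetaReg σ = -1 := by linear_combination h0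
    have h4 := congrArg norm h3
    rw [norm_mul, norm_neg, norm_one] at h4
    have h5 : ‖(σ : ℂ) - 1‖ = 1 - σ := by
      rw [← Complex.ofReal_one, ← Complex.ofReal_sub, Complex.norm_real, Real.norm_eq_abs, abs_of_nonpos (by linarith)]
      ring
    have h6 : ‖(σ : ℂ)‖ / (σ : ℂ).re = 1 := by
      rw [Complex.norm_real, Real.norm_eq_abs, abs_of_pos (by linarith), Complex.ofReal_re, div_self (by linarith)]
    rw [h6] at h2
    rw [h5] at h4
    nlinarith [norm_nonneg (zetaReg σ)]

lemma siegel_of_no_zero {δ : ℝ} (hδ : 0 < δ) (hδ1 : δ < 1 / 8) : ∃ c : ℝ, 0 < c ∧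
    ∀ (q : ℕ) [NeZero q] (χ : DirichletCharacter ℂ q), χ ≠ 1 → χ ^ 2 = 1 →
      (∀ β : ℝ, 1 - δ ≤ β → β < 1 → regL χ β ≠ 0) → c * (q : ℝ) ^ (-(26 * δ)) ≤ ‖regL χ 1‖ := by
  obtain ⟨c, hc, h⟩ := two_family_lower
  refine ⟨c * δ, by positivity, fun q _ χ h1 h2 hz => ?_⟩
  obtain ⟨e1, e2, e3⟩ := h q χ h1 h2
  obtain ⟨-, e4⟩ := e3 (1 - δ) (by linarith) (by linarith)
  have key : 0 ≤ (regL (1 : DirichletCharacter ℂ q) ((1 - δ : ℝ) : ℂ) * regL χ ((1 - δ : ℝ) : ℂ)).re := by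
    by_contra! hneg
    have hcont : Continuous fun σ : ℝ => (regL (1 : DirichletCharacter ℂ q) (σ : ℂ) * regL χ (σ : ℂ)).re :=
      Complex.continuous_re.comp (((differentiable_regL _).continuous.comp Complex.continuous_ofReal).mul
        ((differentiable_regL _).continuous.comp Complex.continuous_ofReal))
    have := intermediate_value_Icc (by linarith : 1 - δ ≤ 1) hcont.continuousOn
    obtain ⟨σ, hσ, h0⟩ := this (Set.mem_Icc.2 ⟨hneg.le, by simpa using e2⟩)
    simp only at h0
    have him : (regL (1 : DirichletCharacter ℂ q) (σ : ℂ) * regL χ (σ : ℂ)).im = 0 := by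
      rcases hσ.2.lt_or_eq with h' | h'
      · exact (e3 σ (by linarith [hσ.1]) h').1
      · rw [h']; simpa using e1
    have h00 := Complex.ext (z := regL (1 : DirichletCharacter ℂ q) (σ : ℂ) * regL χ (σ : ℂ)) (w := 0) h0 him
    rcases mul_eq_zero.1 h00 with h' | h'
    · exact regL_one_ofReal_ne_zero q (by linarith [hσ.1]) hσ.2 h'
    · rcases hσ.2.lt_or_eq with h'' | h''
      · exact hz σ hσ.1 h'' h'
      · exact regL_ne_zero_of_one_le_re χ (by simp [h'']) h'
  have := e4 key
  simpa using this

lemma norm_LFunction_changeLevel_one_le {q₁ q₂ : ℕ} [NeZero q₁] [NeZero q₂] (χ : DirichletCharacter ℂ q₂) (h : χ ≠ 1) :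
    ‖DirichletCharacter.LFunction (DirichletCharacter.changeLevel (Nat.dvd_mul_left q₂ q₁) χ) 1‖ ≤
      2 ^ q₁.primeFactors.card * ‖DirichletCharacter.LFunction χ 1‖ := by
  rw [DirichletCharacter.LFunction_changeLevel _ _ (Or.inl h), norm_mul, mul_comm, norm_prod]
  gcongr
  calc ∏ p ∈ (q₁ * q₂).primeFactors, ‖1 - χ p * (p : ℂ) ^ (-1 : ℂ)‖
      ≤ ∏ p ∈ (q₁ * q₂).primeFactors, if p ∈ q₁.primeFactors then (2 : ℝ) else 1 := by
        refine Finset.prod_le_prod (fun _ _ => norm_nonneg _) fun p hp => ?_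
        have hpp := Nat.prime_of_mem_primeFactors hp
        split_ifs with hp1
        · refine (norm_sub_le _ _).trans ?_
          rw [norm_one, norm_mul, Complex.cpow_neg_one, norm_inv, Complex.norm_natCast]
          have h1 : ‖χ p‖ ≤ 1 := DirichletCharacter.norm_le_one _ _
          have h2 : (p : ℝ)⁻¹ ≤ 1 := inv_le_one_of_one_le₀ (by exact_mod_cast hpp.one_le)
          have h3 : 0 ≤ (p : ℝ)⁻¹ := by positivity
          nlinarith [norm_nonneg (χ p)]
        · have hq2 : p ∣ q₂ := by
            rw [Nat.primeFactors_mul (NeZero.ne _) (NeZero.ne _), Finset.mem_union] at hp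
            exact Nat.dvd_of_mem_primeFactors (hp.resolve_left hp1)
          have : ¬ IsUnit (p : ZMod q₂) := by
            rw [ZMod.isUnit_iff_coprime, hpp.coprime_iff_not_dvd]; simpa using hq2
          simp [MulChar.map_nonunit _ this]
    _ = ∏ p ∈ (q₁ * q₂).primeFactors ∩ q₁.primeFactors, (2 : ℝ) := Finset.prod_ite_mem _ _ _
    _ ≤ 2 ^ q₁.primeFactors.card := by
        rw [Finset.prod_const]
        exact pow_le_pow_right₀ (by norm_num) (Finset.card_le_card Finset.inter_subset_right)

lemma siegel_of_zero {q₁ : ℕ} [NeZero q₁] (χ₁ : DirichletCharacter ℂ q₁) (h11 : χ₁ ≠ 1) (h12 : χ₁ ^ 2 = 1)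
    {β ε : ℝ} (hβ : 7 / 8 < β) (hβ1 : β < 1) (h0 : regL χ₁ β = 0) (hε : 0 < ε) (hε1 : ε ≤ 1) :
    ∃ c : ℝ, 0 < c ∧
    ∀ (q : ℕ) [NeZero q] (χ : DirichletCharacter ℂ q), χ ≠ 1 → χ ^ 2 = 1 →
      c * (q : ℝ) ^ (-(26 * (1 - β) + 2 * ε)) ≤ ‖regL χ 1‖ := by
  obtain ⟨c, hc, h⟩ := two_family_lower
  obtain ⟨c', hc', h'⟩ := four_family_lower
  set B : ℝ := 2 ^ q₁.primeFactors.card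
  have hB : 0 < B := by positivity
  have hq1 : (0 : ℝ) < q₁ := by exact_mod_cast NeZero.pos q₁
  refine ⟨min c c' * (1 - β) * ε ^ 2 / B * (q₁ : ℝ) ^ (-(26 * (1 - β) + 2 * ε)), ?_, fun q _ χ h1 h2 => ?_⟩
  · have := lt_min hc hc'
    have : 0 < 1 - β := by linarith
    positivity
  have : NeZero (q₁ * q) := ⟨mul_ne_zero (NeZero.ne _) (NeZero.ne _)⟩
  have hq0 : (0 : ℝ) < q := by exact_mod_cast NeZero.pos q
  have hqq : (1 : ℝ) ≤ ((q₁ * q : ℕ) : ℝ) := by exact_mod_cast NeZero.one_le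
  obtain ⟨ψ₁, hψ₁⟩ : ∃ ψ, ψ = DirichletCharacter.changeLevel (Nat.dvd_mul_right q₁ q) χ₁ := ⟨_, rfl⟩
  obtain ⟨ψ, hψ⟩ : ∃ ψ, ψ = DirichletCharacter.changeLevel (Nat.dvd_mul_left q q₁) χ := ⟨_, rfl⟩
  have n1 : ψ₁ ≠ 1 := by
    rw [hψ₁, Ne, DirichletCharacter.changeLevel_eq_one_iff]; exact h11
  have n2 : ψ ≠ 1 := by
    rw [hψ, Ne, DirichletCharacter.changeLevel_eq_one_iff]; exact h1
  have s1 : ψ₁ ^ 2 = 1 := by rw [hψ₁, ← map_pow, h12, map_one]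
  have s2 : ψ ^ 2 = 1 := by rw [hψ, ← map_pow, h2, map_one]
  have z1 : regL ψ₁ β = 0 := by
    rw [regL_of_ne n1, hψ₁, DirichletCharacter.LFunction_changeLevel _ _ (Or.inl h11), ← regL_of_ne h11, h0, zero_mul]
  have up : ∀ φ : DirichletCharacter ℂ (q₁ * q), φ ≠ 1 → ‖regL φ 1‖ ≤ ((q₁ * q : ℕ) : ℝ) ^ ε / ε := by
    intro φ hφ
    rw [regL_of_ne hφ]
    have := norm_LFunction_le_rpow hφ hε.le hε1 (s := 1) (by simp; linarith)
    simpa using this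
  have hBb : ‖regL ψ 1‖ ≤ B * ‖regL χ 1‖ := by
    rw [regL_of_ne n2, regL_of_ne h1, hψ]
    exact norm_LFunction_changeLevel_one_le χ h1
  have hQ : 0 < ((q₁ * q : ℕ) : ℝ) ^ ε := by positivity
  have hQ1 : 1 ≤ ((q₁ * q : ℕ) : ℝ) ^ ε / ε := by
    rw [one_le_div hε]
    exact hε1.trans (Real.one_le_rpow hqq hε.le)
  have main : min c c' * (1 - β) * ((q₁ * q : ℕ) : ℝ) ^ (-(26 * (1 - β))) ≤
      (((q₁ * q : ℕ) : ℝ) ^ ε / ε) ^ 2 * (B * ‖regL χ 1‖) := by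
    have hβ' : 0 < 1 - β := by linarith
    by_cases h12 : ψ₁ * ψ = 1
    · have he : ψ = ψ₁ := by
        calc ψ = ψ₁ ^ 2 * ψ := by rw [s1, one_mul]
          _ = ψ₁ * (ψ₁ * ψ) := by rw [sq, mul_assoc]
          _ = ψ₁ := by rw [h12, mul_one]
      have := ((h _ ψ n2 s2).2.2 β hβ hβ1).2 (by simp [he, z1])
      calc _ ≤ c * (1 - β) * ((q₁ * q : ℕ) : ℝ) ^ (-(26 * (1 - β))) := by gcongr; exact min_le_left _ _
        _ ≤ _ := this
        _ ≤ B * ‖regL χ 1‖ := hBb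
        _ ≤ _ := le_mul_of_one_le_left (by positivity) (one_le_pow₀ hQ1)
    · have := h' _ ψ₁ ψ n1 s1 n2 s2 h12 β hβ hβ1 z1
      calc _ ≤ c' * (1 - β) * ((q₁ * q : ℕ) : ℝ) ^ (-(26 * (1 - β))) := by gcongr; exact min_le_right _ _
        _ ≤ _ := this
        _ ≤ (((q₁ * q : ℕ) : ℝ) ^ ε / ε) * (B * ‖regL χ 1‖) * (((q₁ * q : ℕ) : ℝ) ^ ε / ε) := by
            gcongr
            · exact up _ n1
            · exact up _ h12
        _ = _ := by ring
  have e1 : (q₁ : ℝ) ^ (-(26 * (1 - β) + 2 * ε)) * (q : ℝ) ^ (-(26 * (1 - β) + 2 * ε)) =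
      ((q₁ * q : ℕ) : ℝ) ^ (-(26 * (1 - β))) / (((q₁ * q : ℕ) : ℝ) ^ ε) ^ 2 := by
    rw [← Real.mul_rpow hq1.le hq0.le, neg_add, Nat.cast_mul, Real.rpow_add (by positivity),
      Real.rpow_neg (by positivity) (2 * ε), div_eq_mul_inv, ← Real.rpow_natCast _ 2, ← Real.rpow_mul (by positivity)]
    congr 3
    push_cast; ring
  calc min c c' * (1 - β) * ε ^ 2 / B * (q₁ : ℝ) ^ (-(26 * (1 - β) + 2 * ε)) * (q : ℝ) ^ (-(26 * (1 - β) + 2 * ε))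
      = min c c' * (1 - β) * ((q₁ * q : ℕ) : ℝ) ^ (-(26 * (1 - β))) * (ε ^ 2 / (B * (((q₁ * q : ℕ) : ℝ) ^ ε) ^ 2)) := by
        rw [mul_assoc, e1]; field_simp
    _ ≤ (((q₁ * q : ℕ) : ℝ) ^ ε / ε) ^ 2 * (B * ‖regL χ 1‖) * (ε ^ 2 / (B * (((q₁ * q : ℕ) : ℝ) ^ ε) ^ 2)) := by
        gcongr
    _ = ‖regL χ 1‖ := by field_simp

/-- The lower bound of Siegel for `L(1, χ)`, `χ` quadratic. -/
theorem siegel {ε : ℝ} (hε : 0 < ε) : ∃ c : ℝ, 0 < c ∧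
    ∀ (q : ℕ) [NeZero q] (χ : DirichletCharacter ℂ q), χ ≠ 1 → χ ^ 2 = 1 → c * (q : ℝ) ^ (-ε) ≤ ‖regL χ 1‖ := by
  set δ := min (ε / 100) (1 / 16)
  have hδ : 0 < δ := lt_min (by positivity) (by norm_num)
  have hδε : δ ≤ ε / 100 := min_le_left _ _
  have hδ1 : δ ≤ 1 / 16 := min_le_right _ _
  have hmono : ∀ (q : ℕ) [NeZero q] (c y : ℝ), 0 < c → y ≤ ε → c * (q : ℝ) ^ (-ε) ≤ c * (q : ℝ) ^ (-y) := by
    intro q _ c y hc hy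
    have : (1 : ℝ) ≤ q := by exact_mod_cast NeZero.one_le
    gcongr
  by_cases hz : ∃ (q : ℕ) (_ : NeZero q) (χ : DirichletCharacter ℂ q) (β : ℝ), χ ≠ 1 ∧ χ ^ 2 = 1 ∧ 1 - δ ≤ β ∧
      β < 1 ∧ regL χ β = 0
  · obtain ⟨q₁, _, χ₁, β, h11, h12, hb, hb1, h0⟩ := hz
    obtain ⟨c, hc, h⟩ := siegel_of_zero χ₁ h11 h12 (by linarith) hb1 h0 hδ (by linarith)
    exact ⟨c, hc, fun q _ χ h1 h2 => (hmono q c _ hc (by linarith)).trans (h q χ h1 h2)⟩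
  · push Not at hz
    obtain ⟨c, hc, h⟩ := siegel_of_no_zero hδ (by linarith)
    exact ⟨c, hc, fun q _ χ h1 h2 => (hmono q c _ hc (by linarith)).trans
      (h q χ h1 h2 fun β hb hb1 => hz q inferInstance χ β h1 h2 hb hb1)⟩

lemma regL_one_ne_zero_of_norm_sub_lt (q : ℕ) [NeZero q] {s : ℂ} (h : ‖s - 1‖ < 1 / 8) :
    regL (1 : DirichletCharacter ℂ q) s ≠ 0 := by
  have hre : 7 / 8 < s.re := by
    have := (Complex.abs_re_le_norm (s - 1)).trans_lt h
    rw [Complex.sub_re, Complex.one_re, abs_lt] at this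
    linarith [this.1]
  rw [regL_one_eq (by linarith)]
  refine mul_ne_zero (Finset.prod_ne_zero_iff.2 fun p hp h0 => ?_) fun h0 => ?_
  · have hp1 : (1 : ℝ) < p := by exact_mod_cast (Nat.prime_of_mem_primeFactors hp).one_lt
    have := congrArg norm (sub_eq_zero.1 h0)
    rw [norm_one, Complex.norm_natCast_cpow_of_pos (Nat.prime_of_mem_primeFactors hp).pos] at this
    have h3 := Real.rpow_lt_one_of_one_lt_of_neg hp1 (z := (-s).re) (by simp; linarith)
    linarith
  · have h2 := norm_zetaReg_le (s := s) (by linarith)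
    have h3 : (s - 1) * zetaReg s = -1 := by linear_combination h0
    have h4 := congrArg norm h3
    rw [norm_mul, norm_neg, norm_one] at h4
    have h6 : ‖s‖ ≤ 9 / 8 := by
      calc ‖s‖ = ‖(s - 1) + 1‖ := by ring_nf
        _ ≤ ‖s - 1‖ + ‖(1 : ℂ)‖ := norm_add_le _ _
        _ ≤ _ := by rw [norm_one]; linarith
    have h7 : ‖s‖ / s.re ≤ 9 / 7 := by
      rw [div_le_iff₀ (by linarith)]; linarith
    nlinarith [norm_nonneg (zetaReg s), norm_nonneg (s - 1)]

/-- Zeros of quadratic (or trivial) `L`-functions keep away from `1`. -/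
lemma norm_zero_sub_one_ge {ε : ℝ} (hε : 0 < ε) (hε1 : ε ≤ 1) : ∃ c : ℝ, 0 < c ∧ c ≤ 1 ∧
    ∀ (q : ℕ) [NeZero q] (χ : DirichletCharacter ℂ q), χ ^ 2 = 1 → ∀ ρ : ℂ, regL χ ρ = 0 →
      c * (q : ℝ) ^ (-ε) ≤ ‖ρ - 1‖ := by
  obtain ⟨c, hc, h⟩ := siegel (half_pos hε)
  refine ⟨min (min (ε / 8) (c * ε ^ 2 / 64)) (1 / 8), by positivity, (min_le_right _ _).trans (by norm_num),
    fun q _ χ h2 ρ h0 => ?_⟩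
  have hq : (1 : ℝ) ≤ q := by exact_mod_cast NeZero.one_le
  have hq1 : (q : ℝ) ^ (-ε) ≤ 1 := Real.rpow_le_one_of_one_le_of_nonpos hq (by linarith)
  have hq0 : 0 < (q : ℝ) ^ (-ε) := by positivity
  by_cases h1 : χ = 1
  · have : 1 / 8 ≤ ‖ρ - 1‖ := by
      by_contra! hlt
      subst h1
      exact regL_one_ne_zero_of_norm_sub_lt q hlt h0
    refine le_trans ?_ this
    calc _ ≤ 1 / 8 * (q : ℝ) ^ (-ε) := by gcongr; exact min_le_right _ _
      _ ≤ _ := by linarith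
  · by_cases hρ : ε / 8 < ‖ρ - 1‖
    · refine le_trans ?_ hρ.le
      calc _ ≤ ε / 8 * (q : ℝ) ^ (-ε) := by gcongr; exact (min_le_left _ _).trans (min_le_left _ _)
        _ ≤ _ := mul_le_of_le_one_right (by positivity) hq1
    · push Not at hρ
      have hb : ∀ z : ℂ, ‖z - 1‖ ≤ ε / 4 → ‖regL χ z‖ ≤ 2 * ((q : ℝ) ^ (ε / 2) / (ε / 4)) := by
        intro z hz
        have hre : 1 - ε / 4 ≤ z.re := by
          have := (Complex.abs_re_le_norm (z - 1)).trans hz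
          rw [Complex.sub_re, Complex.one_re, abs_le] at this
          linarith [this.1]
        have hn : ‖z‖ ≤ 2 := by
          calc ‖z‖ = ‖(z - 1) + 1‖ := by ring_nf
            _ ≤ ‖z - 1‖ + ‖(1 : ℂ)‖ := norm_add_le _ _
            _ ≤ _ := by rw [norm_one]; linarith
        rw [regL_of_ne h1]
        refine (norm_LFunction_le_rpow h1 (half_pos hε).le (by linarith) (by linarith)).trans ?_
        have : 0 < z.re - (1 - ε / 2) := by linarith
        gcongr
        linarith
      have hd : ∀ z ∈ Metric.closedBall (1 : ℂ) (ε / 8), ‖deriv (regL χ) z‖ ≤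
          2 * ((q : ℝ) ^ (ε / 2) / (ε / 4)) / (ε / 8) := by
        intro z hz
        refine Complex.norm_deriv_le_of_forall_mem_sphere_norm_le (by positivity)
          (differentiable_regL χ).diffContOnCl fun w hw => hb w ?_
        rw [mem_sphere_iff_norm] at hw
        rw [mem_closedBall_iff_norm] at hz
        calc ‖w - 1‖ = ‖(w - z) + (z - 1)‖ := by ring_nf
          _ ≤ ‖w - z‖ + ‖z - 1‖ := norm_add_le _ _
          _ ≤ _ := by linarith
      have hmv := (convex_closedBall (1 : ℂ) (ε / 8)).norm_image_sub_le_of_norm_deriv_le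
        (fun z _ => (differentiable_regL χ) z) hd (mem_closedBall_iff_norm.2 hρ)
        (Metric.mem_closedBall_self (by positivity))
      rw [h0, sub_zero, norm_sub_rev] at hmv
      have h3 := (h q χ h1 h2).trans hmv
      have hQ : 0 < (q : ℝ) ^ (ε / 2) := by positivity
      have e1 : (q : ℝ) ^ (-ε) = (q : ℝ) ^ (-(ε / 2)) / (q : ℝ) ^ (ε / 2) := by
        rw [Real.rpow_neg (by positivity) (ε / 2), div_eq_mul_inv, ← mul_inv, ← Real.rpow_add (by positivity),
          ← Real.rpow_neg (by positivity)]
        ring_nf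
      calc _ ≤ c * ε ^ 2 / 64 * (q : ℝ) ^ (-ε) := by gcongr; exact (min_le_left _ _).trans (min_le_right _ _)
        _ = (c * (q : ℝ) ^ (-(ε / 2))) * (ε ^ 2 / (64 * (q : ℝ) ^ (ε / 2))) := by rw [e1]; field_simp
        _ ≤ (2 * ((q : ℝ) ^ (ε / 2) / (ε / 4)) / (ε / 8) * ‖ρ - 1‖) * (ε ^ 2 / (64 * (q : ℝ) ^ (ε / 2))) := by gcongr
        _ = _ := by field_simp; ring

lemma neg_re_logDeriv_regL_le {q : ℕ} [NeZero q] (χ : DirichletCharacter ℂ q) {δ t : ℝ} (h0 : 0 < δ) (h1 : δ ≤ 1 / 8) :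
    -(logDeriv (regL χ) ((1 + δ : ℝ) + t * I)).re ≤ 448 * Real.log (12 * q * (|t| + 4) ^ 2 / δ ^ 2) ∧
    ∀ β : ℝ, 7 / 8 ≤ β → β ≤ 1 → regL χ (β + t * I) = 0 → -(logDeriv (regL χ) ((1 + δ : ℝ) + t * I)).re ≤
      448 * Real.log (12 * q * (|t| + 4) ^ 2 / δ ^ 2) + 2 - 1 / (1 + δ - β) := by
  have hq : (1 : ℝ) ≤ q := by exact_mod_cast NeZero.one_le
  set w : ℂ := (1 + δ : ℝ) + t * I
  have hw : w.re = 1 + δ := by simp [w]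
  have hnw : ‖w‖ ≤ 9 / 8 + |t| := by
    refine (norm_add_le _ _).trans ?_
    rw [Complex.norm_real, norm_mul, Complex.norm_I, mul_one, Complex.norm_real, Real.norm_eq_abs, Real.norm_eq_abs,
      abs_of_pos (by linarith)]
    linarith
  have hX : 1 < 12 * q * (|t| + 4) ^ 2 / δ ^ 2 := by
    rw [lt_div_iff₀ (by positivity)]
    nlinarith [abs_nonneg t]
  have hge := norm_regL_ge χ h0 (by linarith) hw
  obtain ⟨l1, l2⟩ := landau (f := regL χ) (c := w) (R := 1 / 2) (M := Real.log (12 * q * (|t| + 4) ^ 2 / δ ^ 2))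
    (by norm_num) (Real.log_pos hX) (differentiable_regL χ) (regL_ne_zero_of_one_le_re χ (by linarith)) (by
      intro z hz
      rw [mem_closedBall_iff_norm] at hz
      rw [Real.exp_log (by linarith)]
      have hre : 1 / 2 ≤ z.re := by
        have := (Complex.abs_re_le_norm (z - w)).trans hz
        rw [Complex.sub_re, hw, abs_le] at this
        linarith [this.1]
      have hn : 1 + ‖z‖ ≤ |t| + 4 := by
        have : ‖z‖ ≤ ‖z - w‖ + ‖w‖ := by
          calc ‖z‖ = ‖(z - w) + w‖ := by ring_nf
            _ ≤ _ := norm_add_le _ _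
        linarith
      calc ‖regL χ z‖ ≤ q * (4 * (1 + ‖z‖) ^ 2) := norm_regL_le χ hre
        _ ≤ q * (4 * (|t| + 4) ^ 2) := by gcongr
        _ = 12 * q * (|t| + 4) ^ 2 / δ ^ 2 * (δ ^ 2 / 3) := by field_simp; norm_num
        _ ≤ _ := by gcongr)
    (by
      intro z hz
      by_contra! hlt
      exact regL_ne_zero_of_one_le_re χ (by linarith) hz)
  refine ⟨by linarith, fun β hb hb1 hz => ?_⟩
  have hsub : ((β : ℂ) + t * I) - w = ((-(1 + δ - β) : ℝ) : ℂ) := by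
    simp only [w]; push_cast; ring
  have := l2 (β + t * I) (by
    rw [hsub, Complex.norm_real, Real.norm_eq_abs, abs_neg, abs_of_pos (by linarith)]
    linarith) hz
  rw [hsub, ← Complex.ofReal_one, ← Complex.ofReal_div, Complex.ofReal_re, div_neg] at this
  linarith

lemma re_one_div_le {δ t : ℝ} (ht : 0 < |t|) : (1 / ((δ : ℂ) + t * I)).re ≤ 1 / |t| := by
  refine (Complex.re_le_norm _).trans ?_
  rw [norm_div, norm_one]
  gcongr
  have := Complex.abs_im_le_norm ((δ : ℂ) + t * I)
  simpa using this

/-- The zero-free region, uniform in the modulus. -/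
theorem zero_free {ε : ℝ} (hε : 0 < ε) (hε1 : ε ≤ 1) : ∃ c : ℝ, 0 < c ∧ c ≤ 1 / 8 ∧
    ∀ (q : ℕ) [NeZero q] (χ : DirichletCharacter ℂ q) (V β t : ℝ), 1 ≤ V → Real.log (q * (|t| + 3)) ≤ V →
      (q : ℝ) ^ ε ≤ V → regL χ (β + t * I) = 0 → β < 1 - c / V := by
  obtain ⟨c₁, hc₁, hc₁1, hz⟩ := norm_zero_sub_one_ge hε hε1
  obtain ⟨y, hy8, hy⟩ : ∃ y : ℝ, 8 ≤ y ∧ 3584 * (8 + 2 * Real.log y) + 8 + 10 / c₁ ≤ y / 4 := by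
    have h1 : ∀ᶠ y : ℝ in atTop, ‖Real.log y‖ ≤ (1 / 57344) * ‖y‖ := Real.isLittleO_log_id_atTop.def (by norm_num)
    obtain ⟨y, h1, h2, h3⟩ := (h1.and ((eventually_ge_atTop 8).and
      (eventually_ge_atTop (8 * (28680 + 10 / c₁))))).exists
    refine ⟨y, h2, ?_⟩
    rw [Real.norm_eq_abs, Real.norm_eq_abs, abs_of_pos (by linarith : 0 < y)] at h1
    have := le_abs_self (Real.log y)
    linarith
  have hy0 : 0 < y := by linarith
  refine ⟨min (c₁ / 2) (2 / 13 / y), by positivity, ?_, fun q _ χ V β t hV hV1 hV2 h0 => ?_⟩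
  · refine (min_le_right _ _).trans ?_
    rw [div_le_iff₀ hy0]; linarith
  by_contra! hβ
  have hV0 : 0 < V := by linarith
  have hq : (1 : ℝ) ≤ q := by exact_mod_cast NeZero.one_le
  have hβ1 : β < 1 := by
    by_contra! h
    exact regL_ne_zero_of_one_le_re χ (by simpa using h) h0
  have hb1 : 1 - β ≤ c₁ / 2 / V := by
    have : min (c₁ / 2) (2 / 13 / y) / V ≤ c₁ / 2 / V := by gcongr; exact min_le_left _ _
    linarith
  have hb2 : 1 - β ≤ 2 / 13 / y / V := by
    have : min (c₁ / 2) (2 / 13 / y) / V ≤ 2 / 13 / y / V := by gcongr; exact min_le_right _ _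
    linarith
  set δ := 1 / (y * V)
  have hδ : 0 < δ := by positivity
  have hyV : 8 ≤ y * V := by nlinarith
  have hδ8 : δ ≤ 1 / 8 := by
    simp only [δ]; gcongr
  have hb3 : 1 - β ≤ 2 / 13 * δ := by
    convert hb2 using 1; simp only [δ]; field_simp
  -- the logarithms
  have hM : ∀ s : ℝ, |s| ≤ 2 * |t| → Real.log (12 * q * (|s| + 4) ^ 2 / δ ^ 2) ≤ (8 + 2 * Real.log y) * V := by
    intro s hs
    have e1 : 12 * q * (|s| + 4) ^ 2 / δ ^ 2 ≤ 48 * (q * (|t| + 3)) ^ 2 * (y ^ 2 * V ^ 2) := by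
      have : 12 * q * (|s| + 4) ^ 2 / δ ^ 2 = 12 * q * (|s| + 4) ^ 2 * (y ^ 2 * V ^ 2) := by
        simp only [δ]; field_simp
      rw [this]
      gcongr ?_ * _
      have : (|s| + 4) ^ 2 ≤ (2 * (|t| + 3)) ^ 2 := by
        have := abs_nonneg s
        have := abs_nonneg t
        gcongr
        linarith
      calc 12 * q * (|s| + 4) ^ 2 ≤ 12 * q * (2 * (|t| + 3)) ^ 2 := by gcongr
        _ = 48 * (|t| + 3) ^ 2 * q := by ring
        _ ≤ 48 * (|t| + 3) ^ 2 * (q ^ 2) := by gcongr; nlinarith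
        _ = _ := by ring
    have hpos : 0 < 12 * q * (|s| + 4) ^ 2 / δ ^ 2 := by positivity
    refine (Real.log_le_log hpos e1).trans ?_
    have ht3 : 0 < |t| + 3 := by positivity
    rw [Real.log_mul (by positivity) (by positivity), Real.log_mul (by norm_num) (by positivity),
      Real.log_mul (by positivity) (by positivity), Real.log_pow, Real.log_pow, Real.log_pow]
    have l1 : Real.log V ≤ V - 1 := Real.log_le_sub_one_of_pos hV0
    have l2 : Real.log 48 ≤ 6 := by
      rw [Real.log_le_iff_le_exp (by norm_num)]
      have := Real.exp_one_gt_d9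
      have h6 : Real.exp 6 = Real.exp 1 ^ 6 := by rw [← Real.exp_nat_mul]; norm_num
      rw [h6]
      calc (48 : ℝ) ≤ 2 ^ 6 := by norm_num
        _ ≤ _ := by gcongr; linarith
    have l3 : 0 ≤ Real.log y := Real.log_nonneg (by linarith)
    have l4 : Real.log y ≤ Real.log y * V := le_mul_of_one_le_right l3 hV
    push_cast
    linarith
  -- the contribution of the pole of a principal character
  have hfar : χ ^ 2 = 1 → c₁ / 2 / V ≤ |t| := by
    intro h2
    have h3 := hz q χ h2 _ h0
    have h4 : ‖(β : ℂ) + t * I - 1‖ ≤ (1 - β) + |t| := by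
      calc ‖(β : ℂ) + t * I - 1‖ = ‖((β - 1 : ℝ) : ℂ) + t * I‖ := by push_cast; ring_nf
        _ ≤ _ := norm_add_le _ _
        _ = _ := by
          rw [Complex.norm_real, norm_mul, Complex.norm_I, mul_one, Complex.norm_real, Real.norm_eq_abs,
            Real.norm_eq_abs, abs_of_neg (by linarith)]
          ring
    have h5 : c₁ / V ≤ c₁ * (q : ℝ) ^ (-ε) := by
      rw [Real.rpow_neg (by positivity), ← div_eq_mul_inv]
      gcongr
    have : c₁ / V = c₁ / 2 / V + c₁ / 2 / V := by ring
    linarith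
  have hpole : ∀ s : ℝ, |t| ≤ |s| → χ ^ 2 = 1 → (1 / ((δ : ℂ) + s * I)).re ≤ 2 / c₁ * V := by
    intro s hs h2
    have h3 := hfar h2
    have h4 : 0 < c₁ / 2 / V := by positivity
    refine (re_one_div_le (by linarith)).trans ?_
    calc 1 / |s| ≤ 1 / (c₁ / 2 / V) := by gcongr; linarith
      _ = _ := by field_simp
  have h341 := three_four_one χ (σ := 1 + δ) (by linarith) t
  have hre : ∀ s : ℝ, (((1 + δ : ℝ) : ℂ) + s * I).re = 1 + δ := by intro s; simp
  rw [logDeriv_regL _ (by simp [hδ]), logDeriv_regL _ (by rw [hre]; linarith), logDeriv_regL _ (by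
    have := hre (2 * t); push_cast at this ⊢; rw [this]; linarith)] at h341
  rw [if_pos rfl] at h341
  have n0 := (neg_re_logDeriv_regL_le (1 : DirichletCharacter ℂ q) (t := 0) hδ hδ8).1
  have n1 := (neg_re_logDeriv_regL_le χ (t := t) hδ hδ8).2 β (by
    have : 2 / 13 * δ ≤ 1 / 8 := by linarith
    linarith) hβ1.le h0
  have n2 := (neg_re_logDeriv_regL_le (χ ^ 2) (t := 2 * t) hδ hδ8).1
  have m0 := hM 0 (by simp)
  have m1 := hM t (by linarith [abs_nonneg t])
  have m2 := hM (2 * t) (by rw [abs_mul]; norm_num)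
  have p1 : (if χ = 1 then 1 / ((((1 + δ : ℝ) : ℂ) + t * I) - 1) else 0 : ℂ).re ≤ 2 / c₁ * V := by
    split_ifs with h
    · convert hpole t le_rfl (by rw [h, one_pow]) using 4
      push_cast; ring
    · simp; positivity
  have p2 : (if χ ^ 2 = 1 then 1 / ((((1 + δ : ℝ) : ℂ) + 2 * t * I) - 1) else 0 : ℂ).re ≤ 2 / c₁ * V := by
    split_ifs with h
    · convert hpole (2 * t) (by rw [abs_mul]; norm_num; linarith [abs_nonneg t]) h using 4
      push_cast; ring
    · simp; positivity
  have p0 : (1 / (((1 + δ : ℝ) : ℂ) - 1)).re = y * V := by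
    have : (((1 + δ : ℝ) : ℂ) - 1) = (δ : ℂ) := by push_cast; ring
    rw [this, ← Complex.ofReal_one, ← Complex.ofReal_div, Complex.ofReal_re]
    simp [δ]
  simp only [logDeriv_apply, Complex.ofReal_zero, zero_mul, add_zero] at n0 n1 n2
  push_cast at n2 n0 n1 h341 p1 p2 p0
  simp only [Complex.add_re, Complex.neg_re] at h341
  have fin1 : 4 / (1 + δ - β) ≤ 3 * (y * V) + V * (3584 * (8 + 2 * Real.log y) + 8 + 10 / c₁) := by
    have e1 : 4 / (1 + δ - β) = 4 * (1 / (1 + δ - β)) := by ring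
    have e2 : 10 / c₁ = 5 * (2 / c₁) := by ring
    rw [e1, e2]
    nlinarith
  have fin2 : 4 / (1 + δ - β) ≤ 13 / 4 * (y * V) := by nlinarith
  have hyδ : y * V = 1 / δ := by simp [δ]
  rw [hyδ, div_le_iff₀ (by linarith)] at fin2
  have hs : 1 + δ - β ≤ 15 / 13 * δ := by linarith
  have : 13 / 4 * (1 / δ) * (1 + δ - β) < 4 := by
    calc 13 / 4 * (1 / δ) * (1 + δ - β) ≤ 13 / 4 * (1 / δ) * (15 / 13 * δ) := by gcongr
      _ = 15 / 4 := by field_simp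
      _ < 4 := by norm_num
  linarith

lemma logDeriv_regL_bound {B : ℝ} (hB : 0 < B) : ∃ c : ℝ, 0 < c ∧ c ≤ 1 / 16 ∧ ∃ K : ℝ, 0 < K ∧
    ∀ (q : ℕ) [NeZero q] (χ : DirichletCharacter ℂ q) (U : ℝ), 1 ≤ U → (q : ℝ) ≤ U ^ B →
      ∀ s : ℂ, |s.re - 1| ≤ c / U → |s.im| ≤ Real.exp U →
        regL χ s ≠ 0 ∧ ‖logDeriv (regL χ) s‖ ≤ K * U ^ 2 := by
  obtain ⟨c₀, hc₀, hc₀1, hz⟩ := zero_free (ε := min 1 (1 / B)) (by positivity) (min_le_left _ _)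
  set c₁ := c₀ / (B + 3)
  have hc₁ : 0 < c₁ := by positivity
  have hc₁1 : c₁ ≤ 1 / 8 := (div_le_self hc₀.le (by linarith)).trans hc₀1
  have hl1 : 0 ≤ Real.log (1 / c₁) := Real.log_nonneg (by rw [le_div_iff₀ hc₁]; linarith)
  refine ⟨c₁ / 2, by positivity, by linarith, 112 * (B + 11 + 2 * Real.log (1 / c₁)) / (2 * c₁), by positivity,
    fun q _ χ U hU hqU s hs hst => ?_⟩
  have hU0 : 0 < U := by linarith
  have hq : (1 : ℝ) ≤ q := by exact_mod_cast NeZero.one_le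
  have hexp : 1 ≤ Real.exp U := Real.one_le_exp hU0.le
  have hlq : Real.log q ≤ B * U := by
    refine (Real.log_le_log (by linarith) hqU).trans ?_
    rw [Real.log_rpow hU0]
    gcongr
    exact (Real.log_le_sub_one_of_pos hU0).trans (by linarith)
  have hl5 : Real.log (5 * Real.exp U) ≤ U + 2 := by
    rw [Real.log_mul (by norm_num) (by positivity), Real.log_exp]
    have : Real.log 5 ≤ 2 := by
      rw [Real.log_le_iff_le_exp (by norm_num)]
      have := Real.exp_one_gt_d9
      have h6 : Real.exp 2 = Real.exp 1 ^ 2 := by rw [← Real.exp_nat_mul]; norm_num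
      rw [h6]; nlinarith
    linarith
  have hzf : ∀ z : ℂ, |z.im| ≤ Real.exp U + 1 → 1 - c₁ / U ≤ z.re → regL χ z ≠ 0 := by
    intro z hzi hzr h0
    have := hz q χ ((B + 3) * U) z.re z.im (by nlinarith) (by
      have : |z.im| + 3 ≤ 5 * Real.exp U := by linarith
      have h3 : 0 < |z.im| + 3 := by positivity
      calc Real.log (q * (|z.im| + 3)) = Real.log q + Real.log (|z.im| + 3) :=
            Real.log_mul (by linarith) h3.ne'
        _ ≤ B * U + (U + 2) := by
            gcongr
            exact (Real.log_le_log h3 this).trans hl5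
        _ ≤ _ := by linarith) (by
      calc (q : ℝ) ^ (min 1 (1 / B)) ≤ (q : ℝ) ^ (1 / B) := by gcongr; exact min_le_right _ _
        _ ≤ (U ^ B) ^ (1 / B) := by gcongr
        _ = U := by rw [← Real.rpow_mul hU0.le, mul_one_div_cancel hB.ne', Real.rpow_one]
        _ ≤ _ := by nlinarith) (by rwa [Complex.re_add_im])
    have e : c₀ / ((B + 3) * U) = c₁ / U := by simp only [c₁]; field_simp
    rw [e] at this
    linarith
  set r := c₁ / U
  have hr : 0 < r := by positivity
  have hr1 : r ≤ 1 / 8 := (div_le_self hc₁.le hU).trans hc₁1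
  have hs2 : |s.re - 1| ≤ r / 2 := by
    convert hs using 1; simp only [r]; ring
  rw [abs_le] at hs2
  refine ⟨hzf s (by linarith) (by linarith), ?_⟩
  set w : ℂ := (1 + r : ℝ) + s.im * I
  have hw : w.re = 1 + r := by simp [w]
  have hwi : w.im = s.im := by simp [w]
  have hnw : ‖w‖ ≤ 9 / 8 + |s.im| := by
    refine (norm_add_le _ _).trans ?_
    rw [Complex.norm_real, norm_mul, Complex.norm_I, mul_one, Complex.norm_real, Real.norm_eq_abs, Real.norm_eq_abs,
      abs_of_pos (by linarith)]
    linarith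
  have hX : 1 < 12 * q * (5 * Real.exp U) ^ 2 / r ^ 2 := by
    rw [lt_div_iff₀ (by positivity)]
    nlinarith
  have hge := norm_regL_ge χ hr (by linarith) hw
  have hmain := norm_logDeriv_le_of_ne_zero (f := regL χ) (c := w) (R := 2 * r)
    (M := Real.log (12 * q * (5 * Real.exp U) ^ 2 / r ^ 2)) (by positivity) (Real.log_pos hX) (differentiable_regL χ) (by
      intro z hz
      rw [mem_ball_iff_norm] at hz
      have h1 := (Complex.abs_re_le_norm (z - w)).trans hz.le
      have h2 := (Complex.abs_im_le_norm (z - w)).trans hz.le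
      rw [Complex.sub_re, hw, abs_le] at h1
      rw [Complex.sub_im, hwi] at h2
      refine hzf z ?_ (by linarith [h1.1])
      have := abs_sub_abs_le_abs_sub z.im s.im
      linarith) (by
      intro z hz
      rw [mem_ball_iff_norm] at hz
      rw [Real.exp_log (by linarith)]
      have hre : 1 / 2 ≤ z.re := by
        have := (Complex.abs_re_le_norm (z - w)).trans hz.le
        rw [Complex.sub_re, hw, abs_le] at this
        linarith [this.1]
      have hn : 1 + ‖z‖ ≤ 5 * Real.exp U := by
        have : ‖z‖ ≤ ‖z - w‖ + ‖w‖ := by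
          calc ‖z‖ = ‖(z - w) + w‖ := by ring_nf
            _ ≤ _ := norm_add_le _ _
        linarith
      calc ‖regL χ z‖ ≤ q * (4 * (1 + ‖z‖) ^ 2) := norm_regL_le χ hre
        _ ≤ q * (4 * (5 * Real.exp U) ^ 2) := by gcongr
        _ = 12 * q * (5 * Real.exp U) ^ 2 / r ^ 2 * (r ^ 2 / 3) := by field_simp; norm_num
        _ ≤ _ := by gcongr) (z := s) (by
      have : s - w = ((s.re - (1 + r) : ℝ) : ℂ) := by
        apply Complex.ext <;> simp [w]
      rw [this, Complex.norm_real, Real.norm_eq_abs, abs_le]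
      constructor <;> linarith)
  refine hmain.trans ?_
  have hM : Real.log (12 * q * (5 * Real.exp U) ^ 2 / r ^ 2) ≤ (B + 11 + 2 * Real.log (1 / c₁)) * U := by
    have e1 : 12 * q * (5 * Real.exp U) ^ 2 / r ^ 2 = 12 * q * (5 * Real.exp U) ^ 2 * ((1 / c₁) ^ 2 * U ^ 2) := by
      simp only [r]; field_simp
    rw [e1, Real.log_mul (by positivity) (by positivity), Real.log_mul (by positivity) (by positivity),
      Real.log_mul (by positivity) (by positivity), Real.log_mul (by positivity) (by positivity), Real.log_pow,
      Real.log_pow, Real.log_pow]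
    have l1 : Real.log U ≤ U - 1 := Real.log_le_sub_one_of_pos hU0
    have l2 : Real.log 12 ≤ 4 := by
      rw [Real.log_le_iff_le_exp (by norm_num)]
      have := Real.exp_one_gt_d9
      have h6 : Real.exp 4 = Real.exp 1 ^ 4 := by rw [← Real.exp_nat_mul]; norm_num
      rw [h6]
      calc (12 : ℝ) ≤ 2 ^ 4 := by norm_num
        _ ≤ _ := by gcongr; linarith
    have l4 : Real.log (1 / c₁) ≤ Real.log (1 / c₁) * U := le_mul_of_one_le_right hl1 hU
    push_cast
    linarith
  calc 112 * Real.log (12 * q * (5 * Real.exp U) ^ 2 / r ^ 2) / (2 * r)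
      ≤ 112 * ((B + 11 + 2 * Real.log (1 / c₁)) * U) / (2 * r) := by gcongr
    _ = _ := by simp only [r]; field_simp

lemma norm_perron_kernel_le {s : ℂ} (h : 1 ≤ s.re) : ‖1 / (s * (s + 1))‖ ≤ (1 + s.im ^ 2)⁻¹ := by
  have h1 : 1 + s.im ^ 2 ≤ ‖s‖ ^ 2 := by
    rw [← Complex.normSq_eq_norm_sq, Complex.normSq_apply]; nlinarith
  have h2 : ‖s‖ ^ 2 ≤ ‖s + 1‖ ^ 2 := by
    rw [← Complex.normSq_eq_norm_sq, ← Complex.normSq_eq_norm_sq, Complex.normSq_apply, Complex.normSq_apply]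
    simp; nlinarith
  have h3 : ‖s‖ ≤ ‖s + 1‖ := by
    exact (sq_le_sq₀ (norm_nonneg _) (norm_nonneg _)).1 h2
  rw [norm_div, norm_one, norm_mul, one_div]
  refine inv_anti₀ (by positivity) (h1.trans ?_)
  rw [sq]
  gcongr

lemma line_ne_zero {c : ℝ} (hc : 1 ≤ c) (t : ℝ) :
    ((c : ℂ) + t * I) * ((c : ℂ) + t * I + 1) ≠ 0 := by
  refine mul_ne_zero (fun h => ?_) (fun h => ?_)
  · have := congrArg Complex.re h
    simp at this; linarith
  · have := congrArg Complex.re h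
    simp at this; linarith

lemma continuous_perron_kernel {c : ℝ} (hc : 1 ≤ c) :
    Continuous fun t : ℝ => 1 / (((c : ℂ) + t * I) * ((c : ℂ) + t * I + 1)) :=
  continuous_const.div (by fun_prop) (line_ne_zero hc)

lemma integrable_perron_kernel {c : ℝ} (hc : 1 ≤ c) :
    Integrable fun t : ℝ => 1 / (((c : ℂ) + t * I) * ((c : ℂ) + t * I + 1)) := by
  refine integrable_inv_one_add_sq.mono' (continuous_perron_kernel hc).aestronglyMeasurable
    (Eventually.of_forall fun t => ?_)
  have := norm_perron_kernel_le (s := (c : ℂ) + t * I) (by simpa using hc)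
  simpa using this

lemma hasMellin_fejer {s : ℂ} (hs : 0 < s.re) :
    HasMellin (fun t : ℝ => ((max (1 - t) 0 : ℝ) : ℂ)) s (1 / (s * (s + 1))) := by
  have h1 := hasMellin_one_Ioc hs
  have h2 := hasMellin_cpow_Ioc 1 (s := s) (by simp; linarith)
  have h3 := hasMellin_sub h1.1 h2.1
  rw [h1.2, h2.2] at h3
  have hs0 : s ≠ 0 := fun h => by simp [h] at hs
  have hs1 : s + 1 ≠ 0 := fun h => by
    have := congrArg Complex.re h
    simp at this; linarith
  have e : (1 / s - 1 / (s + 1)) = 1 / (s * (s + 1)) := by field_simp; ring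
  rw [e] at h3
  have heq : ∀ t ∈ Ioi (0 : ℝ), ((max (1 - t) 0 : ℝ) : ℂ) =
      indicator (Ioc (0 : ℝ) 1) (fun _ => 1 : ℝ → ℂ) t - indicator (Ioc 0 1) (fun t : ℝ => (t : ℂ) ^ (1 : ℂ)) t := by
    intro t ht
    by_cases h : t ≤ 1
    · have hm : t ∈ Ioc (0 : ℝ) 1 := ⟨ht, h⟩
      rw [indicator_of_mem hm, indicator_of_mem hm, max_eq_left (by linarith)]
      simp
    · rw [indicator_of_notMem (fun hh => h hh.2), indicator_of_notMem (fun hh => h hh.2), max_eq_right (by linarith)]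
      simp
  constructor
  · refine (integrableOn_congr_fun (fun t ht => ?_) measurableSet_Ioi).2 h3.1
    simp only [heq t ht]
  · rw [← h3.2]
    exact setIntegral_congr_fun measurableSet_Ioi fun t ht => by simp only [heq t ht]

lemma integral_perron_kernel {c : ℝ} (hc : 1 ≤ c) {y : ℝ} (hy : 0 < y) :
    ∫ t : ℝ, (y : ℂ) ^ (-((c : ℂ) + t * I)) * (1 / (((c : ℂ) + t * I) * ((c : ℂ) + t * I + 1))) =
      2 * Real.pi * ((max (1 - y) 0 : ℝ) : ℂ) := by
  have hm : ∀ t : ℝ, mellin (fun t : ℝ => ((max (1 - t) 0 : ℝ) : ℂ)) ((c : ℂ) + t * I) =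
      1 / (((c : ℂ) + t * I) * ((c : ℂ) + t * I + 1)) := fun t =>
    (hasMellin_fejer (s := (c : ℂ) + t * I) (by simp; linarith)).2
  have := mellinInv_mellin_eq c (fun t : ℝ => ((max (1 - t) 0 : ℝ) : ℂ)) hy
    (hasMellin_fejer (s := (c : ℂ)) (by simp; linarith)).1 (by
      unfold Complex.VerticalIntegrable
      simp_rw [hm]
      exact integrable_perron_kernel hc) (by fun_prop)
  simp only [mellinInv, hm, smul_eq_mul] at this
  rw [← this, Complex.real_smul, ← mul_assoc]
  have : (Real.pi : ℂ) ≠ 0 := by exact_mod_cast Real.pi_ne_zero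
  have e : 2 * (Real.pi : ℂ) * ((1 / (2 * Real.pi) : ℝ) : ℂ) = 1 := by push_cast; field_simp
  rw [e, one_mul]

lemma norm_LSeries_line_le {a : ℕ → ℂ} {c : ℝ} (ha : Summable fun n => ‖LSeries.term a c n‖) {s : ℂ} (hs : s.re = c) :
    ‖LSeries a s‖ ≤ ∑' n, ‖LSeries.term a c n‖ := by
  have e : ∀ n, ‖LSeries.term a s n‖ = ‖LSeries.term a c n‖ := by
    intro n; simp [LSeries.norm_term_eq, hs]
  refine (norm_tsum_le_tsum_norm (by simpa only [e] using ha)).trans ?_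
  simp only [e, le_refl]

lemma continuous_LSeries_line {a : ℕ → ℂ} {c : ℝ} (ha : Summable fun n => ‖LSeries.term a c n‖) :
    Continuous fun t : ℝ => LSeries a ((c : ℂ) + t * I) := by
  refine continuous_tsum (fun n => ?_) ha fun n t => ?_
  · rcases eq_or_ne n 0 with rfl | hn
    · simp only [LSeries.term_zero]; exact continuous_const
    · simp only [LSeries.term_of_ne_zero hn]
      have : (n : ℂ) ≠ 0 := by exact_mod_cast hn
      refine continuous_const.div (Continuous.const_cpow (by fun_prop) (Or.inl this)) fun t => ?_
      simp [Complex.cpow_eq_zero_iff, this]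
  · simp [LSeries.norm_term_eq]

lemma norm_perron_integrand_le {a : ℕ → ℂ} {c x : ℝ} (hc : 1 ≤ c) (hx : 0 < x)
    (ha : Summable fun n => ‖LSeries.term a c n‖) (t : ℝ) :
    ‖LSeries a ((c : ℂ) + t * I) * (x : ℂ) ^ ((c : ℂ) + t * I) * (1 / (((c : ℂ) + t * I) * ((c : ℂ) + t * I + 1)))‖ ≤
      (∑' n, ‖LSeries.term a c n‖) * x ^ c * (1 + t ^ 2)⁻¹ := by
  have h1 := norm_perron_kernel_le (s := (c : ℂ) + t * I) (by simpa using hc)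
  have h2 : ‖(x : ℂ) ^ ((c : ℂ) + t * I)‖ = x ^ c := by
    rw [Complex.norm_cpow_eq_rpow_re_of_pos hx]; simp
  rw [norm_mul, norm_mul, h2]
  gcongr
  · exact norm_LSeries_line_le ha (by simp)
  · simpa using h1

lemma integrable_perron_integrand {a : ℕ → ℂ} {c x : ℝ} (hc : 1 ≤ c) (hx : 0 < x)
    (ha : Summable fun n => ‖LSeries.term a c n‖) :
    Integrable fun t : ℝ => LSeries a ((c : ℂ) + t * I) * (x : ℂ) ^ ((c : ℂ) + t * I) *
      (1 / (((c : ℂ) + t * I) * ((c : ℂ) + t * I + 1))) := by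
  have hx0 : (x : ℂ) ≠ 0 := by exact_mod_cast hx.ne'
  refine (integrable_inv_one_add_sq.const_mul _).mono' ?_ (Eventually.of_forall (norm_perron_integrand_le hc hx ha))
  exact (((continuous_LSeries_line ha).mul (Continuous.const_cpow (by fun_prop) (Or.inl hx0))).mul
    (continuous_perron_kernel hc)).aestronglyMeasurable

/-- The Perron formula with the Cesàro weight. -/
theorem perron {a : ℕ → ℂ} {c x : ℝ} (hc : 1 ≤ c) (hx : 0 < x) (ha : Summable fun n => ‖LSeries.term a c n‖) :
    ∫ t : ℝ, LSeries a ((c : ℂ) + t * I) * (x : ℂ) ^ ((c : ℂ) + t * I) *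
      (1 / (((c : ℂ) + t * I) * ((c : ℂ) + t * I + 1))) =
    2 * Real.pi * ∑ n ∈ Finset.Icc 1 ⌊x⌋₊, (1 - n / x) * a n := by
  have hx0 : (x : ℂ) ≠ 0 := by exact_mod_cast hx.ne'
  set F : ℕ → ℝ → ℂ := fun n t => LSeries.term a ((c : ℂ) + t * I) n * (x : ℂ) ^ ((c : ℂ) + t * I) *
      (1 / (((c : ℂ) + t * I) * ((c : ℂ) + t * I + 1)))
  have hF : ∀ n, F n = fun t : ℝ => (if n = 0 then 0 else a n) * ((((n : ℝ) / x : ℝ) : ℂ) ^ (-((c : ℂ) + t * I)) *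
      (1 / (((c : ℂ) + t * I) * ((c : ℂ) + t * I + 1)))) := by
    intro n
    ext t
    simp only [F]
    rcases eq_or_ne n 0 with rfl | hn
    · simp
    · rw [LSeries.term_of_ne_zero hn, if_neg hn, div_eq_mul_inv (n : ℝ), Complex.ofReal_mul,
        Complex.mul_cpow_ofReal_nonneg (by positivity) (by positivity), Complex.ofReal_inv,
        Complex.inv_cpow_ofReal_nonneg hx.le, Complex.cpow_neg, Complex.cpow_neg, inv_inv]
      push_cast
      ring
  have hn : ∀ n t, ‖F n t‖ = ‖LSeries.term a c n‖ * x ^ c *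
      ‖1 / (((c : ℂ) + t * I) * ((c : ℂ) + t * I + 1))‖ := by
    intro n t
    have h2 : ‖(x : ℂ) ^ ((c : ℂ) + t * I)‖ = x ^ c := by
      rw [Complex.norm_cpow_eq_rpow_re_of_pos hx]; simp
    have e : ‖LSeries.term a ((c : ℂ) + t * I) n‖ = ‖LSeries.term a c n‖ := by simp [LSeries.norm_term_eq]
    simp only [F, norm_mul, h2, e]
  have hint : ∀ n, Integrable (F n) := by
    intro n
    rcases eq_or_ne n 0 with rfl | h0
    · simp [F]
    · have hcont : Continuous (F n) := by
        rw [hF]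
        have : ((((n : ℝ) / x : ℝ) : ℂ)) ≠ 0 := by
          have : (n : ℝ) / x ≠ 0 := by positivity
          exact_mod_cast this
        exact continuous_const.mul ((Continuous.const_cpow (by fun_prop) (Or.inl this)).mul
          (continuous_perron_kernel hc))
      refine ((integrable_perron_kernel hc).norm.const_mul (‖LSeries.term a c n‖ * x ^ c)).mono'
        hcont.aestronglyMeasurable (Eventually.of_forall fun t => (hn n t).le)
  have hsum := hasSum_integral_of_summable_integral_norm hint (by
    simp only [hn, integral_const_mul]
    exact (ha.mul_right _).mul_right _)
  have hval : ∀ n, ∫ t, F n t = 2 * Real.pi * ((if n = 0 then 0 else a n) * ((max (1 - n / x) 0 : ℝ) : ℂ)) := by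
    intro n
    rw [hF, integral_const_mul]
    rcases eq_or_ne n 0 with rfl | h0
    · simp
    · rw [integral_perron_kernel hc (by positivity)]; ring
  have htsum : ∀ t : ℝ, ∑' n, F n t = LSeries a ((c : ℂ) + t * I) * (x : ℂ) ^ ((c : ℂ) + t * I) *
      (1 / (((c : ℂ) + t * I) * ((c : ℂ) + t * I + 1))) := by
    intro t
    simp only [F, tsum_mul_right, LSeries]
  simp only [htsum, hval] at hsum
  rw [← hsum.tsum_eq, tsum_mul_left, tsum_eq_sum (s := Finset.Icc 1 ⌊x⌋₊), ]
  · congr 1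
    refine Finset.sum_congr rfl fun n hn => ?_
    rw [Finset.mem_Icc] at hn
    have hnx : (n : ℝ) ≤ x := (Nat.le_floor_iff hx.le).1 hn.2
    rw [if_neg (by omega), max_eq_left (by rw [sub_nonneg, div_le_one hx]; exact hnx)]
    push_cast; ring
  · intro n hn
    rcases eq_or_ne n 0 with rfl | h0
    · simp
    · have : x < n := by
        by_contra! h
        exact hn (Finset.mem_Icc.2 ⟨by omega, Nat.le_floor h⟩)
      rw [max_eq_right]
      · simp
      · rw [sub_nonpos, one_le_div hx]; exact this.le

lemma norm_integral_line_le {G : ℂ → ℂ} {σ c T M₁ M₂ : ℝ} (hσ : σ ≤ c) (hT : 0 ≤ T)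
    (hG : DifferentiableOn ℂ G (uIcc σ c ×ℂ uIcc (-T) T))
    (h1 : ∀ t : ℝ, |t| ≤ T → ‖G (σ + t * I)‖ ≤ M₁)
    (h2 : ∀ u t : ℝ, σ ≤ u → u ≤ c → |t| = T → ‖G (u + t * I)‖ ≤ M₂) :
    ‖∫ t in (-T)..T, G (c + t * I)‖ ≤ 2 * T * M₁ + 2 * (c - σ) * M₂ := by
  have hz := Complex.integral_boundary_rect_eq_zero_of_differentiableOn G (σ + (-T : ℝ) * I) (c + T * I)
    (by simpa using hG)
  simp only [Complex.add_re, Complex.ofReal_re, Complex.mul_re, Complex.I_re, mul_zero, Complex.ofReal_im,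
    Complex.I_im, mul_one, sub_self, add_zero, Complex.add_im, Complex.mul_im, zero_add, smul_eq_mul] at hz
  have e : ∫ t in (-T)..T, G (c + t * I) = (∫ t in (-T)..T, G (σ + t * I)) +
      I * ((∫ u in σ..c, G (u + (-T : ℝ) * I)) - ∫ u in σ..c, G (u + T * I)) := by
    linear_combination (-I) * hz - (∫ t in (-T)..T, G (σ + t * I)) * I_mul_I + (∫ t in (-T)..T, G (c + t * I)) * I_mul_I
  rw [e]
  have n1 : ‖∫ t in (-T)..T, G (σ + t * I)‖ ≤ M₁ * |T - -T| := by
    refine intervalIntegral.norm_integral_le_of_norm_le_const fun t ht => h1 t ?_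
    rw [uIoc_of_le (by linarith)] at ht
    exact abs_le.2 ⟨ht.1.le, ht.2⟩
  have n2 : ∀ τ : ℝ, |τ| = T → ‖∫ u in σ..c, G (u + τ * I)‖ ≤ M₂ * |c - σ| := by
    intro τ hτ
    refine intervalIntegral.norm_integral_le_of_norm_le_const fun u hu => h2 u τ ?_ ?_ hτ
    all_goals rw [uIoc_of_le hσ] at hu
    · exact hu.1.le
    · exact hu.2
  have n3 := n2 T (abs_of_nonneg hT)
  have n4 := n2 (-T) (by rw [abs_neg, abs_of_nonneg hT])
  rw [abs_of_nonneg (by linarith)] at n1 n3 n4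
  refine (norm_add_le _ _).trans ?_
  rw [norm_mul, Complex.norm_I, one_mul]
  have := norm_sub_le (∫ u in σ..c, G (u + (-T : ℝ) * I)) (∫ u in σ..c, G (u + T * I))
  linarith

lemma integral_compl_Ioc_inv_one_add_sq_le {T : ℝ} (hT : 0 < T) :
    ∫ t in (Ioc (-T) T)ᶜ, (1 + t ^ 2)⁻¹ ≤ 2 / T := by
  have hc : (Ioc (-T) T)ᶜ = Iic (-T) ∪ Ioi T := by
    ext t; simp only [mem_compl_iff, mem_Ioc, mem_union, mem_Iic, mem_Ioi, not_and_or, not_lt, not_le]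
  rw [hc, setIntegral_union (by rw [Set.disjoint_left]; intro t h h'; simp only [mem_Iic, mem_Ioi] at h h'; linarith)
    measurableSet_Ioi integrable_inv_one_add_sq.integrableOn integrable_inv_one_add_sq.integrableOn,
    integral_Iic_inv_one_add_sq, integral_Ioi_inv_one_add_sq, Real.arctan_neg]
  have h1 : Real.pi / 2 - Real.arctan T ≤ 1 / T := by
    rw [← Real.arctan_inv_of_pos hT, one_div]
    have := Real.le_tan (x := Real.arctan T⁻¹) (Real.arctan_nonneg.2 (by positivity)) (Real.arctan_lt_pi_div_two _)
    rwa [Real.tan_arctan] at this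
  have : 2 / T = 1 / T + 1 / T := by ring
  linarith

/-- Coefficients of the error in the prime number theorem twisted by `χ`. -/
noncomputable def devCoeff {q : ℕ} (χ : DirichletCharacter ℂ q) (n : ℕ) : ℂ :=
  χ n * (ArithmeticFunction.vonMangoldt n : ℂ) - if χ = 1 then 1 else 0

/-- The analytic continuation of the Dirichlet series of `devCoeff`. -/
noncomputable def devL {q : ℕ} [NeZero q] (χ : DirichletCharacter ℂ q) (s : ℂ) : ℂ :=
  -logDeriv (regL χ) s - if χ = 1 then zetaReg s else 0

lemma LSeries_devCoeff {q : ℕ} [NeZero q] (χ : DirichletCharacter ℂ q) {s : ℂ} (hs : 1 < s.re) :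
    LSeries (devCoeff χ) s = devL χ s := by
  by_cases h : χ = 1
  · have e : devCoeff χ = (fun n : ℕ => χ n * (ArithmeticFunction.vonMangoldt n : ℂ)) - 1 := by
      ext n; simp [devCoeff, h]
    rw [e, LSeries_sub (summable_char_vonMangoldt χ hs) (LSeriesSummable_one_iff.2 hs), logDeriv_regL χ hs, if_pos h,
      LSeries_one_eq_riemannZeta hs, riemannZeta_eq_of_one_lt hs, devL, if_pos h, logDeriv_apply]
    ring
  · have e : devCoeff χ = (fun n : ℕ => χ n * (ArithmeticFunction.vonMangoldt n : ℂ)) := by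
      ext n; simp [devCoeff, h]
    rw [e, logDeriv_regL χ hs, if_neg h, devL, if_neg h, logDeriv_apply]
    ring

lemma norm_devCoeff_le {q : ℕ} (χ : DirichletCharacter ℂ q) {η : ℝ} (h0 : 0 < η) (h1 : η ≤ 1) (n : ℕ) (hn : n ≠ 0) :
    ‖devCoeff χ n‖ ≤ 2 / η * (n : ℝ) ^ η := by
  have hn1 : (1 : ℝ) ≤ n := by exact_mod_cast Nat.one_le_iff_ne_zero.2 hn
  have hp : 1 ≤ (n : ℝ) ^ η := Real.one_le_rpow hn1 h0.le
  have e1 : ‖(if χ = 1 then 1 else 0 : ℂ)‖ ≤ (n : ℝ) ^ η / η := by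
    have : 1 ≤ (n : ℝ) ^ η / η := by rw [one_le_div h0]; linarith
    split_ifs
    · simpa using this
    · rw [norm_zero]; linarith
  have e2 : ‖χ n * (ArithmeticFunction.vonMangoldt n : ℂ)‖ ≤ (n : ℝ) ^ η / η := by
    rw [norm_mul, Complex.norm_real, Real.norm_eq_abs, abs_of_nonneg ArithmeticFunction.vonMangoldt_nonneg]
    calc _ ≤ 1 * ArithmeticFunction.vonMangoldt n := by
          gcongr
          · exact DirichletCharacter.norm_le_one _ _
      _ ≤ Real.log n := by rw [one_mul]; exact ArithmeticFunction.vonMangoldt_le_log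
      _ ≤ _ := Real.log_le_rpow_div (by positivity) h0
  refine (norm_sub_le _ _).trans ?_
  have : 2 / η * (n : ℝ) ^ η = (n : ℝ) ^ η / η + (n : ℝ) ^ η / η := by ring
  linarith

lemma tsum_norm_devCoeff_le {q : ℕ} (χ : DirichletCharacter ℂ q) {δ : ℝ} (h0 : 0 < δ) (h1 : δ ≤ 1) :
    (Summable fun n => ‖LSeries.term (devCoeff χ) (1 + δ : ℝ) n‖) ∧
      ∑' n, ‖LSeries.term (devCoeff χ) (1 + δ : ℝ) n‖ ≤ 16 / δ ^ 2 := by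
  have hη := norm_devCoeff_le χ (half_pos h0) (by linarith)
  have hs : 1 + δ / 2 < (((1 + δ : ℝ) : ℂ)).re := by rw [Complex.ofReal_re]; linarith
  refine ⟨summable_term_of_le hη hs, (tsum_norm_term_le hη hs).trans ?_⟩
  rw [Complex.ofReal_re]
  have : 1 / (1 + δ - δ / 2 - 1) = 2 / δ := by
    have : 1 + δ - δ / 2 - 1 = δ / 2 := by ring
    rw [this]; field_simp
  rw [this]
  have h2 : 2 ≤ 2 / δ := by rw [le_div_iff₀ h0]; linarith
  calc 2 / (δ / 2) * (2 / δ + 2) ≤ 2 / (δ / 2) * (2 / δ + 2 / δ) := by gcongr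
    _ = _ := by field_simp; norm_num

lemma pow_four_mul_exp_neg_le {k U : ℝ} (hk : 0 < k) (hU : 0 ≤ U) :
    U ^ 4 * Real.exp (-(k * U)) ≤ 384 / k ^ 4 * Real.exp (-(k / 2 * U)) := by
  have h := Real.pow_div_factorial_le_exp (k / 2 * U) (by positivity) 4
  have e : Real.exp (-(k * U)) = Real.exp (-(k / 2 * U)) * Real.exp (-(k / 2 * U)) := by
    rw [← Real.exp_add]; ring_nf
  have h2 : U ^ 4 ≤ 384 / k ^ 4 * Real.exp (k / 2 * U) := by
    have : U ^ 4 = 384 / k ^ 4 * ((k / 2 * U) ^ 4 / (Nat.factorial 4 : ℕ)) := by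
      rw [show Nat.factorial 4 = 24 from rfl]
      push_cast; field_simp; norm_num; ring
    rw [this]; gcongr
  calc _ ≤ 384 / k ^ 4 * Real.exp (k / 2 * U) * Real.exp (-(k * U)) := by gcongr
    _ = 384 / k ^ 4 * (Real.exp (k / 2 * U) * Real.exp (-(k / 2 * U))) * Real.exp (-(k / 2 * U)) := by rw [e]; ring
    _ = _ := by rw [← Real.exp_add, add_neg_cancel, Real.exp_zero, mul_one]

lemma differentiableAt_devL {q : ℕ} [NeZero q] {χ : DirichletCharacter ℂ q} {s : ℂ} (hs : 0 < s.re)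
    (h0 : regL χ s ≠ 0) : DifferentiableAt ℂ (devL χ) s := by
  have hd : DifferentiableAt ℂ (logDeriv (regL χ)) s :=
    ((differentiable_regL χ).analyticAt s).deriv.differentiableAt.div (differentiable_regL χ s) h0
  unfold devL
  split_ifs
  · exact hd.neg.sub (differentiableAt_zetaReg hs)
  · exact hd.neg.sub (differentiableAt_const _)

theorem norm_sum_devCoeff_le {B : ℝ} (hB : 0 < B) : ∃ D : ℝ, 0 < D ∧ ∃ K : ℝ, 0 < K ∧
    ∀ (q : ℕ) [NeZero q] (χ : DirichletCharacter ℂ q) (U x : ℝ), 1 ≤ U → (q : ℝ) ≤ U ^ B → x = Real.exp (U ^ 2) →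
      ‖∑ n ∈ Finset.Icc 1 ⌊x⌋₊, (1 - n / x) * devCoeff χ n‖ ≤ K * x * Real.exp (-(D * U)) := by
  obtain ⟨c, hc, hc1, K₀, hK₀, hb⟩ := logDeriv_regL_bound hB
  set k := c / 3
  have hk : 0 < k := by positivity
  refine ⟨k / 2, by positivity, (16 * (K₀ + 7) + 96 / c ^ 2) * (384 / k ^ 4), by positivity,
    fun q _ χ U x hU hqU hx => ?_⟩
  have hU0 : 0 < U := by linarith
  have hx0 : 0 < x := by rw [hx]; positivity
  have hxc : (x : ℂ) ≠ 0 := by exact_mod_cast hx0.ne'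
  set T := Real.exp (k * U)
  have hT1 : 1 ≤ T := Real.one_le_exp (by positivity)
  have hT0 : 0 < T := by linarith
  have hTU : T ≤ Real.exp U := by
    apply Real.exp_le_exp.2
    have : k ≤ 1 := by simp only [k]; linarith
    nlinarith
  set η := c / U
  set δ := c / U ^ 2
  have hη : 0 < η := by positivity
  have hδ : 0 < δ := by positivity
  have hη1 : η ≤ 1 / 16 := (div_le_self hc.le hU).trans hc1
  have hδη : δ ≤ η := by
    simp only [δ, η]; gcongr; nlinarith
  set A := (K₀ + 7) * U ^ 2 * T
  have hA0 : 0 < A := by positivity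
  have hre : ∀ s : ℂ, |s.re - 1| ≤ η → 15 / 16 ≤ s.re := by
    intro s h; rw [abs_le] at h; linarith
  have hA : ∀ s : ℂ, |s.re - 1| ≤ η → |s.im| ≤ T → ‖devL χ s‖ ≤ A := by
    intro s h1 h2
    have hr := hre s h1
    have hr2 : s.re ≤ 2 := by rw [abs_le] at h1; linarith
    have h3 := (hb q χ U hU hqU s h1 (h2.trans hTU)).2
    have h4 : ‖(if χ = 1 then zetaReg s else 0 : ℂ)‖ ≤ 7 * T := by
      split_ifs
      · refine (norm_zetaReg_le (by linarith)).trans ?_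
        have h5 : ‖s‖ ≤ 2 + T := by
          refine (Complex.norm_le_abs_re_add_abs_im s).trans ?_
          rw [abs_of_nonneg (by linarith)]; linarith
        have : ‖s‖ / s.re ≤ 2 * (2 + T) := by
          rw [div_le_iff₀ (by linarith)]; nlinarith
        linarith
      · rw [norm_zero]; positivity
    have hU2 : 1 ≤ U ^ 2 := by nlinarith
    calc ‖devL χ s‖ ≤ ‖-logDeriv (regL χ) s‖ + ‖(if χ = 1 then zetaReg s else 0 : ℂ)‖ := norm_sub_le _ _
      _ ≤ K₀ * U ^ 2 * 1 + 7 * 1 * T := by rw [norm_neg]; linarith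
      _ ≤ K₀ * U ^ 2 * T + 7 * U ^ 2 * T := by gcongr
      _ = A := by simp only [A]; ring
  set G : ℂ → ℂ := fun s => devL χ s * (x : ℂ) ^ s * (1 / (s * (s + 1)))
  have hxpow : ∀ s : ℂ, ‖(x : ℂ) ^ s‖ = x ^ s.re := fun s => Complex.norm_cpow_eq_rpow_re_of_pos hx0 s
  have hx1 : 1 ≤ x := by rw [hx]; exact Real.one_le_exp (by positivity)
  have hxη : x ^ (1 - η) = x * Real.exp (-(c * U)) := by
    rw [hx, ← Real.exp_mul, ← Real.exp_add]; congr 1; simp only [η]; field_simp; ring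
  have hxδ : x ^ (1 + δ) = x * Real.exp c := by
    rw [hx, ← Real.exp_mul, ← Real.exp_add]; congr 1; simp only [δ]; field_simp
  have hexpc : Real.exp c ≤ 3 := by
    refine (Real.exp_le_exp.2 (by linarith : c ≤ 1)).trans ?_
    have := Real.exp_one_lt_d9; linarith
  obtain ⟨hs1, hs2⟩ := tsum_norm_devCoeff_le χ hδ (by linarith)
  have hL : ∀ t : ℝ, LSeries (devCoeff χ) (((1 + δ : ℝ) : ℂ) + t * I) * (x : ℂ) ^ (((1 + δ : ℝ) : ℂ) + t * I) *
      (1 / ((((1 + δ : ℝ) : ℂ) + t * I) * (((1 + δ : ℝ) : ℂ) + t * I + 1))) = G (((1 + δ : ℝ) : ℂ) + t * I) := by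
    intro t
    rw [LSeries_devCoeff χ (by simp [hδ])]
  have hp := perron (a := devCoeff χ) (c := 1 + δ) (by linarith) hx0 hs1
  have hint := integrable_perron_integrand (a := devCoeff χ) (c := 1 + δ) (by linarith) hx0 hs1
  have hbd := norm_perron_integrand_le (a := devCoeff χ) (c := 1 + δ) (by linarith) hx0 hs1
  simp only [hL] at hp hint hbd
  have hsplit := integral_add_compl (μ := volume) (measurableSet_Ioc (a := -T) (b := T)) hint
  have htail : ‖∫ t in (Ioc (-T) T)ᶜ, G (((1 + δ : ℝ) : ℂ) + t * I)‖ ≤ 16 / δ ^ 2 * (x * Real.exp c) * (2 / T) := by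
    refine (norm_integral_le_of_norm_le (g := fun t : ℝ => 16 / δ ^ 2 * (x * Real.exp c) * (1 + t ^ 2)⁻¹)
      (integrable_inv_one_add_sq.const_mul _).integrableOn (Eventually.of_forall fun t => (hbd t).trans ?_)).trans ?_
    · rw [hxδ]; gcongr
    · rw [integral_const_mul]
      gcongr
      exact integral_compl_Ioc_inv_one_add_sq_le hT0
  have hcentral : ‖∫ t in (-T)..T, G (((1 + δ : ℝ) : ℂ) + t * I)‖ ≤
      2 * T * (A * (x * Real.exp (-(c * U))) * 2) + 2 * ((1 + δ) - (1 - η)) * (A * (x * Real.exp c) * (1 / T ^ 2)) := by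
    refine norm_integral_line_le (G := G) (by linarith) hT0.le (fun s hs => ?_) (fun t ht => ?_) (fun u t hu1 hu2 ht => ?_)
    · rw [mem_reProdIm, uIcc_of_le (by linarith), uIcc_of_le (by linarith)] at hs
      have h1 : |s.re - 1| ≤ η := abs_le.2 ⟨by linarith [hs.1.1], by linarith [hs.1.2]⟩
      have h2 : |s.im| ≤ T := abs_le.2 hs.2
      have h3 := hre s h1
      have hs0 : s ≠ 0 := fun h => by rw [h] at h3; simp at h3; linarith
      have hs1 : s + 1 ≠ 0 := fun h => by
        have := congrArg Complex.re h
        simp at this; linarith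
      exact (((differentiableAt_devL (by linarith) (hb q χ U hU hqU s h1 (h2.trans hTU)).1).mul
        (differentiableAt_id.const_cpow (Or.inl hxc))).mul
        ((differentiableAt_const _).div (differentiableAt_id.mul (differentiableAt_id.add (differentiableAt_const _)))
          (mul_ne_zero hs0 hs1))).differentiableWithinAt
    · have hr : (((1 - η : ℝ) : ℂ) + t * I).re = 1 - η := by simp
      have hi : (((1 - η : ℝ) : ℂ) + t * I).im = t := by simp
      have h1 := hA (((1 - η : ℝ) : ℂ) + t * I) (by rw [hr, abs_le]; constructor <;> linarith) (by rwa [hi])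
      simp only [G]
      rw [norm_mul, norm_mul, hxpow, hr, hxη]
      gcongr
      rw [norm_div, norm_one, norm_mul, div_le_iff₀]
      · have h5 := (Complex.abs_re_le_norm (((1 - η : ℝ) : ℂ) + t * I))
        have h6 := (Complex.abs_re_le_norm (((1 - η : ℝ) : ℂ) + t * I + 1))
        rw [Complex.add_re, hr, Complex.one_re, abs_of_pos (by linarith)] at h6
        rw [hr, abs_of_pos (by linarith)] at h5
        nlinarith
      · have h5 := (Complex.abs_re_le_norm (((1 - η : ℝ) : ℂ) + t * I))
        have h6 := (Complex.abs_re_le_norm (((1 - η : ℝ) : ℂ) + t * I + 1))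
        rw [Complex.add_re, hr, Complex.one_re, abs_of_pos (by linarith)] at h6
        rw [hr, abs_of_pos (by linarith)] at h5
        apply mul_pos <;> linarith
    · have hr : ((u : ℂ) + t * I).re = u := by simp
      have hi : ((u : ℂ) + t * I).im = t := by simp
      have h1 := hA ((u : ℂ) + t * I) (by rw [hr, abs_le]; constructor <;> linarith) (by rw [hi, ht])
      simp only [G]
      rw [norm_mul, norm_mul, hxpow, hr, ← hxδ]
      have h5 := (Complex.abs_im_le_norm ((u : ℂ) + t * I))
      have h6 := (Complex.abs_im_le_norm ((u : ℂ) + t * I + 1))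
      rw [Complex.add_im, hi, Complex.one_im, add_zero, ht] at h6
      rw [hi, ht] at h5
      gcongr
      rw [norm_div, norm_one, norm_mul, sq]
      gcongr
  have htot : ‖2 * Real.pi * ∑ n ∈ Finset.Icc 1 ⌊x⌋₊, (1 - n / x) * devCoeff χ n‖ ≤
      (16 * (K₀ + 7) + 96 / c ^ 2) * x * (U ^ 4 * Real.exp (-(k * U))) := by
    rw [← hp, ← hsplit, ← intervalIntegral.integral_of_le (by linarith)]
    refine (norm_add_le _ _).trans ((add_le_add hcentral htail).trans ?_)
    have hTi : Real.exp (-(k * U)) = 1 / T := by rw [Real.exp_neg, one_div]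
    have hcT : Real.exp (-(c * U)) = 1 / T ^ 3 := by
      rw [Real.exp_neg, one_div, ← Real.exp_nat_mul]
      congr 2; simp only [k]; push_cast; ring
    rw [hTi, hcT]
    have hU24 : U ^ 2 ≤ U ^ 4 := pow_le_pow_right₀ hU (by norm_num)
    have t1 : 2 * T * (A * (x * (1 / T ^ 3)) * 2) ≤ 4 * (K₀ + 7) * x * (U ^ 4 * (1 / T)) := by
      have : 2 * T * (A * (x * (1 / T ^ 3)) * 2) = 4 * (K₀ + 7) * x * (U ^ 2 * (1 / T)) := by
        simp only [A]; field_simp; ring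
      rw [this]; gcongr
    have t2 : 2 * ((1 + δ) - (1 - η)) * (A * (x * Real.exp c) * (1 / T ^ 2)) ≤ 12 * (K₀ + 7) * x * (U ^ 4 * (1 / T)) := by
      calc 2 * ((1 + δ) - (1 - η)) * (A * (x * Real.exp c) * (1 / T ^ 2)) ≤ 4 * (A * (x * 3) * (1 / T ^ 2)) := by
            gcongr; linarith
        _ = 12 * (K₀ + 7) * x * (U ^ 2 * (1 / T)) := by simp only [A]; field_simp; ring
        _ ≤ _ := by gcongr
    have t3 : 16 / δ ^ 2 * (x * Real.exp c) * (2 / T) ≤ 96 / c ^ 2 * x * (U ^ 4 * (1 / T)) := by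
      calc 16 / δ ^ 2 * (x * Real.exp c) * (2 / T) ≤ 16 / δ ^ 2 * (x * 3) * (2 / T) := by gcongr
        _ = _ := by simp only [δ]; field_simp; ring
    linarith
  rw [norm_mul] at htot
  have hpi : 1 ≤ ‖(2 * Real.pi : ℂ)‖ := by
    rw [norm_mul, Complex.norm_real, Real.norm_eq_abs, abs_of_pos Real.pi_pos]
    have := Real.pi_gt_three
    simp; linarith
  calc _ ≤ ‖(2 * Real.pi : ℂ)‖ * ‖∑ n ∈ Finset.Icc 1 ⌊x⌋₊, (1 - n / x) * devCoeff χ n‖ :=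
        le_mul_of_one_le_left (norm_nonneg _) hpi
    _ ≤ _ := htot
    _ ≤ (16 * (K₀ + 7) + 96 / c ^ 2) * x * (384 / k ^ 4 * Real.exp (-(k / 2 * U))) :=
        mul_le_mul_of_nonneg_left (pow_four_mul_exp_neg_le hk hU0.le) (by positivity)
    _ = _ := by ring

lemma sum_char_inv_mul_devCoeff {q : ℕ} [NeZero q] {a : ZMod q} (ha : IsUnit a) (n : ℕ) :
    ∑ χ : DirichletCharacter ℂ q, χ a⁻¹ * devCoeff χ n = (q.totient : ℂ) * residueClass a n - 1 := by
  have h1 : (1 : DirichletCharacter ℂ q) a⁻¹ = 1 := by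
    obtain ⟨u, rfl⟩ := ha
    rw [ZMod.inv_coe_unit]
    exact MulChar.one_apply_coe _
  have h2 := DirichletCharacter.sum_char_inv_mul_char_eq ℂ ha (n : ZMod q)
  simp only [devCoeff, mul_sub, Finset.sum_sub_distrib, ← mul_assoc, ← Finset.sum_mul, h2]
  simp only [mul_ite, mul_one, mul_zero, Finset.sum_ite_eq', Finset.mem_univ, if_true, h1]
  congr 1
  by_cases h : a = n
  · simp [residueClass, ← h]
  · simp [residueClass, h, Ne.symm h]

lemma abs_sum_one_sub_div_sub_le {x : ℝ} (hx : 1 ≤ x) :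
    |∑ n ∈ Finset.Icc 1 ⌊x⌋₊, (1 - n / x) - x / 2| ≤ 1 := by
  have key (N : ℕ) : ∑ n ∈ Finset.Icc 1 N, (1 - (n : ℝ) / x) = N - N * (N + 1) / (2 * x) := by
    induction N with
    | zero => simp
    | succ k ih =>
      rw [Finset.sum_Icc_succ_top (by omega), ih]
      push_cast; field_simp; ring
  have hN := Nat.floor_le (by linarith : 0 ≤ x)
  have hN' := Nat.lt_floor_add_one x
  rw [key]
  set N : ℝ := (⌊x⌋₊ : ℝ)
  have e : N - N * (N + 1) / (2 * x) - x / 2 = -(((x - N) ^ 2 + N) / (2 * x)) := by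
    field_simp; ring
  have hN0 : 0 ≤ N := Nat.cast_nonneg _
  rw [e, abs_neg, abs_of_nonneg (by positivity), div_le_one (by linarith)]
  nlinarith

lemma sum_one_sub_div_residueClass {B : ℝ} (hB : 0 < B) :
    ∃ D : ℝ, 0 < D ∧ ∃ K : ℝ, 0 < K ∧ ∀ (q : ℕ) [NeZero q] (a : ZMod q) (U x : ℝ), IsUnit a →
      1 ≤ U → (q : ℝ) ≤ U ^ B → x = Real.exp (U ^ 2) →
      |∑ n ∈ Finset.Icc 1 ⌊x⌋₊, (1 - n / x) * residueClass a n - x / (2 * q.totient)| ≤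
        K * x * Real.exp (-(D * U)) := by
  obtain ⟨D, hD, K, hK, h⟩ := norm_sum_devCoeff_le hB
  refine ⟨min D 1, by positivity, K + 1, by positivity, fun q _ a U x ha hU hq hx => ?_⟩
  have hx1 : 1 ≤ x := by rw [hx]; exact Real.one_le_exp (by positivity)
  have hφ : (0 : ℝ) < q.totient := by exact_mod_cast Nat.totient_pos.2 (NeZero.pos q)
  have hφ1 : (1 : ℝ) ≤ q.totient := by exact_mod_cast Nat.totient_pos.2 (NeZero.pos q)
  set S := ∑ n ∈ Finset.Icc 1 ⌊x⌋₊, (1 - n / x) * residueClass a n with hS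
  set T := ∑ n ∈ Finset.Icc 1 ⌊x⌋₊, (1 - n / x) with hT
  have h1 : ((q.totient * S - T : ℝ) : ℂ) = ∑ χ : DirichletCharacter ℂ q,
      χ a⁻¹ * ∑ n ∈ Finset.Icc 1 ⌊x⌋₊, (1 - n / x) * devCoeff χ n := by
    simp_rw [Finset.mul_sum]
    rw [Finset.sum_comm, hS, hT]
    push_cast
    rw [Finset.mul_sum, ← Finset.sum_sub_distrib]
    refine Finset.sum_congr rfl fun n _ => ?_
    have := sum_char_inv_mul_devCoeff ha n
    simp_rw [mul_left_comm _ ((1 : ℂ) - n / x), ← Finset.mul_sum, this]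
    ring
  have h2 : |q.totient * S - T| ≤ q.totient * (K * x * Real.exp (-(D * U))) := by
    rw [← Real.norm_eq_abs, ← Complex.norm_real, h1]
    refine (norm_sum_le _ _).trans ((Finset.sum_le_card_nsmul _ _ (K * x * Real.exp (-(D * U)))
      fun χ _ => ?_).trans ?_)
    · rw [norm_mul]
      exact (mul_le_of_le_one_left (norm_nonneg _) (χ.norm_le_one _)).trans (h q χ U x hU hq hx)
    · rw [nsmul_eq_mul, Finset.card_univ, ← Nat.card_eq_fintype_card,
        DirichletCharacter.card_eq_totient_of_hasEnoughRootsOfUnity]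
  have h3 := abs_sum_one_sub_div_sub_le hx1
  rw [← hT] at h3
  have e : S - x / (2 * q.totient) = (1 / q.totient) * (q.totient * S - T) + (1 / q.totient) * (T - x / 2) := by
    field_simp; ring
  have h4 : Real.exp (-(D * U)) ≤ Real.exp (-(min D 1 * U)) := by
    gcongr; exact min_le_left _ _
  have h5 : 1 ≤ x * Real.exp (-(min D 1 * U)) := by
    rw [hx, ← Real.exp_add]
    refine Real.one_le_exp ?_
    nlinarith [min_le_right D 1]
  calc _ ≤ (1 / q.totient) * |q.totient * S - T| + (1 / q.totient) * |T - x / 2| := by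
        rw [e]
        refine (abs_add_le _ _).trans ?_
        rw [abs_mul, abs_mul, abs_of_pos (show (0 : ℝ) < 1 / q.totient by positivity)]
    _ ≤ (1 / q.totient) * (q.totient * (K * x * Real.exp (-(D * U)))) + 1 * 1 := by
        gcongr
        rw [div_le_one hφ]; exact hφ1
    _ = K * x * Real.exp (-(D * U)) + 1 := by field_simp
    _ ≤ K * x * Real.exp (-(min D 1 * U)) + x * Real.exp (-(min D 1 * U)) := by gcongr
    _ = _ := by ring

/-- The sum of `(x - n) * r n` over `n ≤ x` is a convex function of `x` with slope
the partial sum of `r`. -/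
lemma sub_mul_sum_le {r : ℕ → ℝ} (hr : ∀ n, 0 ≤ r n) {x y : ℝ} (hy : 0 ≤ y) :
    (y - x) * ∑ n ∈ Finset.Icc 1 ⌊x⌋₊, r n ≤
      ∑ n ∈ Finset.Icc 1 ⌊y⌋₊, (y - n) * r n - ∑ n ∈ Finset.Icc 1 ⌊x⌋₊, (x - n) * r n := by
  have e : (y - x) * ∑ n ∈ Finset.Icc 1 ⌊x⌋₊, r n + ∑ n ∈ Finset.Icc 1 ⌊x⌋₊, (x - n) * r n =
      ∑ n ∈ Finset.Icc 1 ⌊x⌋₊, (y - n) * r n := by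
    rw [Finset.mul_sum, ← Finset.sum_add_distrib]
    exact Finset.sum_congr rfl fun n _ => by ring
  rw [le_sub_iff_add_le, e]
  rcases le_total x y with h | h
  · refine Finset.sum_le_sum_of_subset_of_nonneg (Finset.Icc_subset_Icc_right (Nat.floor_mono h))
      fun n hn _ => mul_nonneg ?_ (hr n)
    have := (Nat.le_floor_iff hy).1 (Finset.mem_Icc.1 hn).2
    linarith
  · rw [← Finset.sum_sdiff (Finset.Icc_subset_Icc_right (a := 1) (Nat.floor_mono h))]
    refine add_le_of_nonpos_left (Finset.sum_nonpos fun n hn => mul_nonpos_of_nonpos_of_nonneg ?_ (hr n))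
    rw [Finset.mem_sdiff, Finset.mem_Icc, Finset.mem_Icc] at hn
    have : ⌊y⌋₊ < n := by by_contra! h'; exact hn.2 ⟨hn.1.1, h'⟩
    have := (Nat.floor_lt hy).1 this
    linarith

/-- A Tauberian estimate recovering partial sums from their smoothed version. -/
lemma abs_sum_sub_div_le {r : ℕ → ℝ} (hr : ∀ n, 0 ≤ r n) {x φ K ε : ℝ} (hx : 0 < x) (hφ : 1 ≤ φ)
    (hε : 0 < ε) (hε1 : ε ≤ 1)
    (hW : ∀ y, x / 2 ≤ y → y ≤ 2 * x →
      |∑ n ∈ Finset.Icc 1 ⌊y⌋₊, (y - n) * r n - y ^ 2 / (2 * φ)| ≤ K * x ^ 2 * ε ^ 2) :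
    |∑ n ∈ Finset.Icc 1 ⌊x⌋₊, r n - x / φ| ≤ (1 + 4 * K) * x * ε := by
  obtain ⟨H, hH⟩ : ∃ H, H = x * ε / 2 := ⟨_, rfl⟩
  have hH0 : 0 < H := by rw [hH]; positivity
  have hHx : H ≤ x / 2 := by rw [hH]; nlinarith
  have hEH : 2 * (K * x ^ 2 * ε ^ 2) = H * (4 * K * (x * ε)) := by rw [hH]; ring
  have w0 := abs_le.1 (hW x (by linarith) (by linarith))
  have w1 := abs_le.1 (hW (x + H) (by linarith) (by linarith))
  have w2 := abs_le.1 (hW (x - H) (by linarith) (by linarith))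
  have c1 := sub_mul_sum_le hr (x := x) (show 0 ≤ x + H by linarith)
  have c2 := sub_mul_sum_le hr (x := x) (show 0 ≤ x - H by linarith)
  have i1 : (x + H) ^ 2 / (2 * φ) - x ^ 2 / (2 * φ) = H * (x / φ) + H * (H / (2 * φ)) := by
    field_simp; ring
  have i2 : (x - H) ^ 2 / (2 * φ) - x ^ 2 / (2 * φ) = - (H * (x / φ)) + H * (H / (2 * φ)) := by
    field_simp; ring
  have i3 : H / (2 * φ) ≤ H := div_le_self hH0.le (by linarith)
  have i4 : H * (H / (2 * φ)) ≤ H * H := by gcongr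
  rw [add_sub_cancel_left] at c1
  rw [show x - H - x = -H by ring, neg_mul] at c2
  generalize ∑ n ∈ Finset.Icc 1 ⌊x⌋₊, r n = P at *
  have u1 : H * P ≤ H * (x / φ + (H + 4 * K * (x * ε))) := by
    rw [mul_add, mul_add, ← hEH]; linarith
  have u2 : H * (x / φ) ≤ H * (P + (H + 4 * K * (x * ε))) := by
    rw [mul_add, mul_add, ← hEH]; linarith
  have v1 := le_of_mul_le_mul_left u1 hH0
  have v2 := le_of_mul_le_mul_left u2 hH0
  have hKx : 0 ≤ x * ε := by positivity
  rw [hH] at v1 v2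
  rw [abs_le]
  constructor <;> linarith

lemma abs_sum_residueClass_sub_le {B : ℝ} (hB : 0 < B) :
    ∃ D : ℝ, 0 < D ∧ ∃ K : ℝ, 0 < K ∧ ∀ (q : ℕ) [NeZero q] (a : ZMod q) (x : ℝ), IsUnit a →
      0 < x → 16 ≤ Real.log x → (q : ℝ) ≤ Real.log x ^ B →
      |∑ n ∈ Finset.Icc 1 ⌊x⌋₊, residueClass a n - x / q.totient| ≤
        K * x * Real.exp (-(D * √(Real.log x))) := by
  obtain ⟨D, hD, K, hK, h⟩ := sum_one_sub_div_residueClass (B := 4 * B) (by positivity)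
  refine ⟨D / 4, by positivity, 1 + 16 * K, by positivity, fun q _ a x ha hx0 hx hq => ?_⟩
  set U := √(Real.log x) with hU
  have hU2 : U ^ 2 = Real.log x := Real.sq_sqrt (by linarith)
  have hU4 : 4 ≤ U := Real.le_sqrt_of_sq_le (by linarith)
  have hφ1 : (1 : ℝ) ≤ q.totient := by exact_mod_cast Nat.totient_pos.2 (NeZero.pos q)
  set φ : ℝ := (q.totient : ℝ)
  set E := 4 * K * x ^ 2 * Real.exp (-(D / 2 * U)) with hE
  have hW (y : ℝ) (h1 : x / 2 ≤ y) (h2 : y ≤ 2 * x) :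
      |∑ n ∈ Finset.Icc 1 ⌊y⌋₊, (y - n) * residueClass a n - y ^ 2 / (2 * φ)| ≤ E := by
    have hy : 0 < y := by linarith
    have hlog : Real.log x - 1 ≤ Real.log y := by
      have := Real.log_le_log (by linarith) h1
      rw [Real.log_div hx0.ne' (by norm_num)] at this
      linarith [Real.log_two_lt_d9]
    have hV : U / 2 ≤ √(Real.log y) := Real.le_sqrt_of_sq_le (by nlinarith)
    have hV2 : √(Real.log y) ^ 2 = Real.log y := Real.sq_sqrt (by linarith)
    have hqV : (q : ℝ) ≤ √(Real.log y) ^ (4 * B) := by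
      refine hq.trans ?_
      rw [Real.rpow_mul (by positivity)]
      refine Real.rpow_le_rpow (by linarith) ?_ hB.le
      rw [← hU2, show (4 : ℝ) = (4 : ℕ) by norm_num, Real.rpow_natCast]
      have : U ≤ √(Real.log y) ^ 2 := by nlinarith
      nlinarith
    have := h q a (√(Real.log y)) y ha (by linarith) hqV (by rw [hV2, Real.exp_log hy])
    have e : ∑ n ∈ Finset.Icc 1 ⌊y⌋₊, (y - n) * residueClass a n - y ^ 2 / (2 * φ) =
        y * (∑ n ∈ Finset.Icc 1 ⌊y⌋₊, (1 - n / y) * residueClass a n - y / (2 * φ)) := by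
      rw [mul_sub, Finset.mul_sum]
      congr 1
      · refine Finset.sum_congr rfl fun n _ => ?_
        field_simp
      · ring
    rw [e, abs_mul, abs_of_pos hy]
    calc _ ≤ (2 * x) * (K * (2 * x) * Real.exp (-(D * (U / 2)))) := by
          gcongr
          refine this.trans ?_
          gcongr
      _ = E := by rw [hE, show D * (U / 2) = D / 2 * U by ring]; ring
  have hεE : E = 4 * K * x ^ 2 * Real.exp (-(D / 4 * U)) ^ 2 := by
    rw [hE, ← Real.exp_nat_mul]; congr 2; push_cast; ring
  have hε1 : Real.exp (-(D / 4 * U)) ≤ 1 := Real.exp_le_one_iff.2 (neg_nonpos.2 (by positivity))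
  rw [hεE] at hW
  convert abs_sum_sub_div_le (residueClass_nonneg a) hx0 hφ1 (Real.exp_pos _) hε1 hW using 3
  ring

/-- `log p` at the primes `p` congruent to `a` modulo `q`, and zero elsewhere. -/
noncomputable def primeLog {q : ℕ} (a : ZMod q) (n : ℕ) : ℝ :=
  if n.Prime ∧ (n : ZMod q) = a then Real.log n else 0

/-- The Chebyshev function of a residue class. -/
noncomputable def thetaMod {q : ℕ} (a : ZMod q) (x : ℝ) : ℝ :=
  ∑ n ∈ Finset.Icc 0 ⌊x⌋₊, primeLog a n

lemma primeLog_nonneg {q : ℕ} (a : ZMod q) (n : ℕ) : 0 ≤ primeLog a n := by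
  unfold primeLog
  split_ifs
  exacts [Real.log_natCast_nonneg n, le_rfl]

@[simp]
lemma primeLog_zero {q : ℕ} (a : ZMod q) : primeLog a 0 = 0 := by simp [primeLog]

@[simp]
lemma primeLog_one {q : ℕ} (a : ZMod q) : primeLog a 1 = 0 := by simp [primeLog]

lemma thetaMod_nonneg {q : ℕ} (a : ZMod q) (x : ℝ) : 0 ≤ thetaMod a x :=
  Finset.sum_nonneg fun n _ => primeLog_nonneg a n

lemma thetaMod_le {q : ℕ} (a : ZMod q) {x : ℝ} (hx : 0 ≤ x) : thetaMod a x ≤ 2 * x := by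
  have h := Chebyshev.theta_le_log4_mul_x hx
  have h4 : Real.log 4 ≤ 2 := by
    rw [show (4 : ℝ) = 2 ^ 2 by norm_num, Real.log_pow]
    push_cast; linarith [Real.log_two_lt_d9]
  refine le_trans ?_ (h.trans (by gcongr))
  rw [Chebyshev.theta_eq_sum_Icc, Finset.sum_filter]
  refine Finset.sum_le_sum fun n _ => ?_
  unfold primeLog
  split_ifs with h1 h2 h2
  exacts [le_rfl, absurd h1.1 h2, Real.log_natCast_nonneg n, le_rfl]

lemma abs_sum_residueClass_sub_thetaMod_le {q : ℕ} (a : ZMod q) {x : ℝ} (hx : 1 ≤ x) :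
    |∑ n ∈ Finset.Icc 1 ⌊x⌋₊, residueClass a n - thetaMod a x| ≤ 2 * √x * Real.log x := by
  have e : ∑ n ∈ Finset.Icc 1 ⌊x⌋₊, residueClass a n = ∑ n ∈ Finset.Icc 0 ⌊x⌋₊, residueClass a n := by
    rw [← Finset.add_sum_Ioc_eq_sum_Icc (Nat.zero_le _), ArithmeticFunction.vonMangoldt.residueClass_apply_zero, zero_add]
    rfl
  refine le_trans ?_ (Chebyshev.psi_sub_theta_le hx)
  have h (n : ℕ) : 0 ≤ residueClass a n - primeLog a n ∧
      residueClass a n - primeLog a n ≤ vonMangoldt n - if n.Prime then Real.log n else 0 := by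
    by_cases hn : (n : ZMod q) = a
    · have : residueClass a n = vonMangoldt n := by simp [residueClass, hn]
      rw [this]
      by_cases hp : n.Prime
      · simp [primeLog, hn, hp, ArithmeticFunction.vonMangoldt_apply_prime hp]
      · simp [primeLog, hp]
    · have : residueClass a n = 0 := by simp [residueClass, hn]
      rw [this]
      by_cases hp : n.Prime
      · simp [primeLog, hn, hp, ArithmeticFunction.vonMangoldt_apply_prime hp]
      · simp [primeLog, hp]
  rw [e, thetaMod, ← Finset.sum_sub_distrib, abs_of_nonneg (Finset.sum_nonneg fun n _ => (h n).1),
    Chebyshev.psi_eq_sum_Icc, Chebyshev.theta_eq_sum_Icc, Finset.sum_filter, ← Finset.sum_sub_distrib]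
  exact Finset.sum_le_sum fun n _ => (h n).2

lemma two_mul_sqrt_mul_log_le {x : ℝ} (hx0 : 0 < x) (hx : 16 ≤ Real.log x) :
    2 * √x * Real.log x ≤ 4 * x * Real.exp (-√(Real.log x)) := by
  set U := √(Real.log x) with hU
  have hU2 : U ^ 2 = Real.log x := Real.sq_sqrt (by linarith)
  have hU4 : 4 ≤ U := Real.le_sqrt_of_sq_le (by linarith)
  have hx' : x = Real.exp (U ^ 2) := by rw [hU2, Real.exp_log hx0]
  have hs : √x = Real.exp (U ^ 2 / 2) := by rw [hx', Real.exp_half]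
  have h2 : U ^ 2 ≤ 2 * Real.exp U := by
    have := Real.pow_div_factorial_le_exp U (by linarith) 2
    norm_num at this; linarith
  calc 2 * √x * Real.log x = 2 * Real.exp (U ^ 2 / 2) * U ^ 2 := by rw [hs, hU2]
    _ ≤ 2 * Real.exp (U ^ 2 / 2) * (2 * Real.exp U) := by gcongr
    _ = 4 * Real.exp (U ^ 2 / 2 + U) := by rw [Real.exp_add]; ring
    _ ≤ 4 * Real.exp (U ^ 2 + -U) := by
        have : U ^ 2 / 2 + U ≤ U ^ 2 + -U := by nlinarith
        gcongr
    _ = _ := by rw [Real.exp_add, ← hx']; ring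

lemma abs_thetaMod_sub_le {B : ℝ} (hB : 0 < B) :
    ∃ D : ℝ, 0 < D ∧ D ≤ 1 ∧ ∃ K : ℝ, 0 < K ∧ ∀ (q : ℕ) [NeZero q] (a : ZMod q) (x : ℝ), IsUnit a →
      0 < x → 16 ≤ Real.log x → (q : ℝ) ≤ Real.log x ^ B →
      |thetaMod a x - x / q.totient| ≤ K * x * Real.exp (-(D * √(Real.log x))) := by
  obtain ⟨D, hD, K, hK, h⟩ := abs_sum_residueClass_sub_le hB
  refine ⟨min D 1, by positivity, min_le_right _ _, K + 4, by positivity, fun q _ a x ha hx0 hx hq => ?_⟩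
  have h1 := h q a x ha hx0 hx hq
  have hx1 : 1 ≤ x := by
    by_contra! h'
    linarith [Real.log_nonpos hx0.le h'.le]
  have h2 := (abs_sum_residueClass_sub_thetaMod_le a hx1).trans (two_mul_sqrt_mul_log_le hx0 hx)
  rw [abs_sub_comm] at h2
  have e1 : Real.exp (-(D * √(Real.log x))) ≤ Real.exp (-(min D 1 * √(Real.log x))) := by
    gcongr; exact min_le_left _ _
  have e2 : Real.exp (-√(Real.log x)) ≤ Real.exp (-(min D 1 * √(Real.log x))) := by
    gcongr
    exact mul_le_of_le_one_left (Real.sqrt_nonneg _) (min_le_right _ _)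
  calc _ ≤ 4 * x * Real.exp (-√(Real.log x)) + K * x * Real.exp (-(D * √(Real.log x))) :=
        (abs_sub_le _ _ _).trans (add_le_add h2 h1)
    _ ≤ 4 * x * Real.exp (-(min D 1 * √(Real.log x))) + K * x * Real.exp (-(min D 1 * √(Real.log x))) := by
        gcongr
    _ = _ := by ring

lemma log_pos_of_mem_Icc {x t : ℝ} (ht : t ∈ Icc 2 x) : 0 < Real.log t :=
  Real.log_pos (by linarith [ht.1])

lemma integrableOn_thetaMod {q : ℕ} (a : ZMod q) (x : ℝ) :
    IntegrableOn (fun t => thetaMod a t / (t * Real.log t ^ 2)) (Icc 2 x) := by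
  have : (fun t => thetaMod a t / (t * Real.log t ^ 2)) =
      fun t => (1 / (t * Real.log t ^ 2)) * ∑ n ∈ Finset.Icc 0 ⌊t⌋₊, primeLog a n := by
    ext t; rw [thetaMod]; ring
  rw [this]
  refine integrableOn_mul_sum_Icc _ (by norm_num) <| ContinuousOn.integrableOn_Icc fun t ht ↦
    ContinuousAt.continuousWithinAt ?_
  have h1 : t ≠ 0 := by linarith [ht.1]
  have : t * Real.log t ^ 2 ≠ 0 := mul_ne_zero h1 (pow_ne_zero 2 (log_pos_of_mem_Icc ht).ne')
  fun_prop

lemma continuousOn_inv_log_sq (x : ℝ) :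
    ContinuousOn (fun t => 1 / Real.log t ^ 2) (Icc 2 x) := fun t ht => by
  have h1 : t ≠ 0 := by linarith [ht.1]
  have : Real.log t ^ 2 ≠ 0 := pow_ne_zero 2 (log_pos_of_mem_Icc ht).ne'
  exact ContinuousAt.continuousWithinAt (by fun_prop)

lemma continuousOn_inv_log (x : ℝ) :
    ContinuousOn (fun t => 1 / Real.log t) (Icc 2 x) := fun t ht => by
  have h1 : t ≠ 0 := by linarith [ht.1]
  have : Real.log t ≠ 0 := (log_pos_of_mem_Icc ht).ne'
  exact ContinuousAt.continuousWithinAt (by fun_prop)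

lemma integral_inv_log_eq {x : ℝ} (hx : 2 ≤ x) :
    ∫ t in (2 : ℝ)..x, 1 / Real.log t =
      x / Real.log x - 2 / Real.log 2 + ∫ t in (2 : ℝ)..x, 1 / Real.log t ^ 2 := by
  have i1 : IntervalIntegrable (fun t => 1 / Real.log t) volume 2 x :=
    ContinuousOn.intervalIntegrable (by rw [uIcc_of_le hx]; exact continuousOn_inv_log x)
  have i2 : IntervalIntegrable (fun t => 1 / Real.log t ^ 2) volume 2 x :=
    ContinuousOn.intervalIntegrable (by rw [uIcc_of_le hx]; exact continuousOn_inv_log_sq x)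
  have := intervalIntegral.integral_eq_sub_of_hasDerivAt (a := 2) (b := x)
    (f := fun t => t / Real.log t) (f' := fun t => 1 / Real.log t - 1 / Real.log t ^ 2) (fun t ht => by
      rw [uIcc_of_le hx] at ht
      have h1 : t ≠ 0 := by linarith [ht.1]
      have h2 : Real.log t ≠ 0 := (log_pos_of_mem_Icc ht).ne'
      have h3 : HasDerivAt (fun t => t / Real.log t) ((1 * Real.log t - t * t⁻¹) / Real.log t ^ 2) t :=
        (hasDerivAt_id t).div (Real.hasDerivAt_log h1) h2
      exact h3.congr_deriv (by field_simp)) (i1.sub i2)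
  rw [intervalIntegral.integral_sub i1 i2] at this
  linarith

lemma primePiMod_eq {q : ℕ} (a : ℤ) {x : ℝ} (hx : 2 ≤ x) :
    (primePiMod x q a : ℝ) = thetaMod (a : ZMod q) x / Real.log x +
      ∫ t in (2 : ℝ)..x, thetaMod (a : ZMod q) t / (t * Real.log t ^ 2) := by
  have e : (primePiMod x q a : ℝ) = ∑ n ∈ Finset.Icc 0 ⌊x⌋₊, (Real.log n)⁻¹ * primeLog (a : ZMod q) n := by
    rw [← Finset.add_sum_Ioc_eq_sum_Icc (Nat.zero_le _), primeLog_zero, mul_zero, zero_add,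
      primePiMod, Finset.card_eq_sum_ones, Finset.sum_filter]
    push_cast
    refine Finset.sum_congr rfl fun n _ => ?_
    have hiff : (n : ℤ) ≡ a [ZMOD (q : ℤ)] ↔ (n : ZMod q) = a := by
      rw [← ZMod.intCast_eq_intCast_iff, Int.cast_natCast]
    by_cases h : n.Prime ∧ (n : ZMod q) = a
    · have : Real.log n ≠ 0 := (Real.log_pos (by exact_mod_cast h.1.one_lt)).ne'
      simp only [hiff, primeLog, if_pos h]
      field_simp
    · simp only [hiff, primeLog, if_neg h, mul_zero]
  rw [e, sum_mul_eq_sub_integral_mul₁ (primeLog (a : ZMod q)) (f := fun t => (Real.log t)⁻¹)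
    (primeLog_zero _) (primeLog_one _), ← intervalIntegral.integral_of_le hx, sub_eq_add_neg,
    ← intervalIntegral.integral_neg]
  · congr 1
    · rw [thetaMod]; ring
    · refine intervalIntegral.integral_congr fun t _ => ?_
      simp only [thetaMod, Real.deriv_inv_log_apply]
      ring
  · intro t ht
    have h1 : t ≠ 0 := by linarith [ht.1]
    have : Real.log t ≠ 0 := (log_pos_of_mem_Icc ht).ne'
    fun_prop
  · refine ContinuousOn.integrableOn_Icc fun t ht ↦ ContinuousWithinAt.congr ?_
      (fun _ _ ↦ Real.deriv_inv_log_apply) Real.deriv_inv_log_apply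
    have h1 : t ≠ 0 := by linarith [ht.1]
    have : Real.log t ^ 2 ≠ 0 := pow_ne_zero 2 (log_pos_of_mem_Icc ht).ne'
    exact ContinuousAt.continuousWithinAt <| by fun_prop

lemma primePiMod_sub_eq {q : ℕ} [NeZero q] (a : ℤ) {x : ℝ} (hx : 2 ≤ x) :
    (primePiMod x q a : ℝ) - (1 / q.totient) * ∫ t in (2 : ℝ)..x, 1 / Real.log t =
      (thetaMod (a : ZMod q) x - x / q.totient) / Real.log x + 2 / (q.totient * Real.log 2) +
        ∫ t in (2 : ℝ)..x, (thetaMod (a : ZMod q) t - t / q.totient) / (t * Real.log t ^ 2) := by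
  have hφ : (0 : ℝ) < q.totient := by exact_mod_cast Nat.totient_pos.2 (NeZero.pos q)
  have i1 : IntervalIntegrable (fun t => thetaMod (a : ZMod q) t / (t * Real.log t ^ 2)) volume 2 x :=
    (intervalIntegrable_iff_integrableOn_Icc_of_le hx).2 (integrableOn_thetaMod _ x)
  have i2 : IntervalIntegrable (fun t => 1 / Real.log t ^ 2) volume 2 x :=
    ContinuousOn.intervalIntegrable (by rw [uIcc_of_le hx]; exact continuousOn_inv_log_sq x)
  have e : ∫ t in (2 : ℝ)..x, (thetaMod (a : ZMod q) t - t / q.totient) / (t * Real.log t ^ 2) =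
      (∫ t in (2 : ℝ)..x, thetaMod (a : ZMod q) t / (t * Real.log t ^ 2)) -
        (1 / q.totient) * ∫ t in (2 : ℝ)..x, 1 / Real.log t ^ 2 := by
    rw [← intervalIntegral.integral_const_mul, ← intervalIntegral.integral_sub i1 (i2.const_mul _)]
    refine intervalIntegral.integral_congr fun t ht => ?_
    rw [uIcc_of_le hx] at ht
    have h1 : t ≠ 0 := by linarith [ht.1]
    have h2 : Real.log t ≠ 0 := (log_pos_of_mem_Icc ht).ne'
    field_simp
  have hl : Real.log 2 ≠ 0 := (Real.log_pos one_lt_two).ne'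
  have hlx : Real.log x ≠ 0 := (Real.log_pos (by linarith)).ne'
  rw [e, primePiMod_eq a hx, integral_inv_log_eq hx]
  field_simp
  ring

lemma abs_primePiMod_sub_le_of_thetaMod {q : ℕ} [NeZero q] (a : ℤ) {x E : ℝ} (hx : 4 ≤ x)
    (hlog : 1 ≤ Real.log x / 2)
    (h : ∀ t ∈ Icc (√x) x, |thetaMod (a : ZMod q) t - t / q.totient| ≤ E * t) :
    |(primePiMod x q a : ℝ) - (1 / q.totient) * ∫ t in (2 : ℝ)..x, 1 / Real.log t| ≤
      2 * (E * x) + 16 * √x := by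
  have hφ : (1 : ℝ) ≤ q.totient := by exact_mod_cast Nat.totient_pos.2 (NeZero.pos q)
  have hl2 : 1 / 2 ≤ Real.log 2 := by linarith [Real.log_two_gt_d9]
  have hs2 : 2 ≤ √x := Real.le_sqrt_of_sq_le (by linarith)
  have hsx : √x ≤ x := by nlinarith [Real.sq_sqrt (show 0 ≤ x by linarith)]
  have hE : 0 ≤ E := by
    have := (abs_nonneg _).trans (h x ⟨hsx, le_rfl⟩)
    exact nonneg_of_mul_nonneg_left this (by linarith)
  set f : ℝ → ℝ := fun t => (thetaMod (a : ZMod q) t - t / q.totient) / (t * Real.log t ^ 2) with hf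
  have habs (t : ℝ) (ht : 2 ≤ t) : |thetaMod (a : ZMod q) t - t / q.totient| ≤ 2 * t := by
    have h1 := thetaMod_le (a : ZMod q) (x := t) (by linarith)
    have h2 := thetaMod_nonneg (a : ZMod q) t
    have h3 : t / q.totient ≤ t := div_le_self (by linarith) hφ
    have h4 : 0 ≤ t / q.totient := by positivity
    rw [abs_le]; constructor <;> linarith
  have hint : IntegrableOn f (Icc 2 x) := by
    have : f = fun t => thetaMod (a : ZMod q) t / (t * Real.log t ^ 2) - t / q.totient / (t * Real.log t ^ 2) := by
      ext t; simp only [hf]; ring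
    rw [this]
    refine (integrableOn_thetaMod _ x).sub (ContinuousOn.integrableOn_Icc fun t ht => ?_)
    have h1 : t ≠ 0 := by linarith [ht.1]
    have : t * Real.log t ^ 2 ≠ 0 := mul_ne_zero h1 (pow_ne_zero 2 (log_pos_of_mem_Icc ht).ne')
    exact ContinuousAt.continuousWithinAt (by fun_prop)
  have i1 : IntervalIntegrable f volume 2 √x :=
    (intervalIntegrable_iff_integrableOn_Icc_of_le hs2).2 (hint.mono_set (Icc_subset_Icc_right hsx))
  have i2 : IntervalIntegrable f volume √x x :=
    (intervalIntegrable_iff_integrableOn_Icc_of_le hsx).2 (hint.mono_set (Icc_subset_Icc_left hs2))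
  have b1 : ‖∫ t in (2 : ℝ)..√x, f t‖ ≤ 8 * |√x - 2| :=
    intervalIntegral.norm_integral_le_of_norm_le_const fun t ht => by
      rw [uIoc_of_le hs2] at ht
      have ht2 : 2 ≤ t := ht.1.le
      have hlt : 1 / 2 ≤ Real.log t := hl2.trans (Real.log_le_log (by norm_num) ht2)
      rw [Real.norm_eq_abs, abs_div, abs_of_pos (show 0 < t * Real.log t ^ 2 by positivity),
        div_le_iff₀ (by positivity)]
      calc _ ≤ 2 * t := habs t ht2
        _ = 8 * (t * (1 / 2) ^ 2) := by ring
        _ ≤ _ := by gcongr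
  have b2 : ‖∫ t in √x..x, f t‖ ≤ E * |x - √x| :=
    intervalIntegral.norm_integral_le_of_norm_le_const fun t ht => by
      rw [uIoc_of_le hsx] at ht
      have ht2 : 2 ≤ t := hs2.trans ht.1.le
      have hlt : 1 ≤ Real.log t := by
        refine hlog.trans ?_
        rw [← Real.log_sqrt (by linarith)]
        exact Real.log_le_log (by linarith) ht.1.le
      rw [Real.norm_eq_abs, abs_div, abs_of_pos (show 0 < t * Real.log t ^ 2 by positivity),
        div_le_iff₀ (by positivity)]
      calc _ ≤ E * t := h t ⟨ht.1.le, ht.2⟩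
        _ = E * (t * 1 ^ 2) := by ring
        _ ≤ _ := by gcongr
  rw [abs_of_nonneg (by linarith)] at b1 b2
  have b3 : |(thetaMod (a : ZMod q) x - x / q.totient) / Real.log x| ≤ E * x := by
    rw [abs_div, abs_of_pos (show 0 < Real.log x by linarith)]
    exact (div_le_self (abs_nonneg _) (by linarith)).trans (h x ⟨hsx, le_rfl⟩)
  have b4 : |2 / (q.totient * Real.log 2)| ≤ 4 := by
    rw [abs_of_pos (by positivity), div_le_iff₀ (by positivity)]
    nlinarith
  rw [primePiMod_sub_eq a (by linarith), ← intervalIntegral.integral_add_adjacent_intervals i1 i2]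
  rw [Real.norm_eq_abs] at b1 b2
  refine (abs_add_le _ _).trans ((add_le_add (abs_add_le _ _) (abs_add_le _ _)).trans ?_)
  have : 0 ≤ E * √x := by positivity
  linarith

lemma abs_primePiMod_sub_le_three_mul {q : ℕ} [NeZero q] (a : ℤ) {x : ℝ} (hx : 2 ≤ x) :
    |(primePiMod x q a : ℝ) - (1 / q.totient) * ∫ t in (2 : ℝ)..x, 1 / Real.log t| ≤ 3 * x := by
  have hφ : (1 : ℝ) ≤ q.totient := by exact_mod_cast Nat.totient_pos.2 (NeZero.pos q)
  have hl2 : 1 / 2 ≤ Real.log 2 := by linarith [Real.log_two_gt_d9]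
  have h1 : (primePiMod x q a : ℝ) ≤ x := by
    refine le_trans ?_ (Nat.floor_le (by linarith : 0 ≤ x))
    exact_mod_cast (Finset.card_filter_le _ _).trans (by simp)
  have h2 : ‖∫ t in (2 : ℝ)..x, 1 / Real.log t‖ ≤ 2 * |x - 2| :=
    intervalIntegral.norm_integral_le_of_norm_le_const fun t ht => by
      rw [uIoc_of_le hx] at ht
      have hlt : 1 / 2 ≤ Real.log t := hl2.trans (Real.log_le_log (by norm_num) ht.1.le)
      rw [Real.norm_eq_abs, abs_of_pos (by positivity), div_le_iff₀ (by positivity)]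
      linarith
  rw [abs_of_nonneg (by linarith), Real.norm_eq_abs] at h2
  refine (abs_sub _ _).trans ?_
  rw [abs_mul, Nat.abs_cast, abs_of_pos (by positivity : (0 : ℝ) < 1 / q.totient)]
  have : 1 / (q.totient : ℝ) * |∫ t in (2 : ℝ)..x, 1 / Real.log t| ≤ 1 * (2 * (x - 2)) := by
    gcongr
    rw [div_le_one (by linarith)]; exact hφ
  linarith

lemma sqrt_le_mul_exp_neg {x D : ℝ} (hx0 : 0 < x) (hx : 16 ≤ Real.log x) (hD : D ≤ 1) :
    √x ≤ x * Real.exp (-(D * √(Real.log x))) := by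
  set U := √(Real.log x) with hU
  have hU2 : U ^ 2 = Real.log x := Real.sq_sqrt (by linarith)
  have hU4 : 4 ≤ U := Real.le_sqrt_of_sq_le (by linarith)
  have hx' : x = Real.exp (U ^ 2) := by rw [hU2, Real.exp_log hx0]
  have hs : √x = Real.exp (U ^ 2 / 2) := by rw [hx', Real.exp_half]
  rw [hs, hx', ← Real.exp_add, Real.exp_le_exp]
  nlinarith

end SiegelWalfisz

/-- **Siegel–Walfisz theorem.** For every `C > 0` there are `D = D(C) > 0` and an
implied constant depending only on `C` such that for all `x ≥ 2`, `q ≤ (log x)^C`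
and `a` coprime to `q`,
`π(x; q, a) = (1/φ(q)) ∫_2^x dt/log t + O(x e^(-D √(log x)))`. -/
theorem siegel_walfisz (C : ℝ) (hC : 0 < C) :
    ∃ D : ℝ, 0 < D ∧ ∃ K : ℝ, 0 < K ∧
      ∀ x : ℝ, 2 ≤ x → ∀ q : ℕ, 0 < q → (q : ℝ) ≤ Real.log x ^ C →
        ∀ a : ℤ, IsCoprime a (q : ℤ) →
          |(primePiMod x q a : ℝ) - (1 / (Nat.totient q)) * ∫ t in (2 : ℝ)..x, 1 / Real.log t|
            ≤ K * x * Real.exp (-D * Real.sqrt (Real.log x)) := by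
  open SiegelWalfisz in
  obtain ⟨D, hD, hD1, K, hK, h⟩ := abs_thetaMod_sub_le (B := 2 * C) (by positivity)
  refine ⟨D / 2, by positivity, 2 * K + 16 + 3 * Real.exp 6, by positivity,
    fun x hx q hq0 hq a ha => ?_⟩
  have : NeZero q := ⟨hq0.ne'⟩
  have hx0 : 0 < x := by linarith
  rw [neg_mul]
  rcases le_or_gt 32 (Real.log x) with hlog | hlog
  · have hx4 : 4 ≤ x := by
      have := Real.log_le_sub_one_of_pos hx0
      linarith
    have hau : IsUnit (a : ZMod q) := (ZMod.coe_int_isUnit_iff_isCoprime a q).2 ha.symm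
    set ε := Real.exp (-(D / 2 * √(Real.log x))) with hε
    have key := abs_primePiMod_sub_le_of_thetaMod (q := q) a (E := K * ε) hx4 (by linarith)
      fun t ht => by
        have ht0 : 0 < t := (Real.sqrt_pos.2 hx0).trans_le ht.1
        have hlt : Real.log x / 2 ≤ Real.log t := by
          rw [← Real.log_sqrt hx0.le]
          exact Real.log_le_log (Real.sqrt_pos.2 hx0) ht.1
        have hqt : (q : ℝ) ≤ Real.log t ^ (2 * C) := by
          refine hq.trans ?_
          rw [Real.rpow_mul (by linarith)]
          refine Real.rpow_le_rpow (by linarith) ?_ hC.le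
          rw [Real.rpow_two]
          nlinarith
        have hV : √(Real.log x) / 2 ≤ √(Real.log t) := by
          refine Real.le_sqrt_of_sq_le ?_
          rw [div_pow, Real.sq_sqrt (by linarith)]
          linarith
        refine (h q a t hau ht0 (by linarith) hqt).trans ?_
        rw [mul_right_comm, hε, div_mul_eq_mul_div, mul_div_assoc]
        gcongr
    have hs := sqrt_le_mul_exp_neg (D := D / 2) hx0 (by linarith) (by linarith)
    rw [← hε] at hs
    have h6 : 0 ≤ 3 * Real.exp 6 * (x * ε) := by positivity
    linarith
  · have h1 := abs_primePiMod_sub_le_three_mul (q := q) a hx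
    have hs : √(Real.log x) ≤ 6 := Real.sqrt_le_iff.2 ⟨by norm_num, by linarith⟩
    have h2 : 1 ≤ Real.exp 6 * Real.exp (-(D / 2 * √(Real.log x))) := by
      rw [← Real.exp_add]
      refine Real.one_le_exp ?_
      nlinarith [Real.sqrt_nonneg (Real.log x)]
    have h3 : 0 ≤ (2 * K + 16) * x * Real.exp (-(D / 2 * √(Real.log x))) := by positivity
    nlinarith
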